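/- Let H be a bipartite graph on h vertices such that hcf(H) = 1. Then there exist positive integers m_0 and c_1(H) ≤ 4h³ such that for every balanced bipartite graph G on 2n = mh vertices with m ≥ m_0: if δ(G) ≥ (1 − 1/χ_cr(H))n + c_1(H), then G contains an H-factor. -/

import Mathlib

open Finset

attribute [local instance] Classical.propDecidable

namespace BipTiling

variable {α β V : Type*}

/-- A proper 2-coloring of the graph `H`. -/
def Proper2Coloring (H : SimpleGraph α) (c : α → Bool) : Prop :=
  ∀ ⦃a b : α⦄, H.Adj a b → c a ≠ c b

/-- `H` is bipartite, i.e. it admits a proper 2-coloring. -/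
def IsBip (H : SimpleGraph α) : Prop :=
  ∃ c : α → Bool, Proper2Coloring H c

/-- The size of the color class of color `i` under the 2-coloring `c`. -/
noncomputable def colorCard [Fintype α] (c : α → Bool) (i : Bool) : ℕ :=
  (Finset.univ.filter fun v => c v = i).card

/-- `σ(H)`: the smallest size of a color class over all proper 2-colorings of `H`. -/
noncomputable def sigmaBip [Fintype α] (H : SimpleGraph α) : ℕ :=
  sInf {k | ∃ c : α → Bool, Proper2Coloring H c ∧
    k = min (colorCard c true) (colorCard c false)}

/-- The finset of connected components of `H`. -/
noncomputable def comps [Fintype α] (H : SimpleGraph α) : Finset H.ConnectedComponent :=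
  Finset.univ.image H.connectedComponentMk

/-- `c_i`: the number of vertices of the connected component `K`. -/
noncomputable def compCard [Fintype α] (H : SimpleGraph α) (K : H.ConnectedComponent) : ℕ :=
  (Finset.univ.filter fun v => H.connectedComponentMk v = K).card

/-- `d_i = |W_i| - |U_i|`: the (absolute) difference of the sizes of the two color classes
of the component `K`, computed with respect to a proper 2-coloring `c` of `H`.
(For a proper 2-coloring this is independent of the choice of `c`, since the 2-coloring of a
connected bipartite graph is unique up to swapping the colors.) -/
noncomputable def compDiff [Fintype α] (H : SimpleGraph α) (c : α → Bool)
    (K : H.ConnectedComponent) : ℕ :=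
  (((Finset.univ.filter fun v => H.connectedComponentMk v = K ∧ c v = true).card : ℤ) -
    ((Finset.univ.filter fun v => H.connectedComponentMk v = K ∧ c v = false).card : ℤ)).natAbs

/-- `hcf_c(H) = gcd(c_1, …, c_k)`. -/
noncomputable def hcfC [Fintype α] (H : SimpleGraph α) : ℕ :=
  (comps H).gcd (compCard H)

/-- `hcf_{χ,c}(H) = gcd(d_1, …, d_k)`, with respect to a proper 2-coloring `c`. -/
noncomputable def hcfChiC [Fintype α] (H : SimpleGraph α) (c : α → Bool) : ℕ :=
  (comps H).gcd (compDiff H c)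

/-- `x_2 - x_1` for the 2-coloring `c`, where `x_1 ≤ x_2` are the sizes of its color classes. -/
noncomputable def colorDiff [Fintype α] (c : α → Bool) : ℕ :=
  ((colorCard c true : ℤ) - (colorCard c false : ℤ)).natAbs

/-- `hcf_χ(H)`: the gcd of the set `D(H)` of all differences `x_2 - x_1` of color class sizes
over all proper 2-colorings of `H` (`0` represents `∞`, i.e. `D(H) = {0}`). -/
noncomputable def hcfChi [Fintype α] (H : SimpleGraph α) : ℕ :=
  (Finset.univ.filter fun c : α → Bool => Proper2Coloring H c).gcd colorDiff

/-- `hcf(H) = 1` for a bipartite graph `H`: `hcf_c(H) = 1` and `hcf_χ(H) ≤ 2`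
(in particular `hcf_χ(H)` is finite, i.e. nonzero in our encoding). -/
def HcfOne [Fintype α] (H : SimpleGraph α) : Prop :=
  hcfC H = 1 ∧ 0 < hcfChi H ∧ hcfChi H ≤ 2

/-- `f` is a copy of `H` inside `G` (an injective graph homomorphism). -/
def IsCopy (H : SimpleGraph α) (G : SimpleGraph β) (f : α → β) : Prop :=
  Function.Injective f ∧ ∀ ⦃a b : α⦄, H.Adj a b → G.Adj (f a) (f b)

/-- `s` is an `H`-tiling of `G`: a finite collection of pairwise vertex-disjoint copies of `H`. -/
def IsHTiling (H : SimpleGraph α) (G : SimpleGraph β) (s : Finset (α → β)) : Prop :=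
  (∀ f ∈ s, IsCopy H G f) ∧
    ∀ f ∈ s, ∀ g ∈ s, f ≠ g → ∀ a b : α, f a ≠ g b

/-- The set of vertices covered by the tiling `s`. -/
noncomputable def coveredSet [Fintype α] [Fintype β] (s : Finset (α → β)) : Finset β :=
  s.biUnion fun f => Finset.univ.image f

/-- `G` has a perfect `H`-tiling (`H`-factor). -/
def HasHFactor [Fintype α] [Fintype β] (H : SimpleGraph α) (G : SimpleGraph β) : Prop :=
  ∃ s : Finset (α → β), IsHTiling H G s ∧ coveredSet s = Finset.univ

/-- `G` has an `H`-tiling covering all but at most `t` vertices. -/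
def HasHTilingMissingAtMost [Fintype α] [Fintype β] (H : SimpleGraph α) (G : SimpleGraph β)
    (t : ℕ) : Prop :=
  ∃ s : Finset (α → β), IsHTiling H G s ∧ (Finset.univ \ coveredSet s).card ≤ t

/-- `G` is a bipartite graph with partition sets `X` and `Y`, written `G[X,Y]`. -/
structure BipartiteWith [Fintype V] (G : SimpleGraph V) (X Y : Finset V) : Prop where
  disj : Disjoint X Y
  cover : X ∪ Y = Finset.univ
  cross : ∀ ⦃a b : V⦄, G.Adj a b → (a ∈ X ∧ b ∈ Y) ∨ (a ∈ Y ∧ b ∈ X)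

/-- `e(A,B)`: the number of edges of `G` between `A` and `B`. -/
noncomputable def eAB (G : SimpleGraph V) (A B : Finset V) : ℕ :=
  ((A ×ˢ B).filter fun p => G.Adj p.1 p.2).card

/-- The density `d(A,B) = e(A,B)/(|A||B|)`. -/
noncomputable def dens (G : SimpleGraph V) (A B : Finset V) : ℝ :=
  (eAB G A B : ℝ) / ((A.card : ℝ) * (B.card : ℝ))

/-- `|Γ(x) ∩ B|`: the number of neighbors of `x` in `B`. -/
noncomputable def degIn (G : SimpleGraph V) (x : V) (B : Finset V) : ℕ :=
  (B.filter fun y => G.Adj x y).card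

/-- The pair `(X,Y)` is `ε`-regular in `G`. -/
def EpsRegularPair (G : SimpleGraph V) (X Y : Finset V) (ε : ℝ) : Prop :=
  ∀ A ⊆ X, ∀ B ⊆ Y, ε * X.card < A.card → ε * Y.card < B.card →
    |dens G A B - dens G X Y| < ε

/-- The pair `(X,Y)` is `(ε,δ)`-super-regular in `G`. -/
def SuperRegularPair (G : SimpleGraph V) (X Y : Finset V) (ε δ : ℝ) : Prop :=
  EpsRegularPair G X Y ε ∧
    (∀ x ∈ X, δ * Y.card < (degIn G x Y : ℝ)) ∧
    (∀ y ∈ Y, δ * X.card < (degIn G y X : ℝ))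

/-- `G[X,Y]` has an almost `(ε,d,p,q,N)`-cover. -/
def HasAlmostCover [Fintype V] (G : SimpleGraph V) (X Y : Finset V) (ε d : ℝ) (p q N : ℕ) :
    Prop :=
  ∃ (X₀ Y₀ : Finset V) (k : ℕ) (P Q : Fin k → Finset V),
    X₀ ⊆ X ∧ Y₀ ⊆ Y ∧
    (X₀.card : ℝ) ≤ ε * X.card ∧ (Y₀.card : ℝ) ≤ ε * Y.card ∧
    ((X₀ ∪ Y₀) ∪ Finset.univ.biUnion fun i => P i ∪ Q i) = Finset.univ ∧
    (∀ i, Disjoint (X₀ ∪ Y₀) (P i ∪ Q i)) ∧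
    (∀ i j, i ≠ j → Disjoint (P i ∪ Q i) (P j ∪ Q j)) ∧
    (∀ i, Disjoint (P i) (Q i)) ∧
    (∀ i, SuperRegularPair G (P i) (Q i) ε d) ∧
    (∀ i, (P i ⊆ X ∧ Q i ⊆ Y) ∨ (P i ⊆ Y ∧ Q i ⊆ X)) ∧
    (∀ i, q * (P i).card = p * (Q i).card ∧ N * p ≤ (P i).card)

/-- `G[X,Y]` (with `|X| = |Y| = n`) is in the extremal case with parameter `a`:
there are `A ⊆ X`, `B ⊆ Y` with `|A| = |B| = ⌊wn/h⌋` and `d(A,B) ≤ a`. -/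
def ExtremalWith [Fintype V] (G : SimpleGraph V) (X Y : Finset V) (w h : ℕ) (a : ℝ) : Prop :=
  ∃ A ⊆ X, ∃ B ⊆ Y, A.card = w * X.card / h ∧ B.card = w * X.card / h ∧ dens G A B ≤ a

/-- `S` is the vertex set of an `H`-tiling of `G`. -/
def Tileable [Fintype α] [Fintype V] (H : SimpleGraph α) (G : SimpleGraph V) (S : Finset V) :
    Prop :=
  ∃ s : Finset (α → V), IsHTiling H G s ∧ coveredSet s = S

/-- All edges of `G` between `P` and `Q` are present. -/
def Cpl (G : SimpleGraph V) (P Q : Finset V) : Prop :=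
  ∀ p ∈ P, ∀ q ∈ Q, G.Adj p q

lemma Cpl.disjoint {G : SimpleGraph V} {P Q : Finset V} (h : Cpl G P Q) : Disjoint P Q := by
  rw [Finset.disjoint_left]
  intro a ha hb
  exact G.loopless.irrefl a (h a ha a hb)

lemma Cpl.symm {G : SimpleGraph V} {P Q : Finset V} (h : Cpl G P Q) : Cpl G Q P :=
  fun q hq p hp => (h p hp q hq).symm

lemma Cpl.mono {G : SimpleGraph V} {P Q P' Q' : Finset V} (h : Cpl G P Q) (hP : P' ⊆ P)
    (hQ : Q' ⊆ Q) : Cpl G P' Q' :=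
  fun p hp q hq => h p (hP hp) q (hQ hq)

section Tileable

variable [Fintype α] [Fintype V] {H : SimpleGraph α} {G : SimpleGraph V}

lemma tileable_empty : Tileable H G ∅ :=
  ⟨∅, ⟨by simp, by simp⟩, by simp [coveredSet]⟩

lemma mem_coveredSet {s : Finset (α → V)} {v : V} :
    v ∈ coveredSet s ↔ ∃ f ∈ s, ∃ a, f a = v := by
  simp [coveredSet]

lemma Tileable.union {S T : Finset V} (hS : Tileable H G S) (hT : Tileable H G T)
    (hd : Disjoint S T) : Tileable H G (S ∪ T) := by
  obtain ⟨s, ⟨hs1, hs2⟩, rfl⟩ := hS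
  obtain ⟨t, ⟨ht1, ht2⟩, rfl⟩ := hT
  rw [Finset.disjoint_left] at hd
  refine ⟨s ∪ t, ⟨?_, ?_⟩, ?_⟩
  · intro f hf
    rcases Finset.mem_union.1 hf with hf | hf
    exacts [hs1 f hf, ht1 f hf]
  · intro f hf g hg hfg a b hab
    rcases Finset.mem_union.1 hf with hf | hf <;> rcases Finset.mem_union.1 hg with hg | hg
    · exact hs2 f hf g hg hfg a b hab
    · exact hd (mem_coveredSet.2 ⟨f, hf, a, rfl⟩) (mem_coveredSet.2 ⟨g, hg, b, hab.symm⟩)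
    · exact hd (mem_coveredSet.2 ⟨g, hg, b, rfl⟩) (mem_coveredSet.2 ⟨f, hf, a, hab⟩)
    · exact ht2 f hf g hg hfg a b hab
  · ext v
    simp only [mem_coveredSet, Finset.mem_union]
    constructor
    · rintro ⟨f, hf | hf, a, rfl⟩
      exacts [Or.inl ⟨f, hf, a, rfl⟩, Or.inr ⟨f, hf, a, rfl⟩]
    · rintro (⟨f, hf, a, rfl⟩ | ⟨f, hf, a, rfl⟩)
      exacts [⟨f, Or.inl hf, a, rfl⟩, ⟨f, Or.inr hf, a, rfl⟩]

lemma Tileable.of_union_sdiff {S T : Finset V} (hT : Tileable H G T)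
    (hS : Tileable H G (S \ T)) (hTS : T ⊆ S) : Tileable H G S := by
  have := hT.union hS Finset.disjoint_sdiff
  rwa [Finset.union_sdiff_of_subset hTS] at this

lemma tileable_of_coloring {ι : Type*} [Fintype ι] (t : α → ι) (S : ι → Finset V)
    (hS : ∀ i j, i ≠ j → Disjoint (S i) (S j))
    (hc : ∀ i, (S i).card = (univ.filter fun a => t a = i).card)
    (hadj : ∀ a b, H.Adj a b → Cpl G (S (t a)) (S (t b))) :
    Tileable H G (univ.biUnion S) := by
  have e : ∀ i, {a // t a = i} ≃ S i := fun i => by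
    refine Fintype.equivOfCardEq ?_
    rw [Fintype.card_coe, hc, Fintype.card_subtype]
  let f : α → V := fun a => e (t a) ⟨a, rfl⟩
  have hf : ∀ a, f a ∈ S (t a) := fun a => (e (t a) ⟨a, rfl⟩).2
  have key : ∀ i (a b) (ha : t a = i) (hb : t b = i),
      (e i ⟨a, ha⟩ : V) = e i ⟨b, hb⟩ → a = b := by
    intro i a b ha hb hab
    have := (e i).injective (Subtype.ext hab)
    exact congrArg Subtype.val this
  have fe : ∀ i (a) (ha : t a = i), f a = e i ⟨a, ha⟩ := by
    rintro i a rfl; rfl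
  refine ⟨{f}, ⟨?_, ?_⟩, ?_⟩
  · intro g hg
    rw [Finset.mem_singleton] at hg
    subst hg
    refine ⟨?_, fun a b hab => hadj a b hab _ (hf a) _ (hf b)⟩
    intro a b hab
    by_cases hT : t a = t b
    · apply key (t b) a b hT rfl
      rw [← fe, ← fe, hab]
    · exact absurd (hab ▸ hf a) (Finset.disjoint_right.1 (hS _ _ hT) (hf b))
  · intro g hg g' hg' hne
    rw [Finset.mem_singleton] at hg hg'
    exact absurd (hg.trans hg'.symm) hne
  · ext v
    simp only [mem_coveredSet, Finset.mem_singleton, exists_eq_left, Finset.mem_biUnion,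
      Finset.mem_univ, true_and]
    constructor
    · rintro ⟨a, rfl⟩
      exact ⟨_, hf a⟩
    · rintro ⟨i, hv⟩
      obtain ⟨⟨a, ha⟩, hav⟩ := (e i).surjective ⟨v, hv⟩
      exact ⟨a, by rw [fe i a ha, hav]⟩

end Tileable

section Coloring

variable {H : SimpleGraph α}

/-- Recolor the component `K` by swapping the two colors. -/
noncomputable def flipComp (H : SimpleGraph α) (c : α → Bool) (K : H.ConnectedComponent) :
    α → Bool :=
  fun v => if H.connectedComponentMk v = K then !(c v) else c v

lemma comp_eq_of_adj {a b : α} (h : H.Adj a b) :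
    H.connectedComponentMk a = H.connectedComponentMk b :=
  SimpleGraph.ConnectedComponent.sound h.reachable

lemma Proper2Coloring.flipComp {c : α → Bool} (hc : Proper2Coloring H c)
    (K : H.ConnectedComponent) : Proper2Coloring H (flipComp H c K) := by
  intro a b hab
  have h1 := hc hab
  have h2 := comp_eq_of_adj hab
  unfold BipTiling.flipComp
  rw [h2]
  split_ifs
  · simpa using h1
  · exact h1

lemma Proper2Coloring.not {c : α → Bool} (hc : Proper2Coloring H c) :
    Proper2Coloring H (fun v => !(c v)) := by
  intro a b hab
  simpa using hc hab

lemma xor_eq_of_reachable {c c' : α → Bool} (hc : Proper2Coloring H c)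
    (hc' : Proper2Coloring H c') {a b : α} (h : H.Reachable a b) :
    xor (c a) (c' a) = xor (c b) (c' b) := by
  obtain ⟨p⟩ := h
  induction p with
  | nil => rfl
  | cons hab _ ih =>
    rw [← ih]
    have h1 := hc hab
    have h2 := hc' hab
    revert h1 h2
    generalize c _ = x1
    generalize c _ = x2
    generalize c' _ = x3
    generalize c' _ = x4
    revert x1 x2 x3 x4
    decide

end Coloring

section HData

variable [Fintype α] {H : SimpleGraph α}

/-- The number of vertices of color `b` in the component `K`. -/
noncomputable def compColor (H : SimpleGraph α) (c : α → Bool) (K : H.ConnectedComponent)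
    (b : Bool) : ℕ :=
  (univ.filter fun v => H.connectedComponentMk v = K ∧ c v = b).card

/-- A proper coloring of `H` with color classes of sizes `w` (true) and `u` (false), where `true`
is the majority color on every component. The component sizes are coprime, and so are the
differences of color class sizes of the components. -/
structure HData (H : SimpleGraph α) (u w : ℕ) (c : α → Bool) : Prop where
  proper : Proper2Coloring H c
  card_true : colorCard c true = w
  card_false : colorCard c false = u
  lt : u < w
  le : ∀ K, compColor H c K false ≤ compColor H c K true
  gcd_card : (comps H).gcd (fun K => compColor H c K true + compColor H c K false) = 1
  gcd_diff : (comps H).gcd (fun K => compColor H c K true - compColor H c K false) = 1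

lemma mem_comps (v : α) : H.connectedComponentMk v ∈ comps H := by
  exact Finset.mem_image_of_mem _ (Finset.mem_univ v)

lemma sum_compColor (c : α → Bool) (b : Bool) :
    ∑ K ∈ comps H, compColor H c K b = colorCard c b := by
  unfold compColor colorCard
  rw [Finset.card_eq_sum_card_fiberwise (f := H.connectedComponentMk) (t := comps H)
    (fun v _ => mem_comps v)]
  refine Finset.sum_congr rfl fun K _ => ?_
  rw [Finset.filter_filter]
  congr 1
  ext v
  simp [and_comm]

lemma compCard_eq (c : α → Bool) (K : H.ConnectedComponent) :
    compCard H K = compColor H c K true + compColor H c K false := by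
  unfold compCard compColor
  rw [← Finset.card_union_of_disjoint]
  · congr 1
    ext v
    cases hv : c v <;> simp [hv]
  · rw [Finset.disjoint_left]
    intro v
    simp only [Finset.mem_filter, Finset.mem_univ, true_and, not_and, and_imp]
    intro _ h1 _ h2
    simp [h1] at h2

lemma colorCard_add (c : α → Bool) :
    colorCard c true + colorCard c false = Fintype.card α := by
  have h := Finset.card_filter_add_card_filter_not (s := (univ : Finset α)) (fun v => c v = true)
  simpa [colorCard] using h

lemma colorCard_not (c : α → Bool) (b : Bool) :
    colorCard (fun v => !(c v)) b = colorCard c (!b) := by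
  unfold colorCard
  congr 1
  ext v
  cases b <;> simp

lemma colorCard_flipComp (c : α → Bool) (K : H.ConnectedComponent) (b : Bool) :
    colorCard (flipComp H c K) b + compColor H c K b = colorCard c b + compColor H c K (!b) := by
  have key : ∀ (c' : α → Bool), colorCard c' b =
      (univ.filter fun v => H.connectedComponentMk v = K ∧ c' v = b).card +
      (univ.filter fun v => H.connectedComponentMk v ≠ K ∧ c' v = b).card := by
    intro c'
    unfold colorCard
    rw [← Finset.card_filter_add_card_filter_not (fun v => H.connectedComponentMk v = K),
      Finset.filter_filter, Finset.filter_filter]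
    congr 2 <;> (ext v; simp [and_comm])
  rw [key (flipComp H c K), key c]
  have h1 : (univ.filter fun v => H.connectedComponentMk v = K ∧ flipComp H c K v = b) =
      univ.filter fun v => H.connectedComponentMk v = K ∧ c v = !b := by
    ext v
    rw [Finset.mem_filter, Finset.mem_filter]
    refine and_congr_right fun _ => and_congr_right fun h => ?_
    rw [flipComp, if_pos h]
    cases c v <;> cases b <;> simp
  have h2 : (univ.filter fun v => H.connectedComponentMk v ≠ K ∧ flipComp H c K v = b) =
      univ.filter fun v => H.connectedComponentMk v ≠ K ∧ c v = b := by
    ext v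
    rw [Finset.mem_filter, Finset.mem_filter]
    refine and_congr_right fun _ => and_congr_right fun h => ?_
    rw [flipComp, if_neg h]
  rw [h1, h2]
  unfold compColor
  omega

lemma compColor_other {c c' : α → Bool} (hc : Proper2Coloring H c)
    (hc' : Proper2Coloring H c') (K : H.ConnectedComponent) :
    (∀ b, compColor H c' K b = compColor H c K b) ∨
      (∀ b, compColor H c' K b = compColor H c K (!b)) := by
  induction K using SimpleGraph.ConnectedComponent.ind with
  | h v =>
    cases hv : xor (c v) (c' v)
    · left
      intro b
      unfold compColor
      congr 1
      ext x
      simp only [Finset.mem_filter, Finset.mem_univ, true_and]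
      refine and_congr_right fun h => ?_
      have := xor_eq_of_reachable hc hc' (SimpleGraph.ConnectedComponent.exact h)
      rw [hv] at this
      simp at this
      rw [this]
    · right
      intro b
      unfold compColor
      congr 1
      ext x
      simp only [Finset.mem_filter, Finset.mem_univ, true_and]
      refine and_congr_right fun h => ?_
      have := xor_eq_of_reachable hc hc' (SimpleGraph.ConnectedComponent.exact h)
      rw [hv] at this
      revert this
      cases c x <;> cases c' x <;> cases b <;> simp

lemma exists_hData (hbip : IsBip H) (hhcf : HcfOne H) :
    ∃ (w : ℕ) (c : α → Bool), HData H (sigmaBip H) w c ∧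
      sigmaBip H + w = Fintype.card α := by
  obtain ⟨h1, h2, h3⟩ := hhcf
  obtain ⟨c, hcm, hmin⟩ := Finset.exists_min_image
    (univ.filter fun c : α → Bool => Proper2Coloring H c) (fun c => colorCard c false)
    (by obtain ⟨c, hc⟩ := hbip; exact ⟨c, by simpa using hc⟩)
  have hc : Proper2Coloring H c := by simpa using hcm
  have hmin' : ∀ c', Proper2Coloring H c' → colorCard c false ≤ colorCard c' false :=
    fun c' hc' => hmin c' (by simpa using hc')
  have hle : ∀ K, compColor H c K false ≤ compColor H c K true := by
    intro K
    have e1 := hmin' _ (hc.flipComp K)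
    have e2 := colorCard_flipComp c K false
    simp only [Bool.not_false] at e2
    omega
  have hsum_le : colorCard c false ≤ colorCard c true := by
    rw [← sum_compColor (H := H), ← sum_compColor (H := H)]
    exact Finset.sum_le_sum fun K _ => hle K
  have hsig : sigmaBip H = colorCard c false := by
    unfold sigmaBip
    apply le_antisymm
    · exact Nat.sInf_le ⟨c, hc, by omega⟩
    · refine le_csInf ⟨_, c, hc, rfl⟩ ?_
      rintro k ⟨c', hc', rfl⟩
      have e1 := hmin' _ hc'
      have e2 := hmin' _ hc'.not
      rw [colorCard_not] at e2
      simp only [Bool.not_false] at e2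
      exact le_min e2 e1
  set g := (comps H).gcd (fun K => compColor H c K true - compColor H c K false) with hg
  have hgd : ∀ K ∈ comps H, (g : ℤ) ∣ (compColor H c K true : ℤ) - compColor H c K false := by
    intro K hK
    have := Finset.gcd_dvd (f := fun K => compColor H c K true - compColor H c K false) hK
    rw [← Nat.cast_sub (hle K)]
    exact_mod_cast this
  have hg_dvd : g ∣ hcfChi H := by
    unfold hcfChi
    apply Finset.dvd_gcd
    intro c' hc'
    have hc' : Proper2Coloring H c' := by simpa using hc'
    unfold colorDiff
    rw [← Int.natCast_dvd, ← sum_compColor (H := H), ← sum_compColor (H := H), Nat.cast_sum,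
      Nat.cast_sum, ← Finset.sum_sub_distrib]
    refine Finset.dvd_sum fun K hK => ?_
    rcases compColor_other hc hc' K with h | h
    · rw [h, h]
      exact hgd K hK
    · rw [h, h]
      have := (dvd_neg.2 (hgd K hK))
      simpa using this
  have hg1 : g = 1 := by
    have hgle := Nat.le_of_dvd h2 hg_dvd
    have hg0 : g ≠ 0 := by
      rintro h0
      rw [h0] at hg_dvd
      have := Nat.eq_zero_of_zero_dvd hg_dvd
      omega
    by_contra hne
    have hg2 : g = 2 := by omega
    have : 2 ∣ hcfC H := by
      unfold hcfC
      apply Finset.dvd_gcd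
      intro K hK
      have e1 := Finset.gcd_dvd (f := fun K => compColor H c K true - compColor H c K false) hK
      rw [← hg, hg2] at e1
      rw [compCard_eq c]
      have := hle K
      omega
    omega
  refine ⟨colorCard c true, c, ⟨hc, rfl, hsig.symm, ?_, hle, ?_, hg1⟩, ?_⟩
  · rw [hsig]
    refine lt_of_le_of_ne hsum_le fun heq => ?_
    rw [← sum_compColor (H := H), ← sum_compColor (H := H)] at heq
    have hall := (Finset.sum_eq_sum_iff_of_le fun K _ => hle K).1 heq
    have : g = 0 := by
      rw [hg, Finset.gcd_eq_zero_iff]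
      intro K hK
      rw [hall K hK, Nat.sub_self]
    omega
  · rw [← h1]
    unfold hcfC
    exact Finset.gcd_congr rfl fun K _ => (compCard_eq c K).symm
  · rw [hsig, add_comm]
    exact colorCard_add c

end HData

lemma exists_sum_mul_modEq {ι : Type*} (s : Finset ι) (f : ι → ℕ) (hg : s.gcd f = 1) {m : ℕ}
    (hm : 0 < m) (r : ℕ) :
    ∃ n : ι → ℕ, (∀ i, n i < m) ∧ ∑ i ∈ s, n i * f i ≡ r [MOD m] := by
  obtain ⟨x, hx⟩ := Finset.gcd_eq_sum_mul s (fun i => (f i : ℤ))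
  have hg' : s.gcd (fun i => (f i : ℤ)) = 1 := by
    have hu : IsUnit (s.gcd (fun i => (f i : ℤ))) := by
      rw [Int.isUnit_iff_natAbs_eq]
      rw [← Nat.dvd_one, ← hg]
      apply Finset.dvd_gcd
      intro i hi
      have := Finset.gcd_dvd (f := fun i => (f i : ℤ)) hi
      exact Int.natCast_dvd_natCast.1 (by simpa using this)
    have := normalize_eq_one.2 hu
    rwa [Finset.normalize_gcd] at this
  have hm' : (0 : ℤ) < m := by exact_mod_cast hm
  refine ⟨fun i => ((r * x i) % m).toNat, fun i => ?_, ?_⟩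
  · show ((r * x i) % (m : ℤ)).toNat < m
    have := Int.emod_lt_of_pos (r * x i) hm'
    have := Int.emod_nonneg (r * x i) hm'.ne'
    omega
  · rw [← Int.natCast_modEq_iff]
    push_cast
    have h1 : ∀ i ∈ s, ((((r * x i) % (m : ℤ)).toNat : ℕ) : ℤ) * f i ≡ r * x i * f i [ZMOD m] := by
      intro i _
      rw [Int.toNat_of_nonneg (Int.emod_nonneg _ hm'.ne')]
      exact (Int.mod_modEq _ _).mul_right _
    calc ∑ i ∈ s, ((((r * x i) % (m : ℤ)).toNat : ℕ) : ℤ) * f i ≡ ∑ i ∈ s, r * x i * f i [ZMOD m] := by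
          clear hx hg hg'
          induction s using Finset.induction_on with
          | empty => rfl
          | insert a s ha ih =>
            rw [Finset.sum_insert ha, Finset.sum_insert ha]
            exact (h1 a (by simp)).add (ih fun i hi => h1 i (by simp [hi]))
      _ = r := by
          rw [hg'] at hx
          calc ∑ i ∈ s, r * x i * f i = r * ∑ i ∈ s, f i * x i := by
                rw [Finset.mul_sum]; exact Finset.sum_congr rfl fun i _ => by ring
            _ = r := by
              rw [show ∑ i ∈ s, (f i : ℤ) * x i = 1 from ?_, mul_one]
              rw [hx]

lemma union_sdiff_union_of_disjoint {A B A' B' : Finset V} (hA : A' ⊆ A) (hB : B' ⊆ B)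
    (hd : Disjoint A B) : (A ∪ B) \ (A' ∪ B') = (A \ A') ∪ (B \ B') := by
  have hd1 := Finset.disjoint_left.1 hd
  ext v
  have := @hA v
  have := @hB v
  have := @hd1 v
  simp only [Finset.mem_union, Finset.mem_sdiff]
  tauto

section Tiles

variable [Fintype α] [Fintype V] {H : SimpleGraph α} {G : SimpleGraph V}

lemma tileable_of_proper {c : α → Bool} (hc : Proper2Coloring H c) {P Q : Finset V}
    (hPQ : Cpl G P Q) (hP : P.card = colorCard c true) (hQ : Q.card = colorCard c false) :
    Tileable H G (P ∪ Q) := by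
  have := tileable_of_coloring (H := H) (G := G) c (fun b => if b then P else Q) ?_ ?_ ?_
  · convert this using 1
    ext v
    simp
  · intro i j hij
    cases i <;> cases j <;> simp at hij ⊢
    exacts [hPQ.symm.disjoint, hPQ.disjoint]
  · intro i
    cases i
    · simp only [hQ, colorCard, Bool.false_eq_true, if_false]
      congr!
    · simp only [hP, colorCard, if_true]
      congr!
  · intro a b hab
    have := hc hab
    revert this
    cases c a <;> cases c b <;> simp
    exacts [hPQ.symm, hPQ]

/-- All complete pairs with parts of sizes `x` and `y` are tileable. -/
def TileSize (H : SimpleGraph α) (G : SimpleGraph V) (x y : ℕ) : Prop :=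
  ∀ P Q, Cpl G P Q → P.card = x → Q.card = y → Tileable H G (P ∪ Q)

lemma TileSize.symm {x y : ℕ} (h : TileSize H G x y) : TileSize H G y x := by
  intro P Q hPQ hP hQ
  rw [Finset.union_comm]
  exact h Q P hPQ.symm hQ hP

lemma tileSize_zero : TileSize H G 0 0 := by
  intro P Q _ hP hQ
  rw [Finset.card_eq_zero] at hP hQ
  subst hP hQ
  simpa using tileable_empty

lemma TileSize.add {x y x' y' : ℕ} (h : TileSize H G x y) (h' : TileSize H G x' y') :
    TileSize H G (x + x') (y + y') := by
  intro P Q hPQ hP hQ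
  obtain ⟨P', hP', hP'c⟩ := Finset.exists_subset_card_eq (s := P) (n := x) (by omega)
  obtain ⟨Q', hQ', hQ'c⟩ := Finset.exists_subset_card_eq (s := Q) (n := y) (by omega)
  have h1 := h P' Q' (hPQ.mono hP' hQ') hP'c hQ'c
  have h2 := h' (P \ P') (Q \ Q') (hPQ.mono sdiff_subset sdiff_subset)
    (by rw [Finset.card_sdiff_of_subset hP']; omega) (by rw [Finset.card_sdiff_of_subset hQ']; omega)
  refine Tileable.of_union_sdiff h1 ?_ (Finset.union_subset_union hP' hQ')
  rwa [union_sdiff_union_of_disjoint hP' hQ' hPQ.disjoint]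

lemma TileSize.mul {x y : ℕ} (h : TileSize H G x y) (n : ℕ) : TileSize H G (n * x) (n * y) := by
  induction n with
  | zero => simpa using tileSize_zero
  | succ n ih => simpa [Nat.succ_mul] using ih.add h

lemma TileSize.sum {ι : Type*} (s : Finset ι) {x y : ι → ℕ}
    (h : ∀ i ∈ s, TileSize H G (x i) (y i)) :
    TileSize H G (∑ i ∈ s, x i) (∑ i ∈ s, y i) := by
  induction s using Finset.induction_on with
  | empty => simpa using tileSize_zero
  | insert a s ha ih =>
    rw [Finset.sum_insert ha, Finset.sum_insert ha]
    exact (h a (by simp)).add (ih fun i hi => h i (by simp [hi]))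

/-- The union of any two disjoint complete pairs with parts of sizes `x`, `y` and `x'`, `y'` is
tileable. -/
def TileSize₂ (H : SimpleGraph α) (G : SimpleGraph V) (x y x' y' : ℕ) : Prop :=
  ∀ P Q P' Q', Cpl G P Q → Cpl G P' Q' → Disjoint (P ∪ Q) (P' ∪ Q') → P.card = x →
    Q.card = y → P'.card = x' → Q'.card = y' → Tileable H G ((P ∪ Q) ∪ (P' ∪ Q'))

lemma tileSize₂_zero : TileSize₂ H G 0 0 0 0 := by
  intro P Q P' Q' _ _ _ hP hQ hP' hQ'
  rw [Finset.card_eq_zero] at hP hQ hP' hQ'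
  subst hP hQ hP' hQ'
  simpa using tileable_empty

lemma TileSize₂.add {x y x' y' z t z' t' : ℕ} (h : TileSize₂ H G x y x' y')
    (h' : TileSize₂ H G z t z' t') : TileSize₂ H G (x + z) (y + t) (x' + z') (y' + t') := by
  intro P Q P' Q' hPQ hPQ' hd hP hQ hP' hQ'
  obtain ⟨P1, hP1, hP1c⟩ := Finset.exists_subset_card_eq (s := P) (n := x) (by omega)
  obtain ⟨Q1, hQ1, hQ1c⟩ := Finset.exists_subset_card_eq (s := Q) (n := y) (by omega)
  obtain ⟨P2, hP2, hP2c⟩ := Finset.exists_subset_card_eq (s := P') (n := x') (by omega)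
  obtain ⟨Q2, hQ2, hQ2c⟩ := Finset.exists_subset_card_eq (s := Q') (n := y') (by omega)
  have h1 := h P1 Q1 P2 Q2 (hPQ.mono hP1 hQ1) (hPQ'.mono hP2 hQ2)
    (hd.mono (Finset.union_subset_union hP1 hQ1) (Finset.union_subset_union hP2 hQ2))
    hP1c hQ1c hP2c hQ2c
  have h2 := h' (P \ P1) (Q \ Q1) (P' \ P2) (Q' \ Q2) (hPQ.mono sdiff_subset sdiff_subset)
    (hPQ'.mono sdiff_subset sdiff_subset)
    (hd.mono (Finset.union_subset_union sdiff_subset sdiff_subset)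
      (Finset.union_subset_union sdiff_subset sdiff_subset))
    (by rw [Finset.card_sdiff_of_subset hP1]; omega)
    (by rw [Finset.card_sdiff_of_subset hQ1]; omega)
    (by rw [Finset.card_sdiff_of_subset hP2]; omega)
    (by rw [Finset.card_sdiff_of_subset hQ2]; omega)
  refine Tileable.of_union_sdiff h1 ?_ (Finset.union_subset_union
    (Finset.union_subset_union hP1 hQ1) (Finset.union_subset_union hP2 hQ2))
  rwa [union_sdiff_union_of_disjoint (Finset.union_subset_union hP1 hQ1)
    (Finset.union_subset_union hP2 hQ2) hd, union_sdiff_union_of_disjoint hP1 hQ1 hPQ.disjoint,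
    union_sdiff_union_of_disjoint hP2 hQ2 hPQ'.disjoint]

lemma TileSize₂.mul {x y x' y' : ℕ} (h : TileSize₂ H G x y x' y') (n : ℕ) :
    TileSize₂ H G (n * x) (n * y) (n * x') (n * y') := by
  induction n with
  | zero => simpa using tileSize₂_zero
  | succ n ih => simpa [Nat.succ_mul] using ih.add h

lemma TileSize₂.sum {ι : Type*} (s : Finset ι) {x y x' y' : ι → ℕ}
    (h : ∀ i ∈ s, TileSize₂ H G (x i) (y i) (x' i) (y' i)) :
    TileSize₂ H G (∑ i ∈ s, x i) (∑ i ∈ s, y i) (∑ i ∈ s, x' i) (∑ i ∈ s, y' i) := by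
  induction s using Finset.induction_on with
  | empty => simpa using tileSize₂_zero
  | insert a s ha ih =>
    simp only [Finset.sum_insert ha]
    exact (h a (by simp)).add (ih fun i hi => h i (by simp [hi]))

end Tiles

namespace HData

variable [Fintype α] [Fintype V] {H : SimpleGraph α} {G : SimpleGraph V} {u w : ℕ}
  {c : α → Bool}

lemma card_eq (D : HData H u w c) : Fintype.card α = u + w := by
  rw [← D.card_true, ← D.card_false, add_comm, colorCard_add]

lemma tileSize (D : HData H u w c) : TileSize H G w u := fun _ _ hPQ hP hQ =>
  tileable_of_proper D.proper hPQ (hP.trans D.card_true.symm) (hQ.trans D.card_false.symm)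

lemma compColor_le (_ : HData H u w c) (K : H.ConnectedComponent) (b : Bool) :
    compColor H c K b ≤ colorCard c b :=
  Finset.card_le_card fun v => by simp

lemma tileSize_flip (D : HData H u w c) (K : H.ConnectedComponent) :
    TileSize H G (w - (compColor H c K true - compColor H c K false))
      (u + (compColor H c K true - compColor H c K false)) := by
  intro P Q hPQ hP hQ
  have h1 := colorCard_flipComp c K true
  have h2 := colorCard_flipComp c K false
  have h3 := D.le K
  have h4 := D.compColor_le K true
  have := D.card_true
  have := D.card_false
  simp only [Bool.not_true, Bool.not_false] at h1 h2
  exact tileable_of_proper (D.proper.flipComp K) hPQ (by omega) (by omega)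

lemma tileSize_split (D : HData H u w c) (K : H.ConnectedComponent) :
    TileSize₂ H G (compColor H c K true) (compColor H c K false)
      (w - compColor H c K true) (u - compColor H c K false) := by
  intro P Q P' Q' hPQ hPQ' hd hP hQ hP' hQ'
  have hd1 := Finset.disjoint_left.1 hd
  simp only [Finset.mem_union] at hd1
  have := tileable_of_coloring (H := H) (G := G)
    (fun a => (decide (H.connectedComponentMk a = K), c a))
    (fun b => if b.1 then (if b.2 then P else Q) else (if b.2 then P' else Q')) ?_ ?_ ?_
  · convert this using 1
    ext v
    simp
    tauto
  · have e1 := hPQ.disjoint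
    have e2 := hPQ'.disjoint
    have e3 : Disjoint P P' := hd.mono subset_union_left subset_union_left
    have e4 : Disjoint P Q' := hd.mono subset_union_left subset_union_right
    have e5 : Disjoint Q P' := hd.mono subset_union_right subset_union_left
    have e6 : Disjoint Q Q' := hd.mono subset_union_right subset_union_right
    rintro ⟨_ | _, _ | _⟩ ⟨_ | _, _ | _⟩ hij <;> simp at hij ⊢ <;>
      first | assumption | (rw [disjoint_comm]; assumption)
  · have key : ∀ b, (univ.filter fun a => H.connectedComponentMk a ≠ K ∧ c a = b).card =
        colorCard c b - compColor H c K b := by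
      intro b
      unfold colorCard compColor
      have : (univ.filter fun v => c v = b).card =
          (univ.filter fun a => H.connectedComponentMk a = K ∧ c a = b).card +
          (univ.filter fun a => H.connectedComponentMk a ≠ K ∧ c a = b).card := by
        rw [← Finset.card_union_of_disjoint]
        · congr 1
          ext a
          simp only [Finset.mem_filter, Finset.mem_univ, true_and, Finset.mem_union]
          tauto
        · rw [Finset.disjoint_left]
          intro a
          simp
          tauto
      omega
    have ht := D.card_true
    have hf := D.card_false
    rintro ⟨_ | _, _ | _⟩ <;> simp only [Prod.mk.injEq, decide_eq_true_eq, decide_eq_false_iff_not]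
    · rw [key]; simp; omega
    · rw [key]; simp; omega
    · simpa [compColor] using hQ
    · simpa [compColor] using hP
  · intro a b hab
    have h1 := D.proper hab
    simp only [comp_eq_of_adj hab]
    revert h1
    cases c a <;> cases c b <;> by_cases hK : H.connectedComponentMk b = K <;> simp [hK]
    exacts [hPQ.symm, hPQ'.symm, hPQ, hPQ']

end HData

lemma Tileable.dvd_card [Fintype α] [Fintype V] {H : SimpleGraph α} {G : SimpleGraph V}
    {S : Finset V} (hS : Tileable H G S) : Fintype.card α ∣ S.card := by
  obtain ⟨s, ⟨hs1, hs2⟩, rfl⟩ := hS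
  unfold coveredSet
  rw [Finset.card_biUnion]
  · refine Finset.dvd_sum fun f hf => ?_
    rw [Finset.card_image_of_injective _ (hs1 f hf).1, Finset.card_univ]
  · intro f hf g hg hfg
    show Disjoint _ _
    rw [Finset.disjoint_left]
    intro v hv hv'
    simp only [Finset.mem_image, Finset.mem_univ, true_and] at hv hv'
    obtain ⟨a, rfl⟩ := hv
    obtain ⟨b, hb⟩ := hv'
    exact hs2 f hf g hg hfg a b hb.symm

/-- A complete pair whose part sizes are far from the extreme ratios `u : w` and `w : u`. -/
structure Gd (G : SimpleGraph V) (u w C : ℕ) (P Q : Finset V) : Prop where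
  cpl : Cpl G P Q
  left : u * P.card + C ≤ w * Q.card
  right : u * Q.card + C ≤ w * P.card

lemma Gd.anti {G : SimpleGraph V} {u w C C' : ℕ} {P Q : Finset V} (h : Gd G u w C P Q)
    (hC : C' ≤ C) : Gd G u w C' P Q :=
  ⟨h.cpl, (Nat.add_le_add_left hC _).trans h.left, (Nat.add_le_add_left hC _).trans h.right⟩

lemma union_union_sdiff_of_subset {S A B : Finset V} (h : A ⊆ S) :
    (A ∪ B) ∪ (S \ A) = S ∪ B := by
  ext v
  have := @h v
  simp only [Finset.mem_union, Finset.mem_sdiff]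
  tauto

lemma union_union_sdiff_union {S Z R B : Finset V} (h1 : Disjoint Z R)
    (h2 : Disjoint S R) (h3 : Disjoint S Z) (h : B ⊆ Z) :
    (S ∪ (Z ∪ R)) \ (S ∪ B) = (Z \ B) ∪ R := by
  rw [Finset.disjoint_left] at h1 h2 h3
  ext v
  have := @h v
  have := @h1 v
  have := @h2 v
  have := @h3 v
  simp only [Finset.mem_union, Finset.mem_sdiff]
  tauto

namespace HData

section

variable [Fintype α] {H : SimpleGraph α} {u w : ℕ} {c : α → Bool}

lemma card_comps_le (D : HData H u w c) : (comps H).card ≤ u + w := by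
  rw [← D.card_eq, ← Finset.card_univ]
  exact Finset.card_image_le

lemma sum_true (D : HData H u w c) : ∑ K ∈ comps H, compColor H c K true = w := by
  rw [sum_compColor, D.card_true]

lemma sum_false (D : HData H u w c) : ∑ K ∈ comps H, compColor H c K false = u := by
  rw [sum_compColor, D.card_false]

end

variable [Fintype α] [Fintype V] {H : SimpleGraph α} {G : SimpleGraph V} {u w : ℕ}
  {c : α → Bool}

/-- A complete pair of part sizes far from extreme is tileable as soon as its size is divisible
by the order of `H`. -/
lemma tileable_of_gd (D : HData H u w c) {P Q : Finset V} (hg : Gd G u w ((u + w) ^ 4) P Q)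
    (hdvd : u + w ∣ P.card + Q.card) : Tileable H G (P ∪ Q) := by
  obtain ⟨hcpl, hl, hr⟩ := hg
  obtain ⟨k, hk⟩ := hdvd
  have huw := D.lt
  set h := u + w with hh
  have hpos : 0 < h := by omega
  obtain ⟨d, hd⟩ : ∃ d, w = u + d := ⟨w - u, by omega⟩
  have hdpos : 0 < d := by omega
  have hF1 : P.card + h ^ 3 ≤ w * k := by
    have : h * (P.card + h ^ 3) ≤ h * (w * k) := by
      have e : h * (w * k) = w * P.card + w * Q.card := by rw [← mul_add, hk]; ring
      have e' : h * (P.card + h ^ 3) = w * P.card + (u * P.card + h ^ 4) := by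
        rw [hh]; ring
      omega
    exact Nat.le_of_mul_le_mul_left this hpos
  have hF2 : u * k + h ^ 3 ≤ P.card := by
    have : h * (u * k + h ^ 3) ≤ h * P.card := by
      have e : h * (u * k + h ^ 3) = u * P.card + (u * Q.card + h ^ 4) := by
        have : h * (u * k + h ^ 3) = u * (h * k) + h ^ 4 := by ring
        rw [this, ← hk]; ring
      have e' : h * P.card = u * P.card + w * P.card := by rw [hh]; ring
      omega
    exact Nat.le_of_mul_le_mul_left this hpos
  obtain ⟨F, hF⟩ : ∃ F, w * k = P.card + F := ⟨w * k - P.card, by omega⟩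
  have hFh : h ^ 3 ≤ F := by omega
  obtain ⟨m, hm, hmod⟩ := exists_sum_mul_modEq _ _ D.gcd_diff hdpos F
  set dK := fun K => compColor H c K true - compColor H c K false with hdK
  set s := ∑ K ∈ comps H, m K * dK K with hs
  have hsumd : ∑ K ∈ comps H, dK K = d := by
    have h1 : ∑ K ∈ comps H, (dK K + compColor H c K false) = w := by
      rw [← D.sum_true]
      refine Finset.sum_congr rfl fun K _ => ?_
      have := D.le K
      simp only [hdK]; omega
    rw [Finset.sum_add_distrib, D.sum_false] at h1
    omega
  have hsd : s ≤ d * d := by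
    calc s ≤ ∑ K ∈ comps H, d * dK K :=
          Finset.sum_le_sum fun K _ => Nat.mul_le_mul_right _ (hm K).le
      _ = d * d := by rw [← Finset.mul_sum, hsumd]
  have hdh : d ≤ h := by omega
  have h2 : d * d ≤ h ^ 3 := by
    calc d * d ≤ h * h := Nat.mul_le_mul hdh hdh
      _ ≤ h ^ 3 := by nlinarith [Nat.mul_pos hpos hpos]
  have hsF : s ≤ F := by omega
  obtain ⟨n2, hn2⟩ := (Nat.modEq_iff_dvd' hsF).1 hmod
  set μ := ∑ K ∈ comps H, m K with hμ
  have hμh : μ ≤ h * h := by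
    calc μ ≤ ∑ K ∈ comps H, h := Finset.sum_le_sum fun K _ => (hm K).le.trans hdh
      _ = (comps H).card * h := by simp
      _ ≤ h * h := Nat.mul_le_mul_right _ D.card_comps_le
  have hle : n2 + μ ≤ k := by
    have e : d * (n2 + μ) ≤ d * k := by
      have e1 : d * μ ≤ h ^ 3 := by
        calc d * μ ≤ h * (h * h) := Nat.mul_le_mul hdh hμh
          _ = h ^ 3 := by ring
      have e2 : w * k = u * k + d * k := by rw [hd]; ring
      have e3 : d * (n2 + μ) = d * n2 + d * μ := by ring
      omega
    exact Nat.le_of_mul_le_mul_left e hdpos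
  obtain ⟨n1, hn1⟩ := Nat.exists_eq_add_of_le hle
  have hdw : ∀ K, dK K ≤ w := fun K => by
    have := D.compColor_le K true
    rw [D.card_true] at this
    simp only [hdK]; omega
  have t := ((D.tileSize (G := G)).mul n1).add (((D.tileSize (G := G)).symm.mul n2).add
    (TileSize.sum (comps H) fun K _ => (D.tileSize_flip (G := G) K).mul (m K)))
  have es1 : ∑ K ∈ comps H, m K * (w - dK K) + s = μ * w := by
    rw [hs, ← Finset.sum_add_distrib, hμ, Finset.sum_mul]
    refine Finset.sum_congr rfl fun K _ => ?_
    rw [← mul_add, Nat.sub_add_cancel (hdw K)]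
  have es2 : ∑ K ∈ comps H, m K * (u + dK K) = μ * u + s := by
    rw [hs, hμ, Finset.sum_mul, ← Finset.sum_add_distrib]
    exact Finset.sum_congr rfl fun K _ => by ring
  have hF' : F = d * n2 + s := by omega
  have hkeq : w * k = w * n2 + w * μ + w * n1 := by rw [hn1]; ring
  have hkeq' : u * k = u * n2 + u * μ + u * n1 := by rw [hn1]; ring
  have hwn : w * n2 = u * n2 + d * n2 := by rw [hd]; ring
  have hhk : h * k = u * k + w * k := by rw [hh]; ring
  refine t P Q hcpl ?_ ?_
  · show P.card = n1 * w + (n2 * u + ∑ K ∈ comps H, m K * (w - dK K))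
    rw [mul_comm n1, mul_comm n2]
    rw [mul_comm μ] at es1
    omega
  · show Q.card = n1 * u + (n2 * w + ∑ K ∈ comps H, m K * (u + dK K))
    rw [es2, mul_comm n1, mul_comm n2, mul_comm μ]
    omega

lemma tileable_blocks_aux {ι : Type*} (D : HData H u w c) (P Q : ι → Finset V) (I : Finset ι) :
    ∀ (P₀ Q₀ : Finset V), Gd G u w (2 * (u + w) ^ 4) P₀ Q₀ →
    (∀ i ∈ I, Gd G u w (3 * (u + w) ^ 4) (P i) (Q i)) →
    (∀ i ∈ I, Disjoint (P₀ ∪ Q₀) (P i ∪ Q i)) →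
    (∀ i ∈ I, ∀ j ∈ I, i ≠ j → Disjoint (P i ∪ Q i) (P j ∪ Q j)) →
    u + w ∣ ((P₀ ∪ Q₀) ∪ I.biUnion fun i => P i ∪ Q i).card →
    Tileable H G ((P₀ ∪ Q₀) ∪ I.biUnion fun i => P i ∪ Q i) := by
  induction I using Finset.induction_on with
  | empty =>
    intro P₀ Q₀ h0 _ _ _ hdvd
    simp only [Finset.biUnion_empty, Finset.union_empty] at hdvd ⊢
    rw [Finset.card_union_of_disjoint h0.cpl.disjoint] at hdvd
    exact D.tileable_of_gd (h0.anti (by omega)) hdvd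
  | insert a I ha ih =>
    intro P₀ Q₀ h0 hI hd0 hdI hdvd
    have hu := D.lt
    have hpos : 0 < u + w := by omega
    obtain ⟨m, hm, hmod⟩ := exists_sum_mul_modEq _ _ D.gcd_card hpos (P₀.card + Q₀.card)
    have t := TileSize₂.sum (comps H) fun K _ => (D.tileSize_split (G := G) K).mul (m K)
    set x := ∑ K ∈ comps H, m K * compColor H c K true with hx
    set y := ∑ K ∈ comps H, m K * compColor H c K false with hy
    set x' := ∑ K ∈ comps H, m K * (w - compColor H c K true) with hx'
    set y' := ∑ K ∈ comps H, m K * (u - compColor H c K false) with hy'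
    have hxle : x ≤ (u + w) * w := by
      calc x ≤ ∑ K ∈ comps H, (u + w) * compColor H c K true :=
            Finset.sum_le_sum fun K _ => Nat.mul_le_mul_right _ (hm K).le
        _ = (u + w) * w := by rw [← Finset.mul_sum, D.sum_true]
    have hyle : y ≤ (u + w) * u := by
      calc y ≤ ∑ K ∈ comps H, (u + w) * compColor H c K false :=
            Finset.sum_le_sum fun K _ => Nat.mul_le_mul_right _ (hm K).le
        _ = (u + w) * u := by rw [← Finset.mul_sum, D.sum_false]
    have aux : ∀ z : ℕ, (comps H).card * ((u + w) * z) ≤ (u + w) * ((u + w) * z) := fun z =>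
      Nat.mul_le_mul_right _ D.card_comps_le
    have hx'le : x' ≤ (u + w) * ((u + w) * w) := by
      calc x' ≤ ∑ K ∈ comps H, (u + w) * w :=
            Finset.sum_le_sum fun K _ => Nat.mul_le_mul (hm K).le (Nat.sub_le _ _)
        _ ≤ _ := by simpa using aux w
    have hy'le : y' ≤ (u + w) * ((u + w) * u) := by
      calc y' ≤ ∑ K ∈ comps H, (u + w) * u :=
            Finset.sum_le_sum fun K _ => Nat.mul_le_mul (hm K).le (Nat.sub_le _ _)
        _ ≤ _ := by simpa using aux u
    have hga := hI a (by simp)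
    set h := u + w with hh
    have hwh : w ≤ h := by omega
    have huh : u ≤ h := by omega
    have hw2 : w * w ≤ h * h := Nat.mul_le_mul hwh hwh
    have huw2 : w * u ≤ h * h := Nat.mul_le_mul hwh huh
    have h4 : h ^ 4 = (h * h) * (h * h) := by ring
    have h2pos : 0 < h * h := Nat.mul_pos hpos hpos
    have hhh : h ≤ h * h := Nat.le_mul_of_pos_left h hpos
    have bx' : w * x' ≤ h ^ 4 := by
      calc w * x' ≤ w * (h * (h * w)) := Nat.mul_le_mul_left _ hx'le
        _ = h * h * (w * w) := by ring
        _ ≤ _ := by rw [h4]; exact Nat.mul_le_mul_left _ hw2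
    have by' : w * y' ≤ h ^ 4 := by
      calc w * y' ≤ w * (h * (h * u)) := Nat.mul_le_mul_left _ hy'le
        _ = h * h * (w * u) := by ring
        _ ≤ _ := by rw [h4]; exact Nat.mul_le_mul_left _ huw2
    have bx : w * x ≤ h ^ 4 := by
      calc w * x ≤ w * (h * w) := Nat.mul_le_mul_left _ hxle
        _ = h * (w * w) := by ring
        _ ≤ _ := by rw [h4]; exact Nat.mul_le_mul hhh hw2
    have by0 : w * y ≤ h ^ 4 := by
      calc w * y ≤ w * (h * u) := Nat.mul_le_mul_left _ hyle
        _ = h * (w * u) := by ring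
        _ ≤ _ := by rw [h4]; exact Nat.mul_le_mul hhh huw2
    have hwpos : 0 < w := by omega
    have fit : ∀ z p q C : ℕ, w * z ≤ h ^ 4 → u * q + (C + h ^ 4) ≤ w * p → z ≤ p := by
      intro z p q C h1 h2
      have : w * z ≤ w * p := by omega
      exact Nat.le_of_mul_le_mul_left this hwpos
    have fx := fit x P₀.card Q₀.card (h ^ 4) bx (by linarith [h0.right])
    have fy := fit y Q₀.card P₀.card (h ^ 4) by0 (by linarith [h0.left])
    have fx' := fit x' (P a).card (Q a).card (2 * h ^ 4) bx' (by linarith [hga.right])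
    have fy' := fit y' (Q a).card (P a).card (2 * h ^ 4) by' (by linarith [hga.left])
    obtain ⟨P1, hP1, hP1c⟩ := Finset.exists_subset_card_eq fx
    obtain ⟨Q1, hQ1, hQ1c⟩ := Finset.exists_subset_card_eq fy
    obtain ⟨P2, hP2, hP2c⟩ := Finset.exists_subset_card_eq fx'
    obtain ⟨Q2, hQ2, hQ2c⟩ := Finset.exists_subset_card_eq fy'
    have hd0a := hd0 a (by simp)
    have s1 : P1 ∪ Q1 ⊆ P₀ ∪ Q₀ := Finset.union_subset_union hP1 hQ1
    have s2 : P2 ∪ Q2 ⊆ P a ∪ Q a := Finset.union_subset_union hP2 hQ2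
    have T1 : Tileable H G ((P1 ∪ Q1) ∪ (P2 ∪ Q2)) :=
      t P1 Q1 P2 Q2 (h0.cpl.mono hP1 hQ1) (hga.cpl.mono hP2 hQ2) (hd0a.mono s1 s2)
        hP1c hQ1c hP2c hQ2c
    have cut : ∀ {A B A' B' : Finset V} {C : ℕ}, A' ⊆ A → B' ⊆ B → w * B'.card ≤ h ^ 4 →
        u * A.card + (C + h ^ 4) ≤ w * B.card →
        u * (A \ A').card + C ≤ w * (B \ B').card := by
      intro A B A' B' C hA hB hw1 hw2
      have e1 := Nat.mul_le_mul_left u (Finset.card_le_card (sdiff_subset : A \ A' ⊆ A))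
      have e2 := Finset.card_sdiff_add_card_eq_card hB
      have e3 : w * B.card = w * (B \ B').card + w * B'.card := by rw [← e2]; ring
      omega
    have g0 : Gd G u w (h ^ 4) (P₀ \ P1) (Q₀ \ Q1) :=
      ⟨h0.cpl.mono sdiff_subset sdiff_subset,
        cut hP1 hQ1 (by rw [hQ1c]; exact by0) (by linarith [h0.left]),
        cut hQ1 hP1 (by rw [hP1c]; exact bx) (by linarith [h0.right])⟩
    have ga : Gd G u w (2 * h ^ 4) (P a \ P2) (Q a \ Q2) :=
      ⟨hga.cpl.mono sdiff_subset sdiff_subset,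
        cut hP2 hQ2 (by rw [hQ2c]; exact by') (by linarith [hga.left]),
        cut hQ2 hP2 (by rw [hP2c]; exact bx') (by linarith [hga.right])⟩
    have hdv0 : h ∣ (P₀ \ P1).card + (Q₀ \ Q1).card := by
      rw [Finset.card_sdiff_of_subset hP1, Finset.card_sdiff_of_subset hQ1, hP1c, hQ1c]
      have e : P₀.card - x + (Q₀.card - y) = P₀.card + Q₀.card - (x + y) := by omega
      rw [e]
      refine (Nat.modEq_iff_dvd' (by omega)).1 ?_
      rw [hx, hy, ← Finset.sum_add_distrib]
      simpa only [mul_add] using hmod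
    have T0 := D.tileable_of_gd g0 hdv0
    rw [← union_sdiff_union_of_disjoint hP1 hQ1 h0.cpl.disjoint] at T0
    set S0 := P₀ ∪ Q₀ with hS0
    set R := I.biUnion fun i => P i ∪ Q i with hR
    have hdR : Disjoint (P a ∪ Q a) R := by
      rw [hR, Finset.disjoint_biUnion_right]
      intro i hi
      exact hdI a (by simp) i (by simp [hi]) (by rintro rfl; exact ha hi)
    have hd0R : Disjoint S0 R := by
      rw [hR, Finset.disjoint_biUnion_right]
      exact fun i hi => hd0 i (by simp [hi])
    have TT : Tileable H G (S0 ∪ (P2 ∪ Q2)) := by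
      have := T1.union T0 (by
        rw [Finset.disjoint_union_left]
        refine ⟨Finset.disjoint_sdiff, ?_⟩
        exact (hd0a.symm.mono s2 sdiff_subset))
      rwa [union_union_sdiff_of_subset s1] at this
    have hrest : (S0 ∪ (insert a I).biUnion fun i => P i ∪ Q i) \ (S0 ∪ (P2 ∪ Q2)) =
        ((P a \ P2) ∪ (Q a \ Q2)) ∪ R := by
      rw [Finset.biUnion_insert, ← hR, ← union_sdiff_union_of_disjoint hP2 hQ2 hga.cpl.disjoint]
      exact union_union_sdiff_union hdR hd0R hd0a s2
    have hsub : S0 ∪ (P2 ∪ Q2) ⊆ S0 ∪ (insert a I).biUnion fun i => P i ∪ Q i := by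
      rw [Finset.biUnion_insert]
      exact Finset.union_subset_union subset_rfl (s2.trans subset_union_left)
    refine Tileable.of_union_sdiff TT ?_ hsub
    rw [hrest]
    refine ih _ _ ga (fun i hi => hI i (by simp [hi])) ?_
      (fun i hi j hj => hdI i (by simp [hi]) j (by simp [hj])) ?_
    · intro i hi
      refine (hdI a (by simp) i (by simp [hi]) (by rintro rfl; exact ha hi)).mono_left ?_
      exact Finset.union_subset_union sdiff_subset sdiff_subset
    · rw [← hrest, Finset.card_sdiff_of_subset hsub]
      have := TT.dvd_card
      rw [D.card_eq] at this
      exact Nat.dvd_sub hdvd this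

/-- A vertex-disjoint union of complete pairs with part sizes far from extreme is tileable as
soon as its size is divisible by the order of `H`. -/
lemma tileable_blocks {ι : Type*} (D : HData H u w c) (P Q : ι → Finset V) (I : Finset ι)
    (hI : ∀ i ∈ I, Gd G u w (3 * (u + w) ^ 4) (P i) (Q i))
    (hdI : ∀ i ∈ I, ∀ j ∈ I, i ≠ j → Disjoint (P i ∪ Q i) (P j ∪ Q j))
    (hdvd : u + w ∣ (I.biUnion fun i => P i ∪ Q i).card) :
    Tileable H G (I.biUnion fun i => P i ∪ Q i) := by
  rcases I.eq_empty_or_nonempty with rfl | ⟨a, ha⟩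
  · simpa using tileable_empty
  · rw [← Finset.insert_erase ha, Finset.biUnion_insert] at hdvd ⊢
    refine D.tileable_blocks_aux P Q (I.erase a) (P a) (Q a) ?_ ?_ ?_ ?_ hdvd
    · exact (hI a ha).anti (by omega)
    · exact fun i hi => hI i (Finset.mem_of_mem_erase hi)
    · exact fun i hi => hdI a ha i (Finset.mem_of_mem_erase hi) (Finset.ne_of_mem_erase hi).symm
    · exact fun i hi j hj => hdI i (Finset.mem_of_mem_erase hi) j (Finset.mem_of_mem_erase hj)

end HData

section Degrees

variable {G : SimpleGraph V}

lemma eAB_eq_sum (A B : Finset V) : eAB G A B = ∑ a ∈ A, degIn G a B := by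
  unfold eAB degIn
  simp only [Finset.card_filter]
  rw [Finset.sum_product]

lemma eAB_comm (A B : Finset V) : eAB G A B = eAB G B A := by
  unfold eAB
  simp only [Finset.card_filter]
  rw [Finset.sum_product_right, Finset.sum_product]
  refine Finset.sum_congr rfl fun a _ => Finset.sum_congr rfl fun b _ => ?_
  simp only [G.adj_comm]

lemma degIn_le_card (x : V) (B : Finset V) : degIn G x B ≤ B.card := Finset.card_filter_le _ _

lemma degIn_mono (x : V) {B C : Finset V} (h : B ⊆ C) : degIn G x B ≤ degIn G x C :=
  Finset.card_le_card (Finset.filter_subset_filter _ h)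

lemma degIn_union_le (x : V) (B C : Finset V) :
    degIn G x (B ∪ C) ≤ degIn G x B + degIn G x C := by
  unfold degIn
  rw [Finset.filter_union]
  exact Finset.card_union_le _ _

lemma degIn_biUnion_le {ι : Type*} (x : V) (s : Finset ι) (f : ι → Finset V) :
    degIn G x (s.biUnion f) ≤ ∑ i ∈ s, degIn G x (f i) := by
  unfold degIn
  rw [Finset.filter_biUnion]
  exact Finset.card_biUnion_le

lemma eAB_union_le (A B C : Finset V) : eAB G A (B ∪ C) ≤ eAB G A B + eAB G A C := by
  simp only [eAB_eq_sum, ← Finset.sum_add_distrib]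
  exact Finset.sum_le_sum fun a _ => degIn_union_le a B C

lemma eAB_biUnion_le {ι : Type*} (A : Finset V) (s : Finset ι) (f : ι → Finset V) :
    eAB G A (s.biUnion f) ≤ ∑ i ∈ s, eAB G A (f i) := by
  simp only [eAB_eq_sum]
  rw [Finset.sum_comm]
  exact Finset.sum_le_sum fun a _ => degIn_biUnion_le a s f

lemma eAB_mono {A B A' B' : Finset V} (hA : A' ⊆ A) (hB : B' ⊆ B) :
    eAB G A' B' ≤ eAB G A B :=
  Finset.card_le_card (Finset.filter_subset_filter _ (Finset.product_subset_product hA hB))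

lemma eAB_le_mul (A B : Finset V) : eAB G A B ≤ A.card * B.card := by
  rw [eAB_eq_sum]
  calc ∑ a ∈ A, degIn G a B ≤ ∑ a ∈ A, B.card := Finset.sum_le_sum fun a _ => degIn_le_card a B
    _ = A.card * B.card := by simp

lemma eAB_le_of_threshold (S T : Finset V) {x : ℝ} (hx : 0 ≤ x) :
    (eAB G S T : ℝ) ≤ T.card * (S.filter fun s => x ≤ degIn G s T).card + x * S.card := by
  rw [eAB_eq_sum]
  push_cast
  calc ∑ s ∈ S, (degIn G s T : ℝ)
      ≤ ∑ s ∈ S, ((if x ≤ degIn G s T then (T.card : ℝ) else 0) + x) := by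
        refine Finset.sum_le_sum fun s _ => ?_
        split_ifs with h
        · have : (degIn G s T : ℝ) ≤ T.card := by exact_mod_cast degIn_le_card s T
          linarith
        · push Not at h
          linarith
    _ = _ := by
        rw [Finset.sum_add_distrib, ← Finset.sum_filter]
        simp [mul_comm]

lemma exists_cpl_of_degIn (S T : Finset V) (k j : ℕ) (h : ∀ s ∈ S, k ≤ degIn G s T) (hj0 : 0 < j)
    (hj : 2 ^ T.card * j ≤ S.card) :
    ∃ S' ⊆ S, ∃ T' ⊆ T, S'.card = j ∧ T'.card = k ∧ Cpl G S' T' := by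
  have hex : ∀ s, ∃ R : Finset V, s ∈ S → R ⊆ (T.filter fun y => G.Adj s y) ∧ R.card = k := by
    intro s
    by_cases hs : s ∈ S
    · obtain ⟨R, hR, hRc⟩ := Finset.exists_subset_card_eq (h s hs)
      exact ⟨R, fun _ => ⟨hR, hRc⟩⟩
    · exact ⟨∅, fun h => absurd h hs⟩
  choose f hf using hex
  obtain ⟨R, hR, hRc⟩ := Finset.exists_le_card_fiber_of_mul_le_card_of_maps_to
    (s := S) (t := T.powerset) (f := f) (n := j)
    (fun s hs => Finset.mem_powerset.2 (((hf s hs).1).trans (Finset.filter_subset _ _)))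
    ⟨∅, by simp⟩ (by rwa [Finset.card_powerset])
  obtain ⟨S', hS', hS'c⟩ := Finset.exists_subset_card_eq hRc
  have hmem : ∀ s ∈ S', s ∈ S ∧ f s = R := fun s hs => by simpa using hS' hs
  obtain ⟨s₀, hs₀⟩ : S'.Nonempty := Finset.card_pos.1 (by omega)
  refine ⟨S', fun s hs => (hmem s hs).1, R, Finset.mem_powerset.1 hR, hS'c, ?_, ?_⟩
  · rw [← (hmem s₀ hs₀).2]
    exact (hf s₀ (hmem s₀ hs₀).1).2
  · intro s hs y hy
    rw [← (hmem s hs).2] at hy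
    exact (Finset.mem_filter.1 ((hf s (hmem s hs).1).1 hy)).2

/-- Dense bipartite graphs contain complete bipartite graphs of given size. -/
lemma exists_cpl_of_dense {γ : ℝ} (hγ : 0 < γ) (k j : ℕ) (hj' : 0 < j) :
    ∃ n₀ : ℕ, ∀ (V : Type) (G : SimpleGraph V) (A B : Finset V) (n : ℕ), n₀ ≤ n →
      A.card ≤ n → B.card ≤ n → γ * n ^ 2 ≤ eAB G A B →
      ∃ A' ⊆ A, ∃ B' ⊆ B, A'.card = k ∧ B'.card = j ∧ Cpl G A' B' := by
  obtain ⟨t, ht⟩ := exists_nat_gt (4 * (k + 1 : ℝ) / γ)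
  rw [div_lt_iff₀ hγ] at ht
  obtain ⟨n₀, hn₀⟩ := exists_nat_gt ((2 * t + 4 * (2 ^ t * j) : ℝ) / γ)
  rw [div_lt_iff₀ hγ] at hn₀
  refine ⟨n₀ + 1, fun V G A B n hn hA hB he => ?_⟩
  have hn' : (n₀ : ℝ) ≤ n := by exact_mod_cast (by omega : n₀ ≤ n)
  have hn1 : (0 : ℝ) < n := by exact_mod_cast (by omega : 0 < n)
  have hA' : (A.card : ℝ) ≤ n := by exact_mod_cast hA
  have hB' : (B.card : ℝ) ≤ n := by exact_mod_cast hB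
  have hnγ : 2 * t + 4 * (2 ^ t * j) < (n : ℝ) * γ :=
    hn₀.trans_le (mul_le_mul_of_nonneg_right hn' hγ.le)
  have ht0 : (0 : ℝ) < t := by
    by_contra h
    push Not at h
    have : (0 : ℝ) ≤ k := Nat.cast_nonneg k
    nlinarith
  set A₁ := A.filter fun a => γ / 2 * n ≤ degIn G a B with hA₁
  have h1 := eAB_le_of_threshold (G := G) A B (x := γ / 2 * n) (by positivity)
  rw [← hA₁] at h1
  have h2 : γ / 2 * n ≤ A₁.card := by
    have e1 : (B.card : ℝ) * A₁.card ≤ n * A₁.card :=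
      mul_le_mul_of_nonneg_right hB' (Nat.cast_nonneg _)
    have e2 : γ / 2 * n * A.card ≤ γ / 2 * n * n := mul_le_mul_of_nonneg_left hA' (by positivity)
    have e3 : n * (γ / 2 * n) ≤ (n : ℝ) * A₁.card := by nlinarith
    exact le_of_mul_le_mul_left e3 hn1
  have h3 : t ≤ A₁.card := by
    have : (0 : ℝ) ≤ 2 ^ t * j := by positivity
    have : (t : ℝ) ≤ A₁.card := by nlinarith
    exact_mod_cast this
  obtain ⟨A₂, hA₂, hA₂c⟩ := Finset.exists_subset_card_eq h3
  have h4 : t * (γ / 2 * n) ≤ eAB G A₂ B := by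
    rw [eAB_eq_sum]
    push_cast
    calc t * (γ / 2 * n) = ∑ a ∈ A₂, (γ / 2 * n) := by simp [hA₂c]
      _ ≤ _ := Finset.sum_le_sum fun a ha => (Finset.mem_filter.1 (hA₂ ha)).2
  rw [eAB_comm] at h4
  have h5 := eAB_le_of_threshold (G := G) B A₂ (x := t * γ / 4) (by positivity)
  set B₁ := B.filter fun b => t * γ / 4 ≤ degIn G b A₂ with hB₁
  rw [hA₂c] at h5
  have h6 : γ / 4 * n ≤ B₁.card := by
    have e2 : t * γ / 4 * B.card ≤ t * γ / 4 * n := mul_le_mul_of_nonneg_left hB' (by positivity)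
    have e3 : t * (γ / 4 * n) ≤ (t : ℝ) * B₁.card := by nlinarith
    exact le_of_mul_le_mul_left e3 ht0
  have h7 : 2 ^ A₂.card * j ≤ B₁.card := by
    rw [hA₂c]
    have : ((2 : ℝ) ^ t * j) ≤ B₁.card := by nlinarith
    exact_mod_cast this
  have h8 : ∀ b ∈ B₁, k ≤ degIn G b A₂ := by
    intro b hb
    have := (Finset.mem_filter.1 hb).2
    have : (k : ℝ) ≤ degIn G b A₂ := by linarith
    exact_mod_cast this
  obtain ⟨S', hS', T', hT', hS'c, hT'c, hcpl⟩ := exists_cpl_of_degIn B₁ A₂ k j h8 hj' h7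
  exact ⟨T', (hT'.trans hA₂).trans (Finset.filter_subset _ _), S',
    hS'.trans (Finset.filter_subset _ _), hT'c, hS'c, hcpl.symm⟩

end Degrees

/-- A family of disjoint complete pairs across `(X, Y)`, with part sizes `p * N` and `q * N`. -/
structure IsNT (G : SimpleGraph V) (X Y : Finset V) (p q N : ℕ)
    (𝒯 : Finset (Finset V × Finset V)) : Prop where
  cpl : ∀ t ∈ 𝒯, Cpl G t.1 t.2
  card_fst : ∀ t ∈ 𝒯, t.1.card = p * N
  card_snd : ∀ t ∈ 𝒯, t.2.card = q * N
  side : ∀ t ∈ 𝒯, (t.1 ⊆ X ∧ t.2 ⊆ Y) ∨ (t.1 ⊆ Y ∧ t.2 ⊆ X)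
  disj : ∀ t ∈ 𝒯, ∀ t' ∈ 𝒯, t ≠ t' → Disjoint (t.1 ∪ t.2) (t'.1 ∪ t'.2)

/-- The set covered by a family of pairs. -/
noncomputable def cov (𝒯 : Finset (Finset V × Finset V)) : Finset V :=
  𝒯.biUnion fun t => t.1 ∪ t.2

/-- `S` is covered exactly by a family of disjoint complete pairs of sizes `p * N`, `q * N`. -/
def NT (G : SimpleGraph V) (X Y : Finset V) (p q N : ℕ) (S : Finset V) : Prop :=
  ∃ 𝒯, IsNT G X Y p q N 𝒯 ∧ cov 𝒯 = S

section NT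

variable {G : SimpleGraph V} {X Y : Finset V} {p q N : ℕ}

lemma IsNT.swap {𝒯 : Finset (Finset V × Finset V)} (h : IsNT G X Y p q N 𝒯) :
    IsNT G Y X p q N 𝒯 :=
  ⟨h.cpl, h.card_fst, h.card_snd, fun t ht => (h.side t ht).symm, h.disj⟩

lemma NT.swap {S : Finset V} (h : NT G X Y p q N S) : NT G Y X p q N S := by
  obtain ⟨𝒯, h1, h2⟩ := h
  exact ⟨𝒯, h1.swap, h2⟩

lemma IsNT.mono {𝒯 𝒯' : Finset (Finset V × Finset V)} (h : IsNT G X Y p q N 𝒯) (hs : 𝒯' ⊆ 𝒯) :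
    IsNT G X Y p q N 𝒯' :=
  ⟨fun t ht => h.cpl t (hs ht), fun t ht => h.card_fst t (hs ht), fun t ht => h.card_snd t (hs ht),
    fun t ht => h.side t (hs ht), fun t ht t' ht' => h.disj t (hs ht) t' (hs ht')⟩

lemma mem_cov {𝒯 : Finset (Finset V × Finset V)} {v : V} :
    v ∈ cov 𝒯 ↔ ∃ t ∈ 𝒯, v ∈ t.1 ∨ v ∈ t.2 := by
  simp [cov]

lemma subset_cov {𝒯 : Finset (Finset V × Finset V)} {t : Finset V × Finset V} (ht : t ∈ 𝒯) :
    t.1 ∪ t.2 ⊆ cov 𝒯 :=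
  Finset.subset_biUnion_of_mem (fun t : Finset V × Finset V => t.1 ∪ t.2) ht

lemma IsNT.cov_subset {𝒯 : Finset (Finset V × Finset V)} (h : IsNT G X Y p q N 𝒯) :
    cov 𝒯 ⊆ X ∪ Y := by
  intro v hv
  obtain ⟨t, ht, hv⟩ := mem_cov.1 hv
  rw [Finset.mem_union]
  rcases h.side t ht with ⟨h1, h2⟩ | ⟨h1, h2⟩ <;> rcases hv with hv | hv
  exacts [Or.inl (h1 hv), Or.inr (h2 hv), Or.inr (h1 hv), Or.inl (h2 hv)]

lemma nt_empty : NT G X Y p q N ∅ := ⟨∅, ⟨by simp, by simp, by simp, by simp, by simp⟩, rfl⟩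

lemma NT.union {S S' : Finset V} (h : NT G X Y p q N S) (h' : NT G X Y p q N S')
    (hd : Disjoint S S') : NT G X Y p q N (S ∪ S') := by
  obtain ⟨𝒯, h1, rfl⟩ := h
  obtain ⟨𝒯', h1', rfl⟩ := h'
  refine ⟨𝒯 ∪ 𝒯', ⟨?_, ?_, ?_, ?_, ?_⟩, ?_⟩
  · intro t ht
    exact (Finset.mem_union.1 ht).elim (h1.cpl t) (h1'.cpl t)
  · intro t ht
    exact (Finset.mem_union.1 ht).elim (h1.card_fst t) (h1'.card_fst t)
  · intro t ht
    exact (Finset.mem_union.1 ht).elim (h1.card_snd t) (h1'.card_snd t)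
  · intro t ht
    exact (Finset.mem_union.1 ht).elim (h1.side t) (h1'.side t)
  · intro t ht t' ht' hne
    rcases Finset.mem_union.1 ht with ht | ht <;> rcases Finset.mem_union.1 ht' with ht' | ht'
    · exact h1.disj t ht t' ht' hne
    · exact hd.mono (subset_cov ht) (subset_cov ht')
    · exact hd.symm.mono (subset_cov ht) (subset_cov ht')
    · exact h1'.disj t ht t' ht' hne
  · unfold cov
    exact Finset.union_biUnion

lemma NT.of_union_sdiff {S T : Finset V} (hT : NT G X Y p q N T)
    (hS : NT G X Y p q N (S \ T)) (hTS : T ⊆ S) : NT G X Y p q N S := by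
  have := hT.union hS Finset.disjoint_sdiff
  rwa [Finset.union_sdiff_of_subset hTS] at this

/-- All complete pairs across `(X, Y)` with parts of sizes `x` and `y` split into tiles. -/
def NTSize (G : SimpleGraph V) (X Y : Finset V) (p q N x y : ℕ) : Prop :=
  ∀ P ⊆ X, ∀ Q ⊆ Y, Cpl G P Q → P.card = x → Q.card = y → NT G X Y p q N (P ∪ Q)

lemma ntSize_zero : NTSize G X Y p q N 0 0 := by
  intro P _ Q _ _ hP hQ
  rw [Finset.card_eq_zero] at hP hQ
  subst hP hQ
  simpa using nt_empty

lemma NTSize.add {x y x' y' : ℕ} (h : NTSize G X Y p q N x y) (h' : NTSize G X Y p q N x' y') :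
    NTSize G X Y p q N (x + x') (y + y') := by
  intro P hPX Q hQY hPQ hP hQ
  obtain ⟨P', hP', hP'c⟩ := Finset.exists_subset_card_eq (s := P) (n := x) (by omega)
  obtain ⟨Q', hQ', hQ'c⟩ := Finset.exists_subset_card_eq (s := Q) (n := y) (by omega)
  have h1 := h P' (hP'.trans hPX) Q' (hQ'.trans hQY) (hPQ.mono hP' hQ') hP'c hQ'c
  have h2 := h' (P \ P') (sdiff_subset.trans hPX) (Q \ Q') (sdiff_subset.trans hQY)
    (hPQ.mono sdiff_subset sdiff_subset)
    (by rw [Finset.card_sdiff_of_subset hP']; omega) (by rw [Finset.card_sdiff_of_subset hQ']; omega)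
  refine NT.of_union_sdiff h1 ?_ (Finset.union_subset_union hP' hQ')
  rwa [union_sdiff_union_of_disjoint hP' hQ' hPQ.disjoint]

lemma NTSize.mul {x y : ℕ} (h : NTSize G X Y p q N x y) (n : ℕ) :
    NTSize G X Y p q N (n * x) (n * y) := by
  induction n with
  | zero => simpa using ntSize_zero
  | succ n ih => simpa [Nat.succ_mul] using ih.add h

lemma nt_single {P Q : Finset V} (hP : P ⊆ X) (hQ : Q ⊆ Y) (h : Cpl G P Q)
    (hPc : P.card = p * N) (hQc : Q.card = q * N) : NT G X Y p q N (P ∪ Q) := by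
  refine ⟨{(P, Q)}, ⟨?_, ?_, ?_, ?_, ?_⟩, by simp [cov]⟩ <;> simp [hP, hQ, h, hPc, hQc]

lemma ntSize_tile : NTSize G X Y p q N (p * N) (q * N) :=
  fun _ hP _ hQ h => nt_single hP hQ h

lemma ntSize_tile' : NTSize G X Y p q N (q * N) (p * N) := by
  intro P hP Q hQ h hPc hQc
  rw [Finset.union_comm]
  exact (nt_single hQ hP h.symm hQc hPc).swap

lemma ntSize_combo (i j : ℕ) :
    NTSize G X Y p q N ((i * p + j * q) * N) ((i * q + j * p) * N) := by
  have := (ntSize_tile (G := G) (X := X) (Y := Y) (p := p) (q := q) (N := N)).mul i |>.add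
    ((ntSize_tile' (G := G) (X := X) (Y := Y) (p := p) (q := q) (N := N)).mul j)
  convert this using 1 <;> ring

lemma IsNT.refine {M₁ : ℕ} {𝒯 : Finset (Finset V × Finset V)}
    (h : IsNT G X Y p q (N * M₁) 𝒯) : NT G X Y p q N (cov 𝒯) := by
  induction 𝒯 using Finset.induction_on with
  | empty => exact nt_empty
  | insert t 𝒯 ht ih =>
    have h1 := ih (h.mono (Finset.subset_insert t 𝒯))
    have hc : cov (insert t 𝒯) = (t.1 ∪ t.2) ∪ cov 𝒯 := Finset.biUnion_insert
    rw [hc]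
    have hmem : t ∈ insert t 𝒯 := by simp
    refine NT.union ?_ h1 ?_
    · have key : ∀ {X Y : Finset V}, t.1 ⊆ X → t.2 ⊆ Y → NT G X Y p q N (t.1 ∪ t.2) := by
        intro X Y hX hY
        have := ntSize_combo (G := G) (X := X) (Y := Y) (p := p) (q := q) (N := N) M₁ 0
        refine this _ hX _ hY (h.cpl t hmem) ?_ ?_
        · rw [h.card_fst t hmem]; ring
        · rw [h.card_snd t hmem]; ring
      rcases h.side t hmem with ⟨hX, hY⟩ | ⟨hY, hX⟩
      · exact key hX hY
      · exact (key hY hX).swap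
    · unfold cov
      rw [Finset.disjoint_biUnion_right]
      intro t' ht'
      exact h.disj t hmem t' (by simp [ht']) (by rintro rfl; exact ht ht')

lemma IsNT.card_inter_left {𝒯 : Finset (Finset V × Finset V)} (h : IsNT G X Y p q N 𝒯)
    (hXY : Disjoint X Y) :
    (X ∩ cov 𝒯).card = N * (p * (𝒯.filter fun t => t.1 ⊆ X ∧ t.2 ⊆ Y).card +
      q * (𝒯.filter fun t => ¬ (t.1 ⊆ X ∧ t.2 ⊆ Y)).card) := by
  have e : (X ∩ cov 𝒯) = 𝒯.biUnion fun t => X ∩ (t.1 ∪ t.2) := by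
    unfold cov
    rw [Finset.inter_biUnion]
  rw [e, Finset.card_biUnion]
  · have : ∀ t ∈ 𝒯, (X ∩ (t.1 ∪ t.2)).card = if t.1 ⊆ X ∧ t.2 ⊆ Y then p * N else q * N := by
      intro t ht
      have d1 : ∀ {A}, A ⊆ Y → X ∩ A = ∅ := fun {A} hA =>
        Finset.disjoint_iff_inter_eq_empty.1 (hXY.mono_right hA)
      split_ifs with hs
      · rw [Finset.inter_union_distrib_left, d1 hs.2, Finset.union_empty,
          Finset.inter_eq_right.2 hs.1, h.card_fst t ht]
      · rcases h.side t ht with h1 | h1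
        · exact absurd h1 hs
        · rw [Finset.inter_union_distrib_left, d1 h1.1, Finset.empty_union,
            Finset.inter_eq_right.2 h1.2, h.card_snd t ht]
    rw [Finset.sum_congr rfl this, Finset.sum_ite]
    simp only [Finset.sum_const, smul_eq_mul]
    ring
  · intro t ht t' ht' hne
    exact (h.disj t ht t' ht' hne).mono Finset.inter_subset_right Finset.inter_subset_right

lemma IsNT.card_inter_right {𝒯 : Finset (Finset V × Finset V)} (h : IsNT G X Y p q N 𝒯)
    (hXY : Disjoint X Y) :
    (Y ∩ cov 𝒯).card = N * (q * (𝒯.filter fun t => t.1 ⊆ X ∧ t.2 ⊆ Y).card +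
      p * (𝒯.filter fun t => ¬ (t.1 ⊆ X ∧ t.2 ⊆ Y)).card) := by
  have e : (Y ∩ cov 𝒯) = 𝒯.biUnion fun t => Y ∩ (t.1 ∪ t.2) := by
    unfold cov
    rw [Finset.inter_biUnion]
  rw [e, Finset.card_biUnion]
  · have : ∀ t ∈ 𝒯, (Y ∩ (t.1 ∪ t.2)).card = if t.1 ⊆ X ∧ t.2 ⊆ Y then q * N else p * N := by
      intro t ht
      have d1 : ∀ {A}, A ⊆ X → Y ∩ A = ∅ := fun {A} hA =>
        Finset.disjoint_iff_inter_eq_empty.1 (hXY.symm.mono_right hA)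
      split_ifs with hs
      · rw [Finset.inter_union_distrib_left, d1 hs.1, Finset.empty_union,
          Finset.inter_eq_right.2 hs.2, h.card_snd t ht]
      · rcases h.side t ht with h1 | h1
        · exact absurd h1 hs
        · rw [Finset.inter_union_distrib_left, d1 h1.2, Finset.union_empty,
            Finset.inter_eq_right.2 h1.1, h.card_fst t ht]
    rw [Finset.sum_congr rfl this, Finset.sum_ite]
    simp only [Finset.sum_const, smul_eq_mul]
    ring
  · intro t ht t' ht' hne
    exact (h.disj t ht t' ht' hne).mono Finset.inter_subset_right Finset.inter_subset_right

end NT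

/-- A balanced pair `(X, Y)` of size `n` in which all cross degrees are at least `a / b * n`. -/
structure Bal (G : SimpleGraph V) (X Y : Finset V) (n a b : ℕ) : Prop where
  disj : Disjoint X Y
  card_left : X.card = n
  card_right : Y.card = n
  deg_left : ∀ x ∈ X, a * n ≤ b * degIn G x Y
  deg_right : ∀ y ∈ Y, a * n ≤ b * degIn G y X

lemma Bal.swap {G : SimpleGraph V} {X Y : Finset V} {n a b : ℕ} (h : Bal G X Y n a b) :
    Bal G Y X n a b :=
  ⟨h.disj.symm, h.card_right, h.card_left, h.deg_right, h.deg_left⟩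

lemma rearrange_union {A B C F S T : Finset V} (hT : T ⊆ B) :
    (A ∪ B) ∪ C ∪ (S ∪ F) = ((S ∪ T) ∪ (A ∪ (B \ T))) ∪ (C ∪ F) := by
  ext v
  have := @hT v
  simp only [Finset.mem_union, Finset.mem_sdiff]
  tauto

section Gain

variable {G : SimpleGraph V} {X Y : Finset V} {p q N : ℕ}

/-- Pieces of tiles whose large sides see many uncovered vertices can be rearranged so that
fresh vertices get covered. -/
lemma exists_gain {D M₁ : ℕ} (hD : D + p ^ 2 = q ^ 2) (hM₁ : q * p ≤ M₁) (hDp : 0 < D)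
    (hq : 0 < q) (hN : 0 < N)
    {𝒯 : Finset (Finset V × Finset V)} (h𝒯 : IsNT G X Y p q (N * M₁) 𝒯) (r : ℝ)
    (hr : (2 : ℝ) ^ (q * (N * M₁)) * (q * D * N : ℕ) ≤ r / 2)
    (𝒢 : Finset (Finset V × Finset V)) (h𝒢 : 𝒢 ⊆ 𝒯) (hside : ∀ t ∈ 𝒢, t.1 ⊆ X ∧ t.2 ⊆ Y)
    (hgood : ∀ t ∈ 𝒢, r ≤ ((X \ cov 𝒯).filter fun x => p * D * N ≤ degIn G x t.2).card)
    (hcard : (𝒢.card : ℝ) * (q * D * N : ℕ) ≤ r / 2) :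
    ∃ F ⊆ X \ cov 𝒯, F.card = 𝒢.card * (q * D * N) ∧ NT G X Y p q N (cov 𝒢 ∪ F) := by
  induction 𝒢 using Finset.induction_on with
  | empty => exact ⟨∅, by simp, by simp, by simpa [cov] using nt_empty⟩
  | insert t 𝒢 ht ih =>
    rw [Finset.card_insert_of_notMem ht] at hcard ⊢
    push_cast at hcard
    have hq0 : (0 : ℝ) ≤ ((q * D * N : ℕ) : ℝ) := Nat.cast_nonneg _
    push_cast at hq0
    obtain ⟨F, hF, hFc, hNT⟩ := ih ((Finset.subset_insert t 𝒢).trans h𝒢)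
      (fun t ht => hside t (by simp [ht])) (fun t ht => hgood t (by simp [ht]))
      (by push_cast; nlinarith)
    have htm : t ∈ 𝒯 := h𝒢 (by simp)
    have hts := hside t (by simp)
    set Z := ((X \ cov 𝒯).filter fun x => p * D * N ≤ degIn G x t.2) with hZ
    have hZF : (2 : ℝ) ^ (q * (N * M₁)) * (q * D * N : ℕ) ≤ (Z \ F).card := by
      have h1 : Z.card ≤ (Z \ F).card + F.card := by
        have := Finset.le_card_sdiff F Z
        omega
      have h2 : (Z.card : ℝ) ≤ (Z \ F).card + F.card := by exact_mod_cast h1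
      have h3 := hgood t (by simp)
      rw [← hZ] at h3
      rw [hFc] at h2
      push_cast at h2 hr ⊢
      nlinarith
    obtain ⟨S, hS, T, hT, hSc, hTc, hcpl⟩ := exists_cpl_of_degIn (G := G) (Z \ F) t.2
      (p * D * N) (q * D * N) (fun x hx => by
        have := (Finset.mem_filter.1 (Finset.mem_sdiff.1 hx).1).2
        exact this) (by positivity) (by
        rw [h𝒯.card_snd t htm]
        exact_mod_cast hZF)
    have hSX : S ⊆ X \ cov 𝒯 := hS.trans (sdiff_subset.trans (Finset.filter_subset _ _))
    have hSF : Disjoint S F := by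
      rw [Finset.disjoint_left]
      exact fun v hv => (Finset.mem_sdiff.1 (hS hv)).2
    have n1 : NT G X Y p q N (S ∪ T) := by
      refine (ntSize_combo 0 D) S (hSX.trans sdiff_subset) T (hT.trans hts.2) hcpl ?_ ?_
      · rw [hSc]; ring
      · rw [hTc]; ring
    obtain ⟨i, hi⟩ := Nat.exists_eq_add_of_le hM₁
    have n2 : NT G X Y p q N (t.1 ∪ (t.2 \ T)) := by
      refine (ntSize_combo i (p ^ 2)) t.1 hts.1 _ (sdiff_subset.trans hts.2)
        ((h𝒯.cpl t htm).mono subset_rfl sdiff_subset) ?_ ?_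
      · rw [h𝒯.card_fst t htm, hi]; ring
      · rw [Finset.card_sdiff_of_subset hT, h𝒯.card_snd t htm, hTc, hi]
        have : q * (N * (q * p + i)) = (i * q + p ^ 2 * p) * N + p * D * N := by
          have : q * (N * (q * p + i)) = (q ^ 2 * p + i * q) * N := by ring
          rw [this, ← hD]; ring
        omega
    have hcov : Disjoint (t.1 ∪ t.2) (cov 𝒢) := by
      unfold cov
      rw [Finset.disjoint_biUnion_right]
      intro t' ht'
      exact h𝒯.disj t htm t' (h𝒢 (by simp [ht'])) (by rintro rfl; exact ht ht')
    have hcX : cov 𝒢 ⊆ cov 𝒯 :=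
      Finset.biUnion_subset_biUnion_of_subset_left _ ((Finset.subset_insert t 𝒢).trans h𝒢)
    have htX : t.1 ∪ t.2 ⊆ cov 𝒯 := subset_cov htm
    have dST : ∀ {A B : Finset V}, A ⊆ X \ cov 𝒯 → B ⊆ cov 𝒯 → Disjoint A B := fun hA hB =>
      Finset.disjoint_of_subset_right hB
        (Finset.disjoint_of_subset_left hA Finset.sdiff_disjoint)
    have htT : t.1 ∪ (t.2 \ T) ⊆ t.1 ∪ t.2 := Finset.union_subset_union_right sdiff_subset
    have hTt : T ⊆ t.1 ∪ t.2 := hT.trans subset_union_right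
    have n3 : NT G X Y p q N ((S ∪ T) ∪ (t.1 ∪ (t.2 \ T))) := by
      refine n1.union n2 ?_
      rw [Finset.disjoint_union_left]
      refine ⟨dST hSX (htT.trans htX), ?_⟩
      rw [Finset.disjoint_union_right]
      exact ⟨((h𝒯.cpl t htm).disjoint.mono_right hT).symm, Finset.disjoint_sdiff⟩
    have n4 := n3.union hNT (by
      rw [Finset.disjoint_union_left, Finset.disjoint_union_left, Finset.disjoint_union_right,
        Finset.disjoint_union_right, Finset.disjoint_union_right]
      exact ⟨⟨⟨dST hSX hcX, hSF⟩, hcov.mono_left hTt, (dST hF (hTt.trans htX)).symm⟩,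
        hcov.mono_left htT, (dST hF (htT.trans htX)).symm⟩)
    refine ⟨S ∪ F, Finset.union_subset hSX hF, ?_, ?_⟩
    · rw [Finset.card_union_of_disjoint hSF, hSc, hFc]; ring
    · convert n4 using 1
      have : cov (insert t 𝒢) = (t.1 ∪ t.2) ∪ cov 𝒢 := Finset.biUnion_insert
      rw [this, rearrange_union hT]

end Gain

lemma leftover_arith {P Q M z κ l a b g ω e0 e1 e2 e3 y : ℝ} (hp : 0 < P) (hq : 1 ≤ Q) (hpq : P ≤ Q)
    (hM : 0 < M) (hz : 0 < z) (ha : 0 ≤ a) (hb : 0 ≤ b) (hy : 0 ≤ y) (hab : a ≤ b)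
    (hω : ω = 1 / (4 * Q * (P + Q))) (h1 : e1 ≤ 1 / (2 * P * (P + Q)) * z ^ 2)
    (hg : g * M ≤ ω * z) (h2 : e2 ≤ g * (Q * M * l) + b * (Q * M * (ω * z) + κ * l))
    (h0 : e0 ≤ e1 + e2 + e3) (h3 : e3 ≤ a * (P * M * l)) (hlow : (P - 1) * z * l ≤ (P + Q) * e0)
    (cX : l + M * (P * b + Q * a) = z) (cY : y + M * (Q * b + P * a) = z)
    (hcon : 2 * z < P * l) (hκ : κ * (4 * (P + Q)) ≤ M) : False := by
  have hl : 0 < l := by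
    by_contra h
    push Not at h
    nlinarith
  have hq0 : 0 < Q := by linarith
  have hPQ : 0 < P + Q := by linarith
  have hω0 : 0 < ω := by rw [hω]; positivity
  have hω2 : ω * (4 * Q * (P + Q)) = 1 := by rw [hω]; field_simp
  have hs2 : e1 * (2 * P * (P + Q)) ≤ z ^ 2 := by
    have : e1 ≤ z ^ 2 / (2 * P * (P + Q)) := by
      calc e1 ≤ _ := h1
        _ = _ := by ring
    rwa [le_div_iff₀ (by positivity)] at this
  have s1 : (P + Q) * e1 ≤ z * l / 4 := by
    have h1 : 2 * P * ((P + Q) * e1) ≤ 2 * P * (z * l / 4) := by nlinarith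
    exact le_of_mul_le_mul_left h1 (by positivity)
  have s2 : (P + Q) * (g * (Q * M * l)) ≤ z * l / 4 := by
    have h1 : (P + Q) * (g * (Q * M * l)) = (g * M) * ((P + Q) * Q * l) := by ring
    have h2 : (g * M) * ((P + Q) * Q * l) ≤ ω * z * ((P + Q) * Q * l) :=
      mul_le_mul_of_nonneg_right hg (by positivity)
    have h3 : ω * z * ((P + Q) * Q * l) = (ω * (4 * Q * (P + Q))) * (z * l / 4) := by ring
    rw [hω2] at h3
    linarith
  have hbz : b * Q * M ≤ z := by nlinarith [mul_nonneg (mul_nonneg hM.le hp.le) ha]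
  have s3 : (P + Q) * (b * (Q * M * (ω * z))) ≤ z * l / 4 := by
    have h1 : (P + Q) * (b * (Q * M * (ω * z))) = (b * Q * M) * ((P + Q) * ω * z) := by ring
    have h2 : (b * Q * M) * ((P + Q) * ω * z) ≤ z * ((P + Q) * ω * z) :=
      mul_le_mul_of_nonneg_right hbz (by positivity)
    have h3 : Q * (z * ((P + Q) * ω * z)) = (ω * (4 * Q * (P + Q))) * (z * z / 4) := by ring
    rw [hω2] at h3
    have h4 : z ≤ Q * l := by nlinarith
    have h5 : z * z ≤ z * (Q * l) := mul_le_mul_of_nonneg_left h4 hz.le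
    have h6 : Q * (z * ((P + Q) * ω * z)) ≤ Q * (z * l / 4) := by linarith
    have h7 := le_of_mul_le_mul_left h6 hq0
    linarith
  have s4 : (P + Q) * (b * (κ * l)) ≤ z * l / 4 := by
    have h1 : b * M ≤ b * Q * M := by nlinarith [mul_nonneg hb hM.le]
    have h2 : b * (κ * (4 * (P + Q))) ≤ b * M := mul_le_mul_of_nonneg_left hκ hb
    have h3 : b * (κ * (4 * (P + Q))) ≤ z := by linarith
    have h4 := mul_le_mul_of_nonneg_right h3 hl.le
    linarith
  have s5 : (P + Q) * (a * (P * M * l)) ≤ P * (z - l) * l := by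
    have h1 : (P + Q) * a * M ≤ z - l := by
      nlinarith [mul_nonneg (mul_nonneg hM.le hp.le) (sub_nonneg.2 hab)]
    have h2 := mul_le_mul_of_nonneg_right h1 (by positivity : 0 ≤ P * l)
    linarith
  have s6 : (P + Q) * e0 ≤ z * l + P * (z - l) * l := by
    have t0 : (P + Q) * e0 ≤ (P + Q) * (e1 + e2 + e3) := mul_le_mul_of_nonneg_left h0 hPQ.le
    have t1 : (P + Q) * e2 ≤ (P + Q) * (g * (Q * M * l) + b * (Q * M * (ω * z) + κ * l)) :=
      mul_le_mul_of_nonneg_left h2 hPQ.le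
    have t2 : (P + Q) * e3 ≤ (P + Q) * (a * (P * M * l)) := mul_le_mul_of_nonneg_left h3 hPQ.le
    linarith
  have s7 : l * (P * l) ≤ l * (2 * z) := by linarith
  have := le_of_mul_le_mul_left s7 hl
  linarith

section Count

variable {G : SimpleGraph V} {X Y : Finset V} {p q N₀ n : ℕ}

lemma card_sdiff_add_inter (A B : Finset V) : (A \ B).card + (A ∩ B).card = A.card :=
  Finset.card_sdiff_add_card_inter A B

/-- If the uncovered part of `X` is larger than that of `Y` and larger than `2 * n / p`, then the
edges out of it force many tiles whose large sides see it. -/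
lemma leftover_le_of_few_good {k : ℕ} (hp : 0 < p) (hpq : p < q) (hN₀ : 0 < N₀) (hn : 0 < n)
    (hB : Bal G X Y n (p - 1) (p + q)) {𝒯 : Finset (Finset V × Finset V)}
    (h𝒯 : IsNT G X Y p q N₀ 𝒯) (hle : (Y \ cov 𝒯).card ≤ (X \ cov 𝒯).card)
    (hk : k * (4 * (p + q)) ≤ N₀)
    {ω : ℝ} (hω : ω = 1 / (4 * q * (p + q)))
    (hsparse : (eAB G (X \ cov 𝒯) (Y \ cov 𝒯) : ℝ) ≤ 1 / (2 * p * (p + q)) * n ^ 2)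
    (hgood : ((𝒯.filter fun t => (t.1 ⊆ X ∧ t.2 ⊆ Y) ∧
      ω * n ≤ ((X \ cov 𝒯).filter fun x => k ≤ degIn G x t.2).card).card : ℝ) * N₀ ≤ ω * n) :
    p * (X \ cov 𝒯).card ≤ 2 * n := by
  by_contra hcon
  push Not at hcon
  set L := X \ cov 𝒯 with hL
  set 𝒢 := 𝒯.filter fun t => (t.1 ⊆ X ∧ t.2 ⊆ Y) ∧
      ω * n ≤ (L.filter fun x => k ≤ degIn G x t.2).card with h𝒢
  set ℬ := 𝒯.filter fun t => t.1 ⊆ X ∧ t.2 ⊆ Y with hℬ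
  set 𝒜 := 𝒯.filter fun t => ¬ (t.1 ⊆ X ∧ t.2 ⊆ Y) with h𝒜
  have hGB : 𝒢 ⊆ ℬ := by
    intro t ht
    simp only [h𝒢, hℬ, Finset.mem_filter] at ht ⊢
    tauto
  have cX := card_sdiff_add_inter X (cov 𝒯)
  have cY := card_sdiff_add_inter Y (cov 𝒯)
  rw [h𝒯.card_inter_left hB.disj, hB.card_left, ← hL, ← hℬ, ← h𝒜] at cX
  rw [h𝒯.card_inter_right hB.disj, hB.card_right, ← hℬ, ← h𝒜] at cY
  have hmAB : 𝒜.card ≤ ℬ.card := by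
    by_contra hlt
    push Not at hlt
    have h1 : N₀ * (q * ℬ.card + p * 𝒜.card) < N₀ * (p * ℬ.card + q * 𝒜.card) := by
      apply Nat.mul_lt_mul_of_pos_left _ hN₀
      obtain ⟨e, rfl⟩ := Nat.exists_eq_add_of_lt hpq
      obtain ⟨f, hf⟩ := Nat.exists_eq_add_of_lt hlt
      rw [hf]
      nlinarith
    omega
  have hY : Y ⊆ (Y \ cov 𝒯) ∪ (ℬ.biUnion fun t => t.2) ∪ (𝒜.biUnion fun t => t.1) := by
    intro y hy
    simp only [Finset.mem_union, Finset.mem_sdiff, Finset.mem_biUnion, mem_cov, hℬ, h𝒜,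
      Finset.mem_filter]
    by_cases hc : ∃ t ∈ 𝒯, y ∈ t.1 ∨ y ∈ t.2
    · obtain ⟨t, ht, hyt⟩ := hc
      have dj := Finset.disjoint_left.1 hB.disj
      by_cases hs : t.1 ⊆ X ∧ t.2 ⊆ Y
      · refine Or.inl (Or.inr ⟨t, ⟨ht, hs⟩, hyt.resolve_left fun h => dj (hs.1 h) hy⟩)
      · rcases h𝒯.side t ht with h1 | h1
        · exact absurd h1 hs
        · exact Or.inr ⟨t, ⟨ht, hs⟩, hyt.resolve_right fun h => dj (h1.2 h) hy⟩
    · exact Or.inl (Or.inl ⟨hy, hc⟩)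
  have hE : eAB G L Y ≤ eAB G L (Y \ cov 𝒯) + ∑ t ∈ ℬ, eAB G L t.2 + ∑ t ∈ 𝒜, eAB G L t.1 := by
    calc eAB G L Y ≤ _ := eAB_mono subset_rfl hY
      _ ≤ _ := eAB_union_le _ _ _
      _ ≤ _ := Nat.add_le_add ((eAB_union_le _ _ _).trans
        (Nat.add_le_add_left (eAB_biUnion_le _ _ _) _)) (eAB_biUnion_le _ _ _)
  have hlow : (p - 1) * n * L.card ≤ (p + q) * eAB G L Y := by
    rw [eAB_eq_sum, Finset.mul_sum]
    calc (p - 1) * n * L.card = ∑ x ∈ L, (p - 1) * n := by simp [mul_comm]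
      _ ≤ _ := Finset.sum_le_sum fun x hx => hB.deg_left x (sdiff_subset hx)
  have hA : ∑ t ∈ 𝒜, eAB G L t.1 ≤ 𝒜.card * (p * N₀ * L.card) := by
    calc ∑ t ∈ 𝒜, eAB G L t.1 ≤ ∑ t ∈ 𝒜, p * N₀ * L.card := by
          refine Finset.sum_le_sum fun t ht => ?_
          have := eAB_le_mul (G := G) L t.1
          rw [h𝒯.card_fst t (Finset.mem_filter.1 ht).1] at this
          linarith
      _ = _ := by simp
  have hℓ : (0 : ℝ) ≤ L.card := Nat.cast_nonneg _
  have hp' : (0 : ℝ) < p := by exact_mod_cast hp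
  have hpq' : (p : ℝ) < q := by exact_mod_cast hpq
  have hN₀' : (0 : ℝ) < N₀ := by exact_mod_cast hN₀
  have hn' : (0 : ℝ) < n := by exact_mod_cast hn
  have hq0 : (0 : ℝ) < q := hp'.trans hpq'
  have hωp : 0 < ω := by rw [hω]; positivity
  have hBB : (∑ t ∈ ℬ, eAB G L t.2 : ℝ) ≤ 𝒢.card * (q * N₀ * L.card) +
      ℬ.card * (q * N₀ * (ω * n) + k * L.card) := by
    calc (∑ t ∈ ℬ, eAB G L t.2 : ℝ) ≤ ∑ t ∈ ℬ, ((if t ∈ 𝒢 then (q * N₀ * L.card : ℝ) else 0) +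
          (q * N₀ * (ω * n) + k * L.card)) := by
          refine Finset.sum_le_sum fun t ht => ?_
          have htm := (Finset.mem_filter.1 ht)
          split_ifs with hg
          · have := eAB_le_mul (G := G) L t.2
            rw [h𝒯.card_snd t htm.1] at this
            have : (eAB G L t.2 : ℝ) ≤ L.card * (q * N₀) := by exact_mod_cast this
            have : 0 ≤ q * N₀ * (ω * n) + k * L.card := by positivity
            linarith
          · have h1 : ((L.filter fun x => k ≤ degIn G x t.2).card : ℝ) < ω * n := by
              by_contra hc
              push Not at hc
              exact hg (Finset.mem_filter.2 ⟨htm.1, htm.2, hc⟩)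
            have h2 := eAB_le_of_threshold (G := G) L t.2 (x := (k : ℝ)) (Nat.cast_nonneg _)
            simp only [Nat.cast_le] at h2
            rw [h𝒯.card_snd t htm.1] at h2
            push_cast at h2
            have h3 := mul_le_mul_of_nonneg_left h1.le
              (by positivity : (0 : ℝ) ≤ (q : ℝ) * N₀)
            linarith
      _ = _ := by
          rw [Finset.sum_add_distrib, ← Finset.sum_filter, Finset.filter_mem_eq_inter,
            Finset.inter_eq_right.2 hGB]
          simp [mul_add]
  have hE' : (eAB G L Y : ℝ) ≤ eAB G L (Y \ cov 𝒯) + ∑ t ∈ ℬ, (eAB G L t.2 : ℝ) +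
      ∑ t ∈ 𝒜, (eAB G L t.1 : ℝ) := by exact_mod_cast hE
  have hA' : ∑ t ∈ 𝒜, (eAB G L t.1 : ℝ) ≤ 𝒜.card * (p * N₀ * L.card) := by exact_mod_cast hA
  have hlow' : ((p : ℝ) - 1) * n * L.card ≤ (p + q) * eAB G L Y := by
    have : (((p - 1 : ℕ) : ℝ)) * n * L.card ≤ (p + q) * eAB G L Y := by exact_mod_cast hlow
    rwa [Nat.cast_sub hp, Nat.cast_one] at this
  have cX' : (L.card : ℝ) + N₀ * (p * ℬ.card + q * 𝒜.card) = n := by exact_mod_cast cX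
  have cY' : ((Y \ cov 𝒯).card : ℝ) + N₀ * (q * ℬ.card + p * 𝒜.card) = n := by exact_mod_cast cY
  have hcon' : 2 * (n : ℝ) < p * L.card := by exact_mod_cast hcon
  have hk' : (k : ℝ) * (4 * (p + q)) ≤ N₀ := by exact_mod_cast hk
  have hmAB' : (𝒜.card : ℝ) ≤ ℬ.card := by exact_mod_cast hmAB
  exact leftover_arith hp' (by exact_mod_cast (by omega : 1 ≤ q)) hpq'.le hN₀' hn' (Nat.cast_nonneg _)
    (Nat.cast_nonneg _) (Nat.cast_nonneg _) hmAB' hω hsparse hgood hBB hE' hA' hlow' cX' cY' hcon'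
    hk'

end Count

/-- The refinement factor used when tiles are rearranged. -/
def refineFactor (p q : ℕ) : ℕ := 4 * p * q ^ 2 * (p + q)

/-- The gain, relative to `n`, of one rearrangement step. -/
noncomputable def gainRate (p q : ℕ) : ℝ := 1 / (4 * q * (p + q)) / (2 * refineFactor p q)

lemma gainRate_pos {p q : ℕ} (hp : 0 < p) (hq : 0 < q) : 0 < gainRate p q := by
  unfold gainRate refineFactor
  positivity

lemma nt_step {p q : ℕ} (hp : 0 < p) (hpq : p < q) (N : ℕ) (hN : 0 < N) :
    ∃ n₀ : ℕ, ∀ (V : Type) (G : SimpleGraph V) (X Y : Finset V) (n : ℕ), n₀ ≤ n →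
      Bal G X Y n (p - 1) (p + q) → ∀ 𝒯, IsNT G X Y p q (N * refineFactor p q) 𝒯 →
      (∀ S, NT G X Y p q (N * refineFactor p q) S → S.card ≤ (cov 𝒯).card) →
      (Y \ cov 𝒯).card ≤ (X \ cov 𝒯).card → 2 * n < p * (X \ cov 𝒯).card →
      ∃ S, NT G X Y p q N S ∧ (cov 𝒯).card + gainRate p q * n ≤ S.card := by
  have hq : 0 < q := by omega
  have hM₁ : 0 < refineFactor p q := by unfold refineFactor; positivity
  set M₁ := refineFactor p q with hM₁d
  have hN₀ : 0 < N * M₁ := Nat.mul_pos hN hM₁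
  set ω : ℝ := 1 / (4 * q * (p + q)) with hω
  have hωp : 0 < ω := by rw [hω]; positivity
  obtain ⟨n₁, hn₁⟩ := exists_cpl_of_dense (γ := 1 / (2 * p * (p + q))) (by positivity)
    (p * (N * M₁)) (q * (N * M₁)) (by positivity)
  obtain ⟨D, hD⟩ : ∃ D, q ^ 2 = p ^ 2 + D :=
    Nat.exists_eq_add_of_le (Nat.pow_le_pow_left hpq.le 2)
  have hDp : 0 < D := by
    have := Nat.pow_lt_pow_left hpq (by norm_num : (2 : ℕ) ≠ 0)
    omega
  have hDq : D ≤ q ^ 2 := by omega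
  obtain ⟨n₂, hn₂⟩ := exists_nat_gt ((2 * (2 ^ (q * (N * M₁)) * (q * D * N : ℕ)) +
    2 * M₁ * N : ℝ) / ω)
  rw [div_lt_iff₀ hωp] at hn₂
  refine ⟨n₁ + n₂ + 1, fun V G X Y n hn hB 𝒯 h𝒯 hmax hle hbig => ?_⟩
  have hn0 : 0 < n := by omega
  have hn2 : 2 * (2 ^ (q * (N * M₁)) * (q * D * N : ℕ)) + 2 * M₁ * N < (n : ℝ) * ω :=
    hn₂.trans_le (mul_le_mul_of_nonneg_right (by exact_mod_cast (by omega : n₂ ≤ n)) hωp.le)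
  have hk : p * D * N * (4 * (p + q)) ≤ N * M₁ := by
    calc p * D * N * (4 * (p + q)) ≤ p * q ^ 2 * N * (4 * (p + q)) := by gcongr
      _ = N * M₁ := by rw [hM₁d]; unfold refineFactor; ring
  have hsparse : (eAB G (X \ cov 𝒯) (Y \ cov 𝒯) : ℝ) ≤ 1 / (2 * p * (p + q)) * n ^ 2 := by
    by_contra hcon
    push Not at hcon
    obtain ⟨A, hA, B, hBs, hAc, hBc, hcpl⟩ := hn₁ V G (X \ cov 𝒯) (Y \ cov 𝒯) n (by omega)
      ((Finset.card_le_card sdiff_subset).trans hB.card_left.le)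
      ((Finset.card_le_card sdiff_subset).trans hB.card_right.le) hcon.le
    have hd : Disjoint (cov 𝒯) (A ∪ B) := by
      rw [Finset.disjoint_union_right]
      exact ⟨Finset.disjoint_sdiff.mono_right hA, Finset.disjoint_sdiff.mono_right hBs⟩
    have h1 : NT G X Y p q (N * M₁) (cov 𝒯 ∪ (A ∪ B)) :=
      NT.union ⟨𝒯, h𝒯, rfl⟩ (nt_single (hA.trans sdiff_subset) (hBs.trans sdiff_subset) hcpl
        hAc hBc) hd
    have h2 := hmax _ h1
    rw [Finset.card_union_of_disjoint hd, Finset.card_union_of_disjoint hcpl.disjoint, hAc] at h2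
    have : 0 < p * (N * M₁) := by positivity
    omega
  set good := 𝒯.filter fun t => (t.1 ⊆ X ∧ t.2 ⊆ Y) ∧
      ω * n ≤ ((X \ cov 𝒯).filter fun x => p * D * N ≤ degIn G x t.2).card with hgood
  have hgc : ω * n < good.card * ((N * M₁ : ℕ) : ℝ) := by
    by_contra hcon
    push Not at hcon
    have := leftover_le_of_few_good hp hpq hN₀ hn0 hB h𝒯 hle hk hω hsparse hcon
    omega
  set g := ⌊ω * n / (N * M₁ : ℕ)⌋₊ with hg
  have hN₀' : (0 : ℝ) < (N * M₁ : ℕ) := by exact_mod_cast hN₀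
  have hg1 : (g : ℝ) * (N * M₁ : ℕ) ≤ ω * n := by
    rw [← le_div_iff₀ hN₀']
    exact Nat.floor_le (by positivity)
  have hg2 : ω * n ≤ ((g : ℝ) + 1) * (N * M₁ : ℕ) := by
    rw [← div_le_iff₀ hN₀']
    exact (Nat.lt_floor_add_one _).le
  have hg3 : g ≤ good.card := by
    have : (g : ℝ) * (N * M₁ : ℕ) < good.card * (N * M₁ : ℕ) := hg1.trans_lt hgc
    have := lt_of_mul_lt_mul_right this hN₀'.le
    exact_mod_cast this.le
  obtain ⟨𝒢, h𝒢, h𝒢c⟩ := Finset.exists_subset_card_eq hg3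
  have h𝒢T : 𝒢 ⊆ 𝒯 := h𝒢.trans (Finset.filter_subset _ _)
  have hqD : 2 * (q * D * N) ≤ N * M₁ := by
    have e1 : D ≤ q * (p + q) := hDq.trans (by nlinarith [Nat.zero_le (q * p)])
    calc 2 * (q * D * N) ≤ 2 * (q * (q * (p + q)) * N) := by gcongr
      _ = N * (2 * 1 * q ^ 2 * (p + q)) := by ring
      _ ≤ N * (4 * p * q ^ 2 * (p + q)) := by
          gcongr
          · norm_num
          · exact hp
  have hqD' : 2 * ((q * D * N : ℕ) : ℝ) ≤ (N * M₁ : ℕ) := by exact_mod_cast hqD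
  have hMN : (0 : ℝ) ≤ 2 * M₁ * N := by positivity
  have hpow : (0 : ℝ) ≤ 2 ^ (q * (N * M₁)) * (q * D * N : ℕ) := by positivity
  have hg0 : (0 : ℝ) ≤ g := Nat.cast_nonneg _
  obtain ⟨F, hF, hFc, hNT⟩ := exists_gain (D := D) (by omega)
    (by
      rw [hM₁d]; unfold refineFactor
      calc q * p = 1 * p * q * 1 := by ring
        _ ≤ 4 * p * q ^ 2 * (p + q) := by
          gcongr
          · norm_num
          · exact Nat.le_self_pow (by norm_num) q
          · omega)
    hDp hq hN h𝒯 (ω * n) (by linarith) 𝒢 h𝒢T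
    (fun t ht => (Finset.mem_filter.1 (h𝒢 ht)).2.1)
    (fun t ht => (Finset.mem_filter.1 (h𝒢 ht)).2.2)
    (by
      rw [h𝒢c]
      have := mul_le_mul_of_nonneg_left hqD' hg0
      linarith)
  have hcovG : cov 𝒯 = cov (𝒯 \ 𝒢) ∪ cov 𝒢 := by
    unfold cov
    rw [← Finset.union_biUnion, Finset.sdiff_union_of_subset h𝒢T]
  have hcd : Disjoint (cov (𝒯 \ 𝒢)) (cov 𝒢) := by
    unfold cov
    rw [Finset.disjoint_biUnion_left]
    intro t ht
    rw [Finset.disjoint_biUnion_right]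
    intro t' ht'
    rw [Finset.mem_sdiff] at ht
    exact h𝒯.disj t ht.1 t' (h𝒢T ht') (by rintro rfl; exact ht.2 ht')
  have hFd : Disjoint (cov 𝒯) F := Finset.disjoint_sdiff.mono_right hF
  have hFd' := hFd
  rw [hcovG, Finset.disjoint_union_left] at hFd'
  refine ⟨cov (𝒯 \ 𝒢) ∪ (cov 𝒢 ∪ F), NT.union (IsNT.refine (h𝒯.mono sdiff_subset)) hNT ?_, ?_⟩
  · rw [Finset.disjoint_union_right]
    exact ⟨hcd, hFd'.1⟩
  · rw [← Finset.union_assoc, ← hcovG, Finset.card_union_of_disjoint hFd, hFc, h𝒢c]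
    push_cast at *
    have hM₁' : (0 : ℝ) < M₁ := by exact_mod_cast hM₁
    have hNr : (0 : ℝ) < N := by exact_mod_cast hN
    have hqD1 : (1 : ℝ) ≤ q * D := by
      exact_mod_cast (Nat.mul_pos hq hDp)
    have e1 : gainRate p q * n * (2 * M₁) = ω * n := by
      unfold gainRate
      rw [← hM₁d, ← hω]
      field_simp
    have e2 : gainRate p q * n * (2 * M₁) ≤ (g * (q * D * N)) * (2 * M₁) := by
      rw [e1]
      have : (g : ℝ) * (1 * N) ≤ g * (q * D * N) := by gcongr
      nlinarith
    have e3 := le_of_mul_le_mul_right e2 (by positivity)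
    linarith

lemma nt_iter {p q : ℕ} (hp : 0 < p) (hpq : p < q) (j : ℕ) : ∀ N, 0 < N →
    ∃ n₀ : ℕ, ∀ (V : Type) (G : SimpleGraph V) (X Y : Finset V) (n : ℕ), n₀ ≤ n →
      Bal G X Y n (p - 1) (p + q) → ∃ S, NT G X Y p q N S ∧
      ((p * (X \ S).card ≤ 2 * n ∧ p * (Y \ S).card ≤ 2 * n) ∨
        j * (gainRate p q * n) ≤ S.card) := by
  induction j with
  | zero =>
    exact fun N _ => ⟨0, fun V G X Y n _ _ => ⟨∅, nt_empty, Or.inr (by simp)⟩⟩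
  | succ j ih =>
    intro N hN
    have hM₁ : 0 < refineFactor p q := by
      have : 0 < q := by omega
      unfold refineFactor; positivity
    obtain ⟨n₁, h₁⟩ := ih (N * refineFactor p q) (Nat.mul_pos hN hM₁)
    obtain ⟨n₂, h₂⟩ := nt_step hp hpq N hN
    refine ⟨n₁ + n₂, fun V G X Y n hn hB => ?_⟩
    obtain ⟨S₁, hS₁, hj⟩ := h₁ V G X Y n (by omega) hB
    have hsub : ∀ S, NT G X Y p q (N * refineFactor p q) S → S ⊆ X ∪ Y := by
      rintro S ⟨𝒯, h, rfl⟩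
      exact h.cov_subset
    obtain ⟨S, hS, hmax⟩ := Finset.exists_max_image
      ((X ∪ Y).powerset.filter fun S => NT G X Y p q (N * refineFactor p q) S) Finset.card
      ⟨S₁, Finset.mem_filter.2 ⟨Finset.mem_powerset.2 (hsub _ hS₁), hS₁⟩⟩
    have hmax' : ∀ S', NT G X Y p q (N * refineFactor p q) S' → S'.card ≤ S.card := fun S' h =>
      hmax S' (Finset.mem_filter.2 ⟨Finset.mem_powerset.2 (hsub _ h), h⟩)
    obtain ⟨𝒯, h𝒯, rfl⟩ := (Finset.mem_filter.1 hS).2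
    rcases hj with hj | hj
    · obtain ⟨𝒯₁, h𝒯₁, rfl⟩ := hS₁
      exact ⟨_, h𝒯₁.refine, Or.inl hj⟩
    have hj' : j * (gainRate p q * n) ≤ (cov 𝒯).card :=
      hj.trans (by exact_mod_cast hmax' _ hS₁)
    have hgain : (∃ S, NT G X Y p q N S ∧ (cov 𝒯).card + gainRate p q * n ≤ S.card) →
        ∃ S, NT G X Y p q N S ∧ ((p * (X \ S).card ≤ 2 * n ∧ p * (Y \ S).card ≤ 2 * n) ∨
        ((j + 1 : ℕ) : ℝ) * (gainRate p q * n) ≤ S.card) := by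
      rintro ⟨S, hS, hc⟩
      refine ⟨S, hS, Or.inr ?_⟩
      push_cast
      linarith
    rcases le_total (Y \ cov 𝒯).card (X \ cov 𝒯).card with hle | hle
    · by_cases hb : 2 * n < p * (X \ cov 𝒯).card
      · exact hgain (h₂ V G X Y n (by omega) hB 𝒯 h𝒯 hmax' hle hb)
      · push Not at hb
        exact ⟨_, h𝒯.refine, Or.inl ⟨hb, (Nat.mul_le_mul_left p hle).trans hb⟩⟩
    · by_cases hb : 2 * n < p * (Y \ cov 𝒯).card
      · refine hgain ?_
        obtain ⟨S, hS, hc⟩ := h₂ V G Y X n (by omega) hB.swap 𝒯 h𝒯.swap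
          (fun S h => hmax' S h.swap) hle hb
        exact ⟨S, hS.swap, hc⟩
      · push Not at hb
        exact ⟨_, h𝒯.refine, Or.inl ⟨(Nat.mul_le_mul_left p hle).trans hb, hb⟩⟩

/-- Balanced bipartite graphs of minimum degree almost `p / (p + q) * n` have tilings by disjoint
complete pairs of sizes `p * N` and `q * N` that miss at most `2 * n / p` vertices on each side. -/
lemma exists_isNT {p q : ℕ} (hp : 0 < p) (hpq : p < q) (N : ℕ) (hN : 0 < N) :
    ∃ n₀ : ℕ, ∀ (V : Type) (G : SimpleGraph V) (X Y : Finset V) (n : ℕ), n₀ ≤ n →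
      Bal G X Y n (p - 1) (p + q) → ∃ 𝒯, IsNT G X Y p q N 𝒯 ∧
      p * (X \ cov 𝒯).card ≤ 2 * n ∧ p * (Y \ cov 𝒯).card ≤ 2 * n := by
  have hc := gainRate_pos hp (by omega : 0 < q)
  obtain ⟨j, hj⟩ := exists_nat_gt (2 / gainRate p q)
  rw [div_lt_iff₀ hc] at hj
  obtain ⟨n₀, h₀⟩ := nt_iter hp hpq j N hN
  refine ⟨n₀ + 1, fun V G X Y n hn hB => ?_⟩
  obtain ⟨_, ⟨𝒯, h𝒯, rfl⟩, h | h⟩ := h₀ V G X Y n (by omega) hB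
  · exact ⟨𝒯, h𝒯, h⟩
  · exfalso
    have h1 : (cov 𝒯).card ≤ n + n := by
      calc (cov 𝒯).card ≤ (X ∪ Y).card := Finset.card_le_card h𝒯.cov_subset
        _ ≤ X.card + Y.card := Finset.card_union_le _ _
        _ = n + n := by rw [hB.card_left, hB.card_right]
    have h2 : ((cov 𝒯).card : ℝ) ≤ n + n := by exact_mod_cast h1
    have hn' : (0 : ℝ) < n := by exact_mod_cast (by omega : 0 < n)
    nlinarith

lemma card_inter_union_of_disjoint (P : Finset V) {T U : Finset V} (h : Disjoint T U) :
    (P ∩ (T ∪ U)).card = (P ∩ T).card + (P ∩ U).card := by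
  rw [Finset.inter_union_distrib_left, Finset.card_union_of_disjoint]
  exact h.mono Finset.inter_subset_right Finset.inter_subset_right

lemma inter_eq_empty_of_tile {X Y : Finset V} {p q N : ℕ} {𝒯 : Finset (Finset V × Finset V)}
    {G : SimpleGraph V} (h𝒯 : IsNT G X Y p q N 𝒯) {t t' : Finset V × Finset V} (ht : t ∈ 𝒯) (ht' : t' ∈ 𝒯)
    (hne : t' ≠ t) {T : Finset V} {v : V} (hv : v ∉ cov 𝒯) (hT : T ⊆ insert v (t.1 ∪ t.2)) :
    t'.1 ∩ T = ∅ ∧ t'.2 ∩ T = ∅ := by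
  have hd := Finset.disjoint_left.1 (h𝒯.disj t' ht' t ht hne)
  have key : ∀ x ∈ t'.1 ∪ t'.2, x ∉ T := by
    intro x hx hxT
    rcases Finset.mem_insert.1 (hT hxT) with rfl | h
    · exact hv (subset_cov ht' hx)
    · exact hd hx h
  constructor
  · rw [Finset.eq_empty_iff_forall_notMem]
    intro x hx
    rw [Finset.mem_inter] at hx
    exact key x (Finset.mem_union_left _ hx.1) hx.2
  · rw [Finset.eq_empty_iff_forall_notMem]
    intro x hx
    rw [Finset.mem_inter] at hx
    exact key x (Finset.mem_union_right _ hx.1) hx.2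

lemma sdiff_union_of_inter_eq_empty {P T U : Finset V} (h : P ∩ T = ∅) :
    P \ (T ∪ U) = P \ U := by
  have h1 := Finset.disjoint_left.1 (Finset.disjoint_iff_inter_eq_empty.2 h)
  ext x
  simp only [Finset.mem_sdiff, Finset.mem_union]
  constructor
  · rintro ⟨h2, h3⟩
    exact ⟨h2, fun h => h3 (Or.inr h)⟩
  · rintro ⟨h2, h3⟩
    exact ⟨h2, fun h => h.elim (h1 h2) h3⟩

section Insert

variable [Fintype α] [Fintype V] {H : SimpleGraph α} {G : SimpleGraph V} {u w : ℕ}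

/-- A vertex with `w` free neighbours in `Q` can be covered by a copy of `H` using `u - 1` vertices
of `P` and `w` vertices of `Q`. -/
lemma exists_tileable_insert (hT : TileSize H G w u) (hu : 0 < u) {P Q U : Finset V} {v : V}
    (hPQ : Cpl G P Q) (hvP : v ∉ P) (hvQ : v ∉ Q) (hvU : v ∉ U)
    (hP : u ≤ (P \ U).card) (hQ : w ≤ degIn G v (Q \ U)) :
    ∃ T, Tileable H G T ∧ Disjoint T U ∧ v ∈ T ∧ T ⊆ insert v (P ∪ Q) ∧
      (P ∩ T).card = u - 1 ∧ (Q ∩ T).card = w ∧ T.card = u + w := by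
  obtain ⟨P', hP', hP'c⟩ := Finset.exists_subset_card_eq (s := P \ U) (n := u - 1) (by omega)
  obtain ⟨Q', hQ', hQ'c⟩ := Finset.exists_subset_card_eq hQ
  have hd := hPQ.disjoint
  rw [Finset.disjoint_left] at hd
  have h1 : ∀ x ∈ P', x ∈ P ∧ x ∉ U := fun x hx => Finset.mem_sdiff.1 (hP' hx)
  have h2 : ∀ x ∈ Q', (x ∈ Q ∧ x ∉ U) ∧ G.Adj v x := fun x hx => by
    have := hQ' hx
    rwa [Finset.mem_filter, Finset.mem_sdiff] at this
  have hvP' : v ∉ P' := fun h => hvP (h1 v h).1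
  have hdis : Disjoint Q' (insert v P') := by
    rw [Finset.disjoint_left]
    intro x hx hx'
    rcases Finset.mem_insert.1 hx' with rfl | hx'
    · exact hvQ (h2 x hx).1.1
    · exact hd (h1 x hx').1 (h2 x hx).1.1
  have hc : (insert v P').card = u := by rw [Finset.card_insert_of_notMem hvP', hP'c]; omega
  refine ⟨Q' ∪ insert v P', hT Q' (insert v P') ?_ hQ'c hc, ?_, by simp, ?_, ?_, ?_, ?_⟩
  · intro x hx y hy
    rcases Finset.mem_insert.1 hy with rfl | hy
    · exact (h2 x hx).2.symm
    · exact (hPQ y (h1 y hy).1 x (h2 x hx).1.1).symm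
  · rw [Finset.disjoint_left]
    intro x hx
    rcases Finset.mem_union.1 hx with hx | hx
    · exact (h2 x hx).1.2
    · rcases Finset.mem_insert.1 hx with rfl | hx
      · exact hvU
      · exact (h1 x hx).2
  · intro x hx
    rw [Finset.mem_insert, Finset.mem_union]
    rcases Finset.mem_union.1 hx with hx | hx
    · exact Or.inr (Or.inr (h2 x hx).1.1)
    · rcases Finset.mem_insert.1 hx with rfl | hx
      · exact Or.inl rfl
      · exact Or.inr (Or.inl (h1 x hx).1)
  · rw [← hP'c]
    congr 1
    ext x
    simp only [Finset.mem_inter, Finset.mem_union, Finset.mem_insert]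
    constructor
    · rintro ⟨hx, hx' | rfl | hx'⟩
      · exact absurd (h2 x hx').1.1 (hd hx)
      · exact absurd hx hvP
      · exact hx'
    · exact fun hx => ⟨(h1 x hx).1, Or.inr (Or.inr hx)⟩
  · rw [← hQ'c]
    congr 1
    ext x
    simp only [Finset.mem_inter, Finset.mem_union, Finset.mem_insert]
    constructor
    · rintro ⟨hx, hx' | rfl | hx'⟩
      · exact hx'
      · exact absurd hx hvQ
      · exact absurd hx (hd (h1 x hx').1)
    · exact fun hx => ⟨(h2 x hx).1.1, Or.inl hx⟩
  · rw [Finset.card_union_of_disjoint hdis, hQ'c, hc, Nat.add_comm]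

/-- A vertex with `u` free neighbours in `P` can be covered by a copy of `H` using `u` vertices
of `P` and `w - 1` vertices of `Q`, avoiding a given vertex of `Q`. -/
lemma exists_tileable_exchange (hT : TileSize H G w u) (hw : 0 < w) {P Q U : Finset V} {v v' : V}
    (hPQ : Cpl G P Q) (hvP : v ∉ P) (hvQ : v ∉ Q) (hvU : v ∉ U) (hv'Q : v' ∈ Q) (hv'U : v' ∉ U)
    (hP : u ≤ degIn G v (P \ U)) (hQ : w ≤ (Q \ U).card) :
    ∃ T, Tileable H G T ∧ Disjoint T U ∧ v ∈ T ∧ v' ∉ T ∧ T ⊆ insert v (P ∪ Q) ∧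
      (P ∩ T).card = u ∧ (Q ∩ T).card = w - 1 ∧ T.card = u + w := by
  obtain ⟨P', hP', hP'c⟩ := Finset.exists_subset_card_eq hP
  obtain ⟨Q', hQ', hQ'c⟩ := Finset.exists_subset_card_eq (s := (Q \ U).erase v') (n := w - 1)
    (by rw [Finset.card_erase_of_mem (Finset.mem_sdiff.2 ⟨hv'Q, hv'U⟩)]; omega)
  have hd := hPQ.disjoint
  rw [Finset.disjoint_left] at hd
  have h1 : ∀ x ∈ P', (x ∈ P ∧ x ∉ U) ∧ G.Adj v x := fun x hx => by
    have := hP' hx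
    rwa [Finset.mem_filter, Finset.mem_sdiff] at this
  have h2 : ∀ x ∈ Q', x ≠ v' ∧ x ∈ Q ∧ x ∉ U := fun x hx => by
    have := hQ' hx
    rwa [Finset.mem_erase, Finset.mem_sdiff] at this
  have hvQ' : v ∉ Q' := fun h => hvQ (h2 v h).2.1
  have hdis : Disjoint (insert v Q') P' := by
    rw [Finset.disjoint_left]
    intro x hx hx'
    rcases Finset.mem_insert.1 hx with rfl | hx
    · exact hvP (h1 x hx').1.1
    · exact hd (h1 x hx').1.1 (h2 x hx).2.1
  have hc : (insert v Q').card = w := by rw [Finset.card_insert_of_notMem hvQ', hQ'c]; omega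
  refine ⟨insert v Q' ∪ P', hT (insert v Q') P' ?_ hc hP'c, ?_, by simp, ?_, ?_, ?_, ?_, ?_⟩
  · intro x hx y hy
    rcases Finset.mem_insert.1 hx with rfl | hx
    · exact (h1 y hy).2
    · exact (hPQ y (h1 y hy).1.1 x (h2 x hx).2.1).symm
  · rw [Finset.disjoint_left]
    intro x hx
    rcases Finset.mem_union.1 hx with hx | hx
    · rcases Finset.mem_insert.1 hx with rfl | hx
      · exact hvU
      · exact (h2 x hx).2.2
    · exact (h1 x hx).1.2
  · intro hx
    rcases Finset.mem_union.1 hx with hx | hx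
    · rcases Finset.mem_insert.1 hx with rfl | hx
      · exact hvQ hv'Q
      · exact (h2 _ hx).1 rfl
    · exact hd (h1 _ hx).1.1 hv'Q
  · intro x hx
    rw [Finset.mem_insert, Finset.mem_union]
    rcases Finset.mem_union.1 hx with hx | hx
    · rcases Finset.mem_insert.1 hx with rfl | hx
      · exact Or.inl rfl
      · exact Or.inr (Or.inr (h2 x hx).2.1)
    · exact Or.inr (Or.inl (h1 x hx).1.1)
  · rw [← hP'c]
    congr 1
    ext x
    simp only [Finset.mem_inter, Finset.mem_union, Finset.mem_insert]
    constructor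
    · rintro ⟨hx, (rfl | hx') | hx'⟩
      · exact absurd hx hvP
      · exact absurd (h2 x hx').2.1 (hd hx)
      · exact hx'
    · exact fun hx => ⟨(h1 x hx).1.1, Or.inr hx⟩
  · rw [← hQ'c]
    congr 1
    ext x
    simp only [Finset.mem_inter, Finset.mem_union, Finset.mem_insert]
    constructor
    · rintro ⟨hx, (rfl | hx') | hx'⟩
      · exact absurd hx hvQ
      · exact hx'
      · exact absurd hx (hd (h1 x hx').1.1)
    · exact fun hx => ⟨(h2 x hx).2.1, Or.inl (Or.inr hx)⟩
  · rw [Finset.card_union_of_disjoint hdis, hP'c, hc, Nat.add_comm]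

/-- The state of the process that covers the exceptional vertices `S` one at a time: `U` is the set
of vertices used so far. -/
structure Absorb (H : SimpleGraph α) (G : SimpleGraph V) (u w K : ℕ)
    (𝒯 : Finset (Finset V × Finset V)) (S U : Finset V) : Prop where
  tile : Tileable H G U
  ratio : ∀ t ∈ 𝒯, w * (t.1 ∩ U).card ≤ u * (t.2 ∩ U).card
  bound : ∀ t ∈ 𝒯, (t.2 ∩ U).card ≤ K + w
  out : U \ cov 𝒯 = S
  card : U.card ≤ 2 * (u + w) * S.card

lemma Absorb.direct {X Y : Finset V} {p q N K : ℕ} {𝒯 : Finset (Finset V × Finset V)}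
    {S U : Finset V} (h : Absorb H G u w K 𝒯 S U) (h𝒯 : IsNT G X Y p q N 𝒯)
    (hT : TileSize H G w u) (hu : 0 < u) {v : V} (hv : v ∉ cov 𝒯) (hvS : v ∉ S)
    {t : Finset V × Finset V} (ht : t ∈ 𝒯) (htK : (t.2 ∩ U).card ≤ K)
    (ht1 : u ≤ (t.1 \ U).card) (ht2 : w ≤ degIn G v (t.2 \ U)) :
    ∃ U', Absorb H G u w K 𝒯 (insert v S) U' := by
  have hvU : v ∉ U := fun hvU => hvS (h.out ▸ Finset.mem_sdiff.2 ⟨hvU, hv⟩)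
  have hvt : v ∉ t.1 ∪ t.2 := fun h' => hv (subset_cov ht h')
  rw [Finset.mem_union, not_or] at hvt
  obtain ⟨T, hT1, hT2, hT3, hT4, hT5, hT6, hT7⟩ :=
    exists_tileable_insert hT hu (h𝒯.cpl t ht) hvt.1 hvt.2 hvU ht1 ht2
  refine ⟨T ∪ U, hT1.union h.tile hT2, ?_, ?_, ?_, ?_⟩
  · intro t' ht'
    rw [card_inter_union_of_disjoint _ hT2, card_inter_union_of_disjoint _ hT2]
    have := h.ratio t' ht'
    by_cases hne : t' = t
    · subst hne
      rw [hT5, hT6, Nat.mul_add, Nat.mul_add, Nat.mul_comm u w]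
      exact Nat.add_le_add (Nat.mul_le_mul_left _ (Nat.sub_le _ _)) this
    · obtain ⟨e1, e2⟩ := inter_eq_empty_of_tile h𝒯 ht ht' hne hv hT4
      rw [e1, e2]
      simpa using this
  · intro t' ht'
    rw [card_inter_union_of_disjoint _ hT2]
    have := h.bound t' ht'
    by_cases hne : t' = t
    · subst hne
      omega
    · obtain ⟨e1, e2⟩ := inter_eq_empty_of_tile h𝒯 ht ht' hne hv hT4
      rw [e2]
      simpa using this
  · rw [Finset.union_sdiff_distrib, h.out]
    ext x
    rw [Finset.mem_union, Finset.mem_insert, Finset.mem_sdiff]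
    refine or_congr ⟨?_, ?_⟩ Iff.rfl
    · rintro ⟨hx, hx'⟩
      exact (Finset.mem_insert.1 (hT4 hx)).resolve_right fun h' => hx' (subset_cov ht h')
    · rintro rfl
      exact ⟨hT3, hv⟩
  · rw [Finset.card_union_of_disjoint hT2, Finset.card_insert_of_notMem hvS, hT7]
    have := h.card
    nlinarith

lemma Absorb.exchange {X Y : Finset V} {p q N K : ℕ} {𝒯 : Finset (Finset V × Finset V)}
    {S U : Finset V} (h : Absorb H G u w K 𝒯 S U) (h𝒯 : IsNT G X Y p q N 𝒯)
    (hT : TileSize H G w u) (hu : 0 < u) (hw : 0 < w) {v v' : V} (hv : v ∉ cov 𝒯) (hvS : v ∉ S)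
    {t s : Finset V × Finset V} (ht : t ∈ 𝒯) (hs : s ∈ 𝒯) (hst : s ≠ t)
    (htK : (t.2 ∩ U).card ≤ K) (hsK : (s.2 ∩ U).card ≤ K) (hv't : v' ∈ t.2) (hv'U : v' ∉ U)
    (ht1 : u ≤ degIn G v (t.1 \ U)) (ht2 : w ≤ (t.2 \ U).card)
    (hs1 : u ≤ (s.1 \ U).card) (hs2 : w ≤ degIn G v' (s.2 \ U)) :
    ∃ U', Absorb H G u w K 𝒯 (insert v S) U' := by
  have hvU : v ∉ U := fun hvU => hvS (h.out ▸ Finset.mem_sdiff.2 ⟨hvU, hv⟩)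
  have hvt : v ∉ t.1 ∪ t.2 := fun h' => hv (subset_cov ht h')
  rw [Finset.mem_union, not_or] at hvt
  obtain ⟨T, hT1, hT2, hT3, hT3', hT4, hT5, hT6, hT7⟩ :=
    exists_tileable_exchange hT hw (h𝒯.cpl t ht) hvt.1 hvt.2 hvU hv't hv'U ht1 ht2
  have hv's : v' ∉ s.1 ∪ s.2 := fun h' =>
    Finset.disjoint_left.1 (h𝒯.disj s hs t ht hst) h' (Finset.mem_union_right _ hv't)
  rw [Finset.mem_union, not_or] at hv's
  obtain ⟨es1, es2⟩ := inter_eq_empty_of_tile h𝒯 ht hs hst hv hT4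
  obtain ⟨R, hR1, hR2, hR3, hR4, hR5, hR6, hR7⟩ :=
    exists_tileable_insert (U := T ∪ U) hT hu (h𝒯.cpl s hs) hv's.1 hv's.2
      (fun h' => (Finset.mem_union.1 h').elim hT3' hv'U)
      (by rwa [sdiff_union_of_inter_eq_empty es1]) (by rwa [sdiff_union_of_inter_eq_empty es2])
  have hRs : ∀ x ∈ R, x = v' ∨ x ∈ s.1 ∪ s.2 := fun x hx => Finset.mem_insert.1 (hR4 hx)
  have hRcov : R ⊆ cov 𝒯 := fun x hx => by
    rcases hRs x hx with rfl | h'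
    · exact subset_cov ht (Finset.mem_union_right _ hv't)
    · exact subset_cov hs h'
  have hR : ∀ t' ∈ 𝒯, t' ≠ s → t'.1 ∩ R = ∅ ∧ (t' ≠ t → t'.2 ∩ R = ∅) ∧
      (t' = t → (t'.2 ∩ R).card = 1) := by
    intro t' ht' hne
    have hd := Finset.disjoint_left.1 (h𝒯.disj t' ht' s hs hne)
    refine ⟨?_, ?_, ?_⟩
    · rw [Finset.eq_empty_iff_forall_notMem]
      intro x hx
      rw [Finset.mem_inter] at hx
      rcases hRs x hx.2 with rfl | h'
      · by_cases htt : t' = t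
        · subst htt
          exact Finset.disjoint_left.1 (h𝒯.cpl t' ht').disjoint hx.1 hv't
        · exact Finset.disjoint_left.1 (h𝒯.disj t' ht' t ht htt) (Finset.mem_union_left _ hx.1)
            (Finset.mem_union_right _ hv't)
      · exact hd (Finset.mem_union_left _ hx.1) h'
    · intro htt
      rw [Finset.eq_empty_iff_forall_notMem]
      intro x hx
      rw [Finset.mem_inter] at hx
      rcases hRs x hx.2 with rfl | h'
      · exact Finset.disjoint_left.1 (h𝒯.disj t' ht' t ht htt) (Finset.mem_union_right _ hx.1)
            (Finset.mem_union_right _ hv't)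
      · exact hd (Finset.mem_union_right _ hx.1) h'
    · rintro rfl
      rw [Finset.card_eq_one]
      refine ⟨v', ?_⟩
      ext x
      rw [Finset.mem_inter, Finset.mem_singleton]
      constructor
      · rintro ⟨hx, hx'⟩
        exact (hRs x hx').resolve_right fun h' => hd (Finset.mem_union_right _ hx) h'
      · rintro rfl
        exact ⟨hv't, hR3⟩
  refine ⟨R ∪ (T ∪ U), hR1.union (hT1.union h.tile hT2) hR2, ?_, ?_, ?_, ?_⟩
  · intro t' ht'
    rw [card_inter_union_of_disjoint _ hR2, card_inter_union_of_disjoint _ hR2,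
      card_inter_union_of_disjoint _ hT2, card_inter_union_of_disjoint _ hT2]
    have := h.ratio t' ht'
    by_cases hne : t' = t
    · subst hne
      obtain ⟨a1, -, a3⟩ := hR t' ht hst.symm
      rw [hT5, hT6, a3 rfl, a1, Finset.card_empty]
      obtain ⟨w', rfl⟩ : ∃ w', w = w' + 1 := ⟨w - 1, by omega⟩
      rw [Nat.add_sub_cancel]
      nlinarith
    · obtain ⟨e1, e2⟩ := inter_eq_empty_of_tile h𝒯 ht ht' hne hv hT4
      rw [e1, e2]
      by_cases hns : t' = s
      · subst hns
        rw [hR5, hR6, Finset.card_empty, Nat.zero_add, Nat.zero_add, Nat.mul_add, Nat.mul_add,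
          Nat.mul_comm u w]
        exact Nat.add_le_add (Nat.mul_le_mul_left _ (Nat.sub_le _ _)) this
      · obtain ⟨a1, a2, -⟩ := hR t' ht' hns
        rw [a1, a2 hne]
        simpa using this
  · intro t' ht'
    rw [card_inter_union_of_disjoint _ hR2, card_inter_union_of_disjoint _ hT2]
    have := h.bound t' ht'
    by_cases hne : t' = t
    · subst hne
      obtain ⟨a1, -, a3⟩ := hR t' ht hst.symm
      rw [hT6, a3 rfl]
      omega
    · obtain ⟨e1, e2⟩ := inter_eq_empty_of_tile h𝒯 ht ht' hne hv hT4
      rw [e2]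
      by_cases hns : t' = s
      · subst hns
        rw [hR6, Finset.card_empty]
        omega
      · obtain ⟨a1, a2, -⟩ := hR t' ht' hns
        rw [a2 hne]
        simpa using this
  · rw [Finset.union_sdiff_distrib, Finset.union_sdiff_distrib, h.out,
      Finset.sdiff_eq_empty_iff_subset.2 hRcov, Finset.empty_union]
    ext x
    rw [Finset.mem_union, Finset.mem_insert, Finset.mem_sdiff]
    refine or_congr ⟨?_, ?_⟩ Iff.rfl
    · rintro ⟨hx, hx'⟩
      exact (Finset.mem_insert.1 (hT4 hx)).resolve_right fun h' => hx' (subset_cov ht h')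
    · rintro rfl
      exact ⟨hT3, hv⟩
  · rw [Finset.card_union_of_disjoint hR2, Finset.card_union_of_disjoint hT2,
      Finset.card_insert_of_notMem hvS, hT7, hR7]
    have := h.card
    nlinarith

end Insert

lemma sum_card_snd_inter_le {G : SimpleGraph V} {X Y : Finset V} {p q N : ℕ}
    {𝒯 𝒲 : Finset (Finset V × Finset V)} (h𝒯 : IsNT G X Y p q N 𝒯) (h𝒲 : 𝒲 ⊆ 𝒯) (U : Finset V) :
    ∑ t ∈ 𝒲, (t.2 ∩ U).card ≤ U.card := by
  rw [← Finset.card_biUnion]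
  · refine Finset.card_le_card fun x hx => ?_
    obtain ⟨t, -, hx⟩ := Finset.mem_biUnion.1 hx
    exact (Finset.mem_inter.1 hx).2
  · intro t ht s hs hne
    exact (h𝒯.disj t (h𝒲 ht) s (h𝒲 hs) hne).mono
      (Finset.inter_subset_left.trans Finset.subset_union_right)
      (Finset.inter_subset_left.trans Finset.subset_union_right)

lemma degIn_le_sdiff_add {G : SimpleGraph V} (v : V) (Q U : Finset V) :
    degIn G v Q ≤ degIn G v (Q \ U) + (Q ∩ U).card := by
  have h1 : Q = (Q \ U) ∪ (Q ∩ U) := (Finset.sdiff_union_inter Q U).symm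
  calc degIn G v Q = degIn G v ((Q \ U) ∪ (Q ∩ U)) := by rw [← h1]
    _ ≤ _ := (degIn_union_le v _ _).trans (Nat.add_le_add_left (degIn_le_card v _) _)

section Find

variable [Fintype α] [Fintype V] {H : SimpleGraph α} {G : SimpleGraph V} {u w : ℕ}
  {X Y : Finset V} {p q N K k : ℕ} {𝒯 : Finset (Finset V × Finset V)} {S U : Finset V}

lemma Absorb.exists_tile_direct {𝒲 : Finset (Finset V × Finset V)} (h𝒯 : IsNT G X Y p q N 𝒯)
    (h𝒲 : 𝒲 ⊆ 𝒯) (hqk : q * N = k * K) (x : V)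
    (hx : k * U.card + 𝒲.card * (K + w) < degIn G x (𝒲.biUnion Prod.snd)) :
    ∃ t ∈ 𝒲, (t.2 ∩ U).card ≤ K ∧ w ≤ degIn G x (t.2 \ U) := by
  by_contra! hcon
  refine absurd hx (not_lt.2 ?_)
  calc degIn G x (𝒲.biUnion Prod.snd) ≤ ∑ t ∈ 𝒲, degIn G x t.2 := degIn_biUnion_le _ _ _
    _ ≤ ∑ t ∈ 𝒲, (k * (t.2 ∩ U).card + (K + w)) := by
        refine Finset.sum_le_sum fun t ht => ?_
        by_cases htK : (t.2 ∩ U).card ≤ K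
        · have h1 := hcon t ht htK
          have h2 := degIn_le_sdiff_add (G := G) x t.2 U
          omega
        · have h1 : degIn G x t.2 ≤ q * N := (degIn_le_card _ _).trans (h𝒯.card_snd t (h𝒲 ht)).le
          have h2 : k * K ≤ k * (t.2 ∩ U).card := Nat.mul_le_mul_left _ (by omega)
          omega
    _ = k * ∑ t ∈ 𝒲, (t.2 ∩ U).card + 𝒲.card * (K + w) := by
        rw [Finset.sum_add_distrib, Finset.mul_sum, Finset.sum_const, smul_eq_mul]
    _ ≤ _ := Nat.add_le_add_right
        (Nat.mul_le_mul_left _ (sum_card_snd_inter_le h𝒯 h𝒲 U)) _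

lemma Absorb.card_fst_inter_le (h : Absorb H G u w K 𝒯 S U) (huw : u < w)
    {t : Finset V × Finset V} (ht : t ∈ 𝒯) (htK : (t.2 ∩ U).card ≤ K) : (t.1 ∩ U).card ≤ K := by
  have h1 := h.ratio t ht
  by_contra! hc
  have h2 : w * K < w * (t.1 ∩ U).card := Nat.mul_lt_mul_of_pos_left hc (by omega)
  have h3 : u * (t.2 ∩ U).card ≤ w * K := Nat.mul_le_mul huw.le htK
  omega

lemma Absorb.exists_tile_exchange {𝒲 : Finset (Finset V × Finset V)}
    (h : Absorb H G u w K 𝒯 S U) (h𝒯 : IsNT G X Y p q N 𝒯)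
    (h𝒲 : 𝒲 ⊆ 𝒯) (hqk : q * N = k * K) (hk : 0 < k) (huw : u < w) (hpK : 2 * (K + u) ≤ p * N)
    (hqp : q ≤ w * p) (v : V) {A' : Finset V} (hA' : A' ⊆ 𝒲.biUnion Prod.snd)
    (hv : 2 * w * (𝒲.biUnion Prod.fst).card + k * U.card <
      A'.card + 2 * w * degIn G v (𝒲.biUnion Prod.fst)) :
    ∃ t ∈ 𝒲, (t.2 ∩ U).card ≤ K ∧ u ≤ degIn G v (t.1 \ U) ∧ ∃ v' ∈ A', v' ∈ t.2 ∧ v' ∉ U := by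
  by_contra! hcon
  refine absurd hv (not_lt.2 ?_)
  have hcardA : A'.card ≤ ∑ t ∈ 𝒲, (A' ∩ t.2).card := by
    refine le_trans (Finset.card_le_card fun x hx => ?_) Finset.card_biUnion_le
    obtain ⟨t, ht, hxt⟩ := Finset.mem_biUnion.1 (hA' hx)
    exact Finset.mem_biUnion.2 ⟨t, ht, Finset.mem_inter.2 ⟨hx, hxt⟩⟩
  have hcardP : (𝒲.biUnion Prod.fst).card = ∑ t ∈ 𝒲, t.1.card := by
    rw [Finset.card_biUnion]
    intro t ht s hs hne
    exact (h𝒯.disj t (h𝒲 ht) s (h𝒲 hs) hne).mono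
      Finset.subset_union_left Finset.subset_union_left
  have hdeg := degIn_biUnion_le (G := G) v 𝒲 Prod.fst
  calc A'.card + 2 * w * degIn G v (𝒲.biUnion Prod.fst)
      ≤ ∑ t ∈ 𝒲, (A' ∩ t.2).card + 2 * w * ∑ t ∈ 𝒲, degIn G v t.1 :=
        Nat.add_le_add hcardA (Nat.mul_le_mul_left _ hdeg)
    _ = ∑ t ∈ 𝒲, ((A' ∩ t.2).card + 2 * w * degIn G v t.1) := by
        rw [Finset.sum_add_distrib, Finset.mul_sum]
    _ ≤ ∑ t ∈ 𝒲, (2 * w * t.1.card + k * (t.2 ∩ U).card) := by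
        refine Finset.sum_le_sum fun t ht => ?_
        have hAq : (A' ∩ t.2).card ≤ q * N :=
          (Finset.card_le_card Finset.inter_subset_right).trans (h𝒯.card_snd t (h𝒲 ht)).le
        have hdt : degIn G v t.1 ≤ t.1.card := degIn_le_card _ _
        have hdt' : 2 * w * degIn G v t.1 ≤ 2 * w * t.1.card := Nat.mul_le_mul_left _ hdt
        by_cases htK : (t.2 ∩ U).card ≤ K
        · by_cases hut : u ≤ degIn G v (t.1 \ U)
          · have h1 := hcon t ht htK hut
            have h2 : A' ∩ t.2 ⊆ t.2 ∩ U := by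
              intro x hx
              rw [Finset.mem_inter] at hx ⊢
              exact ⟨hx.2, h1 x hx.1 hx.2⟩
            have h3 := Finset.card_le_card h2
            have h4 : 1 * (t.2 ∩ U).card ≤ k * (t.2 ∩ U).card := Nat.mul_le_mul_right _ hk
            omega
          · have h1 := degIn_le_sdiff_add (G := G) v t.1 U
            have h2 := h.card_fst_inter_le huw (h𝒲 ht) htK
            have h3 := h𝒯.card_fst t (h𝒲 ht)
            have h4 : q * N ≤ w * (p * N) := by
              rw [← Nat.mul_assoc]; exact Nat.mul_le_mul_right _ hqp
            have h5 : w * (2 * degIn G v t.1) ≤ w * t.1.card := Nat.mul_le_mul_left _ (by omega)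
            rw [← h3] at h4
            rw [← Nat.mul_assoc, Nat.mul_comm w 2] at h5
            have h6 : 2 * w * t.1.card = w * t.1.card + w * t.1.card := by ring
            omega
        · have h2 : k * K ≤ k * (t.2 ∩ U).card := Nat.mul_le_mul_left _ (by omega)
          omega
    _ = 2 * w * (𝒲.biUnion Prod.fst).card + k * ∑ t ∈ 𝒲, (t.2 ∩ U).card := by
        rw [hcardP, Finset.sum_add_distrib, Finset.mul_sum, Finset.mul_sum]
    _ ≤ _ := Nat.add_le_add_left
        (Nat.mul_le_mul_left _ (sum_card_snd_inter_le h𝒯 h𝒲 U)) _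

/-- One step of the covering process, for an exceptional vertex in `X`. -/
lemma Absorb.step (h : Absorb H G u w K 𝒯 S U) (h𝒯 : IsNT G X Y p q N 𝒯)
    (hT : TileSize H G w u) (hu : 0 < u) (hqk : q * N = k * K) (hk : 0 < k) (huw : u < w)
    (hpK : 2 * (K + u) ≤ p * N) (hqK : K + w ≤ q * N) (hqp : q ≤ w * p) {v : V} (hv : v ∉ cov 𝒯)
    (hvS : v ∉ S) {𝒜 ℬ : Finset (Finset V × Finset V)} (h𝒜 : 𝒜 ⊆ 𝒯) (hℬ : ℬ ⊆ 𝒯)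
    (h𝒜ℬ : Disjoint 𝒜 ℬ) (hY : Y ∩ cov 𝒯 ⊆ 𝒜.biUnion Prod.fst ∪ ℬ.biUnion Prod.snd)
    (hnum : 2 * w * (𝒜.biUnion Prod.fst).card + k * U.card +
      2 * w * (k * U.card + ℬ.card * (K + w)) + 2 * w * (Y \ cov 𝒯).card <
      ((𝒜.biUnion Prod.snd).filter fun x =>
        k * U.card + ℬ.card * (K + w) < degIn G x (ℬ.biUnion Prod.snd)).card +
        2 * w * degIn G v Y) :
    ∃ U', Absorb H G u w K 𝒯 (insert v S) U' := by
  have hfree : ∀ t ∈ 𝒯, (t.2 ∩ U).card ≤ K → u ≤ (t.1 \ U).card ∧ w ≤ (t.2 \ U).card := by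
    intro t ht htK
    have h1 := h.card_fst_inter_le huw ht htK
    have h2 := h𝒯.card_fst t ht
    have h3 := h𝒯.card_snd t ht
    have h4 := card_sdiff_add_inter t.1 U
    have h5 := card_sdiff_add_inter t.2 U
    omega
  by_cases hd : k * U.card + ℬ.card * (K + w) < degIn G v (ℬ.biUnion Prod.snd)
  · obtain ⟨t, ht, htK, htw⟩ := Absorb.exists_tile_direct h𝒯 hℬ hqk v hd
    exact h.direct h𝒯 hT hu hv hvS (hℬ ht) htK (hfree t (hℬ ht) htK).1 htw
  · push Not at hd
    have hdeg : degIn G v Y ≤ degIn G v (𝒜.biUnion Prod.fst) + degIn G v (ℬ.biUnion Prod.snd) +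
        (Y \ cov 𝒯).card := by
      have h1 := degIn_le_sdiff_add (G := G) v Y (Y \ cov 𝒯)
      have h2 : Y \ (Y \ cov 𝒯) = Y ∩ cov 𝒯 := Finset.sdiff_sdiff_self_left _ _
      have h3 : Y ∩ (Y \ cov 𝒯) = Y \ cov 𝒯 := Finset.inter_eq_right.2 Finset.sdiff_subset
      rw [h2, h3] at h1
      have h4 := (degIn_mono (G := G) v hY).trans (degIn_union_le v _ _)
      omega
    have hmul : 2 * w * degIn G v Y ≤ 2 * w * degIn G v (𝒜.biUnion Prod.fst) +
        2 * w * (k * U.card + ℬ.card * (K + w)) + 2 * w * (Y \ cov 𝒯).card := by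
      rw [← Nat.mul_add, ← Nat.mul_add]
      exact Nat.mul_le_mul_left _ (by omega)
    obtain ⟨t, ht, htK, htu, v', hv', hv't, hv'U⟩ :=
      h.exists_tile_exchange h𝒯 h𝒜 hqk hk huw hpK hqp v (Finset.filter_subset _ _)
        (show 2 * w * (𝒜.biUnion Prod.fst).card + k * U.card <
          ((𝒜.biUnion Prod.snd).filter fun x =>
            k * U.card + ℬ.card * (K + w) < degIn G x (ℬ.biUnion Prod.snd)).card +
          2 * w * degIn G v (𝒜.biUnion Prod.fst) by omega)
    obtain ⟨s, hs, hsK, hsw⟩ :=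
      Absorb.exists_tile_direct h𝒯 hℬ hqk v' (Finset.mem_filter.1 hv').2
    have hst : s ≠ t := fun e => Finset.disjoint_left.1 h𝒜ℬ ht (e ▸ hs)
    exact h.exchange h𝒯 hT hu (by omega) hv hvS (h𝒜 ht) (hℬ hs) hst htK hsK hv't hv'U htu
      (hfree t (h𝒜 ht) htK).2 (hfree s (hℬ hs) hsK).1 hsw

end Find

section Numeric

variable {u w M p q n A B : ℝ}

lemma tile_count_lower (hu : 1 ≤ u) (huw : u + 1 ≤ w) (hM : 4 ≤ M) (hp : p = u * M + 1)
    (hq : q = w * M - 1) (hn : 0 ≤ n) (h1 : p * (n - (p * B + q * A)) ≤ 2 * n)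
    (h2 : q * B + p * A ≤ n) : (w / (u + w) - 5 * w / M) * n ≤ q * A := by
  have hp0 : M ≤ p := by rw [hp]; nlinarith
  have hd0 : M / 2 ≤ q - p := by rw [hp, hq]; nlinarith
  have hs : p + q = (u + w) * M := by rw [hp, hq]; ring
  have hs0 : 0 < p + q := by rw [hs]; nlinarith
  have hpp : 0 < p := by linarith
  have hdp : 0 < q - p := by linarith
  have hqp : 0 < q := by linarith
  have key : (p * (q - p) - 2 * q) * n ≤ p * (p + q) * (q - p) * A := by
    nlinarith [mul_le_mul_of_nonneg_left h1 hqp.le, mul_le_mul_of_nonneg_left h2 (sq_nonneg p)]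
  have e1 : w / (u + w) = q / (p + q) + 1 / (p + q) := by
    rw [hs, hq]
    field_simp
    ring
  have e2 : 2 * q / (p * (q - p)) ≤ 4 * w / M := by
    rw [div_le_div_iff₀ (by positivity) (by linarith)]
    have h3 : M * (M / 2) ≤ p * (q - p) := mul_le_mul hp0 hd0 (by linarith) hpp.le
    have h4 : q ≤ w * M := by linarith
    nlinarith [mul_le_mul_of_nonneg_left h3 (by linarith : (0 : ℝ) ≤ 4 * w),
      mul_le_mul_of_nonneg_right h4 (by linarith : (0 : ℝ) ≤ 2 * M)]
  have e3 : q / (p + q) ≤ 1 := by rw [div_le_one hs0]; linarith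
  have e4 : 1 / (p + q) ≤ w / M := by
    rw [div_le_div_iff₀ hs0 (by linarith)]
    nlinarith
  have e5 : q / (p + q) * n - 2 * q / (p * (q - p)) * (q / (p + q)) * n ≤ q * A := by
    have : q / (p + q) * n - 2 * q / (p * (q - p)) * (q / (p + q)) * n =
        q * ((p * (q - p) - 2 * q) * n) / (p * (p + q) * (q - p)) := by
      field_simp
    rw [this, div_le_iff₀ (by positivity)]
    nlinarith [mul_le_mul_of_nonneg_left key hqp.le]
  have e6 : 2 * q / (p * (q - p)) * (q / (p + q)) * n ≤ 4 * w / M * n := by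
    refine mul_le_mul_of_nonneg_right ?_ hn
    calc 2 * q / (p * (q - p)) * (q / (p + q)) ≤ 2 * q / (p * (q - p)) * 1 :=
          mul_le_mul_of_nonneg_left e3 (by positivity)
      _ ≤ _ := by rw [mul_one]; exact e2
  have e7 : 1 / (p + q) * n ≤ w / M * n := mul_le_mul_of_nonneg_right e4 hn
  rw [e1]
  have e8 : (q / (p + q) + 1 / (p + q) - 5 * w / M) * n =
      q / (p + q) * n + 1 / (p + q) * n - 4 * w / M * n - w / M * n := by ring
  rw [e8]
  linarith

lemma tile_count_upper (hu : 1 ≤ u) (huw : u + 1 ≤ w) (hM : 4 ≤ M) (hp : p = u * M + 1)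
    (hq : q = w * M - 1) (hn : 0 ≤ n) (h1 : p * (n - (q * B + p * A)) ≤ 2 * n)
    (h2 : p * B + q * A ≤ n) : p * A ≤ (u / (u + w) + 5 / M) * n := by
  have hp0 : M ≤ p := by rw [hp]; nlinarith
  have hd0 : M / 2 ≤ q - p := by rw [hp, hq]; nlinarith
  have hs : p + q = (u + w) * M := by rw [hp, hq]; ring
  have hs0 : 0 < p + q := by rw [hs]; nlinarith
  have hpp : 0 < p := by linarith
  have hdp : 0 < q - p := by linarith
  have hqp : 0 < q := by linarith
  have key : (p + q) * (q - p) * A ≤ (q - p + 2) * n := by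
    nlinarith [mul_le_mul_of_nonneg_left h2 hqp.le]
  have e1 : p / (p + q) = u / (u + w) + 1 / (p + q) := by
    rw [hs, hp]
    field_simp
  have e2 : 2 / (q - p) ≤ 4 / M := by
    rw [div_le_div_iff₀ hdp (by linarith)]
    linarith
  have e3 : p / (p + q) ≤ 1 := by rw [div_le_one hs0]; linarith
  have e4 : 1 / (p + q) ≤ 1 / M := by
    rw [div_le_div_iff₀ hs0 (by linarith)]
    linarith
  have e5 : p * A ≤ p / (p + q) * n + 2 / (q - p) * (p / (p + q)) * n := by
    have : p / (p + q) * n + 2 / (q - p) * (p / (p + q)) * n =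
        p * ((q - p + 2) * n) / ((p + q) * (q - p)) := by
      field_simp
    rw [this, le_div_iff₀ (by positivity)]
    nlinarith [mul_le_mul_of_nonneg_left key hpp.le]
  have e6 : 2 / (q - p) * (p / (p + q)) * n ≤ 4 / M * n := by
    refine mul_le_mul_of_nonneg_right ?_ hn
    calc 2 / (q - p) * (p / (p + q)) ≤ 2 / (q - p) * 1 :=
          mul_le_mul_of_nonneg_left e3 (by positivity)
      _ ≤ _ := by rw [mul_one]; exact e2
  have e7 : 1 / (p + q) * n ≤ 1 / M * n := mul_le_mul_of_nonneg_right e4 hn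
  have e8 : (u / (u + w) + 5 / M) * n = u / (u + w) * n + 1 / M * n + 4 / M * n := by ring
  have e9 : p / (p + q) * n = u / (u + w) * n + 1 / (p + q) * n := by rw [e1, add_mul]
  rw [e8]
  linarith

lemma absorb_numeric {h k a As deg U D Yc e A' : ℝ} (hu : 1 ≤ u) (huw : u + 1 ≤ w)
    (hk : 8 * (2 * w + 1) ≤ a * k) (hk0 : 0 < k) (hM0 : 0 < M)
    (hM : 4 * (14 * w + 8 * h * k * (2 * w + 2)) ≤ a * M) (ha : 0 < a) (hn : 0 < n)
    (hAs : As ≤ (u / h + 5 / M) * n) (hdeg : u / h * n ≤ deg) (hU : U ≤ 8 * h * n / M)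
    (hD : D ≤ k * U + 2 * n / k) (hYc : Yc ≤ 2 * n / M) (he : a * n ^ 2 < e)
    (he' : e ≤ n * A' + D * n) :
    2 * w * As + k * U + 2 * w * D + 2 * w * Yc < A' + 2 * w * deg := by
  have h1 : a * n - D < A' := by
    by_contra! hc
    nlinarith [mul_le_mul_of_nonneg_left hc hn.le]
  have hw : 0 < w := by linarith
  have h2 : 2 * w * As ≤ 2 * w * deg + 10 * w * (n / M) := by
    have : As ≤ deg + 5 * (n / M) := by
      have : (u / h + 5 / M) * n = u / h * n + 5 * (n / M) := by ring
      linarith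
    nlinarith
  have h3 : k * U ≤ 8 * h * k * (n / M) := by
    calc k * U ≤ k * (8 * h * n / M) := mul_le_mul_of_nonneg_left hU hk0.le
      _ = _ := by ring
  have h4 : 2 * w * Yc ≤ 4 * w * (n / M) := by
    calc 2 * w * Yc ≤ 2 * w * (2 * n / M) := mul_le_mul_of_nonneg_left hYc (by positivity)
      _ = _ := by ring
  have h5 : (2 * w + 1) * D ≤ (2 * w + 1) * (8 * h * k * (n / M)) + (2 * w + 1) * 2 * (n / k) := by
    calc (2 * w + 1) * D ≤ (2 * w + 1) * (8 * h * k * (n / M) + 2 * n / k) :=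
          mul_le_mul_of_nonneg_left (by linarith) (by positivity)
      _ = _ := by ring
  have h6 : (2 * w + 1) * 2 * (n / k) ≤ a * n / 4 := by
    calc (2 * w + 1) * 2 * (n / k) = 8 * (2 * w + 1) * (n / k) / 4 := by ring
      _ ≤ a * k * (n / k) / 4 := by
          have := mul_le_mul_of_nonneg_right hk (by positivity : 0 ≤ n / k)
          linarith
      _ = a * n / 4 := by field_simp
  have h7 : (14 * w + 8 * h * k * (2 * w + 2)) * (n / M) ≤ a * n / 4 := by
    calc (14 * w + 8 * h * k * (2 * w + 2)) * (n / M)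
        = 4 * (14 * w + 8 * h * k * (2 * w + 2)) * (n / M) / 4 := by ring
      _ ≤ a * M * (n / M) / 4 := by
          have := mul_le_mul_of_nonneg_right hM (by positivity : 0 ≤ n / M)
          linarith
      _ = a * n / 4 := by field_simp
  have h8 : 0 < a * n := by positivity
  linarith

end Numeric

section Cover

variable {G : SimpleGraph V} {X Y : Finset V} {p q N : ℕ} {𝒯 : Finset (Finset V × Finset V)}

lemma IsNT.card_biUnion_fst (h : IsNT G X Y p q N 𝒯) {𝒲 : Finset (Finset V × Finset V)}
    (h𝒲 : 𝒲 ⊆ 𝒯) : (𝒲.biUnion Prod.fst).card = 𝒲.card * (p * N) := by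
  rw [Finset.card_biUnion, Finset.sum_congr rfl (fun t ht => h.card_fst t (h𝒲 ht))]
  · simp
  · intro t ht s hs hne
    exact (h.disj t (h𝒲 ht) s (h𝒲 hs) hne).mono
      Finset.subset_union_left Finset.subset_union_left

lemma IsNT.card_biUnion_snd (h : IsNT G X Y p q N 𝒯) {𝒲 : Finset (Finset V × Finset V)}
    (h𝒲 : 𝒲 ⊆ 𝒯) : (𝒲.biUnion Prod.snd).card = 𝒲.card * (q * N) := by
  rw [Finset.card_biUnion, Finset.sum_congr rfl (fun t ht => h.card_snd t (h𝒲 ht))]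
  · simp
  · intro t ht s hs hne
    exact (h.disj t (h𝒲 ht) s (h𝒲 hs) hne).mono
      Finset.subset_union_right Finset.subset_union_right

lemma IsNT.inter_cov_subset {𝒜 ℬ : Finset (Finset V × Finset V)} (hXY : Disjoint X Y)
    (h𝒜 : ∀ t ∈ 𝒜, t.1 ⊆ Y ∧ t.2 ⊆ X) (hℬ : ∀ t ∈ ℬ, t.1 ⊆ X ∧ t.2 ⊆ Y)
    (hu : 𝒯 = 𝒜 ∪ ℬ) : Y ∩ cov 𝒯 ⊆ 𝒜.biUnion Prod.fst ∪ ℬ.biUnion Prod.snd := by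
  intro x hx
  obtain ⟨hxY, hx⟩ := Finset.mem_inter.1 hx
  have hxX : x ∉ X := fun h' => Finset.disjoint_left.1 hXY h' hxY
  obtain ⟨t, ht, hx⟩ := mem_cov.1 hx
  rw [hu] at ht
  rw [Finset.mem_union, Finset.mem_biUnion, Finset.mem_biUnion]
  rcases Finset.mem_union.1 ht with ht | ht <;> rcases hx with hx | hx
  · exact Or.inl ⟨t, ht, hx⟩
  · exact absurd ((h𝒜 t ht).2 hx) hxX
  · exact absurd ((hℬ t ht).1 hx) hxX
  · exact Or.inr ⟨t, ht, hx⟩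

end Cover

/-- All large sets on the two sides span many edges. -/
def NonExt (G : SimpleGraph V) (X Y : Finset V) (n : ℕ) (r a : ℝ) : Prop :=
  ∀ A ⊆ X, ∀ B ⊆ Y, (r - a) * n ≤ A.card → (r - a) * n ≤ B.card → a * n ^ 2 < eAB G A B

lemma NonExt.swap {G : SimpleGraph V} {X Y : Finset V} {n : ℕ} {r a : ℝ}
    (h : NonExt G X Y n r a) : NonExt G Y X n r a := by
  intro A hA B hB hAc hBc
  rw [eAB_comm]
  exact h B hB A hA hBc hAc

lemma eAB_le_of_lt_threshold {G : SimpleGraph V} (S T : Finset V) (D : ℕ) :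
    eAB G S T ≤ T.card * (S.filter fun s => D < degIn G s T).card + D * S.card := by
  rw [eAB_eq_sum]
  calc ∑ s ∈ S, degIn G s T ≤ ∑ s ∈ S, ((if D < degIn G s T then T.card else 0) + D) := by
        refine Finset.sum_le_sum fun s _ => ?_
        have := degIn_le_card (G := G) s T
        split_ifs <;> omega
    _ = _ := by
        rw [Finset.sum_add_distrib, Finset.card_filter, Finset.mul_sum, Finset.sum_const,
          smul_eq_mul, Nat.mul_comm D]
        simp

lemma eAB_le_of_lt_threshold_real {G : SimpleGraph V} (S T : Finset V) (D : ℕ) {n : ℝ}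
    (hS : (S.card : ℝ) ≤ n) (hT : (T.card : ℝ) ≤ n) : (eAB G S T : ℝ) ≤
      n * ((S.filter fun s => D < degIn G s T).card : ℕ) + D * n := by
  have h1 : (eAB G S T : ℝ) ≤
      (T.card * (S.filter fun s => D < degIn G s T).card + D * S.card : ℕ) := by
    exact_mod_cast eAB_le_of_lt_threshold (G := G) S T D
  push_cast at h1
  refine h1.trans (add_le_add ?_ ?_)
  · exact mul_le_mul_of_nonneg_right hT (Nat.cast_nonneg _)
  · exact mul_le_mul_of_nonneg_left hS (Nat.cast_nonneg _)

lemma le_div_of_mul_le {M p y n : ℝ} (hM : 0 < M) (hMp : M ≤ p) (hy : 0 ≤ y)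
    (h : p * y ≤ 2 * n) : y ≤ 2 * n / M := by
  rw [le_div_iff₀ hM]
  nlinarith

lemma mul_le_of_count {D' p U S n h M : ℝ} (hD : D' = 8 * h * n / M) (hM : 0 < M) (hMp : M ≤ p)
    (hS : p * S ≤ 4 * n) (hS0 : 0 ≤ S) (hh : 0 ≤ h) (hU : U ≤ 2 * h * S) : U ≤ D' := by
  rw [hD, le_div_iff₀ hM]
  have h1 : M * S ≤ 4 * n := (mul_le_mul_of_nonneg_right hMp hS0).trans hS
  have h2 : 2 * h * (M * S) ≤ 2 * h * (4 * n) := mul_le_mul_of_nonneg_left h1 (by positivity)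
  nlinarith

lemma threshold_le {b q k w n : ℝ} (hk : 0 < k) (hb : 0 ≤ b) (hw : w ≤ q * k)
    (hn : q * (k * k * b) ≤ n) : b * (q * k + w) ≤ 2 * n / k := by
  rw [le_div_iff₀ hk]
  nlinarith [mul_le_mul_of_nonneg_left hw (mul_nonneg hb hk.le)]

section Step

variable [Fintype α] [Fintype V] {H : SimpleGraph α} {G : SimpleGraph V} {u w : ℕ}
  {X Y : Finset V} {p q k M n : ℕ} {𝒯 : Finset (Finset V × Finset V)} {S U : Finset V} {a : ℝ}

/-- The relations between the parameters of the covering process. -/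
structure Params (u w k M p q : ℕ) (a : ℝ) : Prop where
  u_pos : 0 < u
  lt : u < w
  p_eq : p = u * M + 1
  q_eq : q + 1 = w * M
  a_pos : 0 < a
  k_large : 8 * (u + w) ^ 3 ≤ k
  k_large' : 8 * (2 * (w : ℝ) + 1) ≤ a * k
  M_four : 4 ≤ M
  M_large : 4 * (14 * (w : ℝ) + 8 * ((u + w : ℕ) : ℝ) * k * (2 * w + 2)) ≤ a * M

lemma Params.nat (h : Params u w k M p q a) : 2 * w + 2 * u ≤ k ∧ 0 < k ∧ 0 < p ∧ p < q ∧
    q ≤ w * p ∧ M ≤ p ∧ p + q = (u + w) * M := by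
  obtain ⟨h1, h2, h3, h4, -, h6, -, h8, -⟩ := h
  have e1 : 2 * (u + w) ≤ 8 * (u + w) ^ 3 := by
    have : 1 ≤ (u + w) ^ 2 := Nat.one_le_pow _ _ (by omega)
    have e : (u + w) ^ 3 = (u + w) * (u + w) ^ 2 := by ring
    rw [e]
    nlinarith
  have e2 : M ≤ u * M := Nat.le_mul_of_pos_left M h1
  have e3 : u * M + M ≤ w * M := by
    rw [← Nat.succ_mul]
    exact Nat.mul_le_mul_right _ h2
  refine ⟨by omega, by omega, by omega, by omega, ?_, by omega, ?_⟩
  · have : w * M ≤ w * p := Nat.mul_le_mul_left _ (by omega)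
    omega
  · rw [Nat.add_mul]
    omega

lemma Params.free (h : Params u w k M p q a) : 2 * (q * k + u) ≤ p * (k * k) ∧
    q * k + w ≤ q * (k * k) ∧ w ≤ q * k := by
  obtain ⟨hk2, hk0, hp0, hpq, hqp, -, -⟩ := h.nat
  have huw := h.lt
  refine ⟨?_, ?_, ?_⟩
  · have e1 : q * k ≤ w * (p * k) := by
      rw [← Nat.mul_assoc]
      exact Nat.mul_le_mul_right _ hqp
    have e2 : (2 * w + 2 * u) * (p * k) ≤ k * (p * k) := Nat.mul_le_mul_right _ hk2
    have e3 : u ≤ u * (p * k) := Nat.le_mul_of_pos_right _ (Nat.mul_pos hp0 hk0)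
    nlinarith
  · have e1 : 1 * k ≤ q * k := Nat.mul_le_mul_right _ (by omega)
    have e2 : 2 * (q * k) ≤ k * (q * k) := Nat.mul_le_mul_right _ (by omega)
    nlinarith
  · have : 1 * k ≤ q * k := Nat.mul_le_mul_right _ (by omega)
    omega

lemma Absorb.step_of_nonExt (hP : Params u w k M p q a) (hT : TileSize H G w u)
    (h𝒯 : IsNT G X Y p q (k * k) 𝒯) (hB : Bal G X Y n u (u + w)) (hn : 0 < n)
    (hX : p * (X \ cov 𝒯).card ≤ 2 * n) (hY : p * (Y \ cov 𝒯).card ≤ 2 * n)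
    (hE : NonExt G X Y n ((w : ℝ) / (u + w : ℕ)) a) (h : Absorb H G u w (q * k) 𝒯 S U)
    (hS : S ⊆ (X ∪ Y) \ cov 𝒯) {v : V} (hv : v ∈ X \ cov 𝒯) (hvS : v ∉ S) :
    ∃ U', Absorb H G u w (q * k) 𝒯 (insert v S) U' := by
  obtain ⟨hk2, hk0, hp0, hpq, hqp, hMp, hpqM⟩ := hP.nat
  have hu := hP.u_pos
  have huw := hP.lt
  set ℬ := 𝒯.filter fun t => t.1 ⊆ X ∧ t.2 ⊆ Y with hℬ
  set 𝒜 := 𝒯.filter fun t => ¬ (t.1 ⊆ X ∧ t.2 ⊆ Y) with h𝒜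
  have h𝒜s : 𝒜 ⊆ 𝒯 := Finset.filter_subset _ _
  have hℬs : ℬ ⊆ 𝒯 := Finset.filter_subset _ _
  have h𝒜m : ∀ t ∈ 𝒜, t.1 ⊆ Y ∧ t.2 ⊆ X := fun t ht =>
    (h𝒯.side t (h𝒜s ht)).resolve_left (Finset.mem_filter.1 ht).2
  have hℬm : ∀ t ∈ ℬ, t.1 ⊆ X ∧ t.2 ⊆ Y := fun t ht => (Finset.mem_filter.1 ht).2
  have hdisj : Disjoint 𝒜 ℬ := (Finset.disjoint_filter_filter_not 𝒯 𝒯 _).symm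
  have hun : 𝒯 = 𝒜 ∪ ℬ := by
    rw [Finset.union_comm]
    exact (Finset.filter_union_filter_not_eq _ 𝒯).symm
  have cX := h𝒯.card_inter_left hB.disj
  have cY := h𝒯.card_inter_right hB.disj
  rw [← hℬ, ← h𝒜] at cX cY
  have sX := card_sdiff_add_inter X (cov 𝒯)
  have sY := card_sdiff_add_inter Y (cov 𝒯)
  rw [hB.card_left] at sX
  rw [hB.card_right] at sY
  have hScard : p * S.card ≤ 4 * n := by
    have h1 : S.card ≤ (X \ cov 𝒯).card + (Y \ cov 𝒯).card := by
      refine (Finset.card_le_card hS).trans ?_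
      rw [Finset.union_sdiff_distrib]
      exact Finset.card_union_le _ _
    have h2 := Nat.mul_le_mul_left p h1
    rw [Nat.mul_add] at h2
    omega
  have hUcard := h.card
  -- real versions
  have hM0 : (0 : ℝ) < M := by exact_mod_cast (by have := hP.M_four; omega : 0 < M)
  have hn0 : (0 : ℝ) < n := by exact_mod_cast hn
  have hkr : (0 : ℝ) < k := by exact_mod_cast hk0
  have hp0r : (0 : ℝ) < p := by exact_mod_cast hp0
  have hur : (1 : ℝ) ≤ u := by exact_mod_cast hu
  have huwr : (u : ℝ) + 1 ≤ w := by exact_mod_cast huw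
  have hM4 : (4 : ℝ) ≤ M := by exact_mod_cast hP.M_four
  have hpr : (p : ℝ) = u * M + 1 := by exact_mod_cast hP.p_eq
  have hqr : (q : ℝ) = w * M - 1 := by
    have := hP.q_eq
    have h' : (q : ℝ) + 1 = w * M := by exact_mod_cast this
    linarith
  have hMpr : (M : ℝ) ≤ p := by exact_mod_cast hMp
  obtain ⟨A, hA⟩ : ∃ A : ℝ, A = (k * k : ℕ) * (𝒜.card : ℝ) := ⟨_, rfl⟩
  obtain ⟨B, hBdef⟩ : ∃ B : ℝ, B = (k * k : ℕ) * (ℬ.card : ℝ) := ⟨_, rfl⟩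
  have xX : ((X ∩ cov 𝒯).card : ℝ) = p * B + q * A := by rw [cX, hA, hBdef]; push_cast; ring
  have xY : ((Y ∩ cov 𝒯).card : ℝ) = q * B + p * A := by rw [cY, hA, hBdef]; push_cast; ring
  have sXr : ((X \ cov 𝒯).card : ℝ) + ((X ∩ cov 𝒯).card : ℝ) = n := by exact_mod_cast sX
  have sYr : ((Y \ cov 𝒯).card : ℝ) + ((Y ∩ cov 𝒯).card : ℝ) = n := by exact_mod_cast sY
  have hXr : (p : ℝ) * ((X \ cov 𝒯).card : ℝ) ≤ 2 * n := by exact_mod_cast hX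
  have hYr : (p : ℝ) * ((Y \ cov 𝒯).card : ℝ) ≤ 2 * n := by exact_mod_cast hY
  have nX : (0 : ℝ) ≤ ((X \ cov 𝒯).card : ℝ) := Nat.cast_nonneg _
  have nY : (0 : ℝ) ≤ ((Y \ cov 𝒯).card : ℝ) := Nat.cast_nonneg _
  have eX : ((X \ cov 𝒯).card : ℝ) = n - (p * B + q * A) := by linarith
  have eY : ((Y \ cov 𝒯).card : ℝ) = n - (q * B + p * A) := by linarith
  have b1 : (w / (u + w) - 5 * w / M) * (n : ℝ) ≤ q * A :=
    tile_count_lower hur huwr hM4 hpr hqr hn0.le (by rw [← eX]; exact hXr) (by linarith)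
  have b2 : (w / (u + w) - 5 * w / M) * (n : ℝ) ≤ q * B :=
    tile_count_lower hur huwr hM4 hpr hqr hn0.le
      (by rw [show (p : ℝ) * A + q * B = q * B + p * A by ring, ← eY]; exact hYr) (by linarith)
  have b3 : (p : ℝ) * A ≤ (u / (u + w) + 5 / M) * n :=
    tile_count_upper hur huwr hM4 hpr hqr hn0.le (by rw [← eY]; exact hYr) (by linarith)
  have hMa : 5 * (w : ℝ) / M ≤ a := by
    rw [div_le_iff₀ hM0]
    have := hP.M_large
    have h' : 0 ≤ 8 * ((u + w : ℕ) : ℝ) * k * (2 * w + 2) := by positivity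
    linarith
  have cA : ((𝒜.biUnion Prod.snd).card : ℝ) = q * A := by
    rw [h𝒯.card_biUnion_snd h𝒜s, hA]; push_cast; ring
  have cB : ((ℬ.biUnion Prod.snd).card : ℝ) = q * B := by
    rw [h𝒯.card_biUnion_snd hℬs, hBdef]; push_cast; ring
  have cAs : ((𝒜.biUnion Prod.fst).card : ℝ) = p * A := by
    rw [h𝒯.card_biUnion_fst h𝒜s, hA]; push_cast; ring
  have hAX : 𝒜.biUnion Prod.snd ⊆ X := Finset.biUnion_subset.2 fun t ht => (h𝒜m t ht).2
  have hBY : ℬ.biUnion Prod.snd ⊆ Y := Finset.biUnion_subset.2 fun t ht => (hℬm t ht).2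
  have hAn : ((𝒜.biUnion Prod.snd).card : ℝ) ≤ n := by
    have := Finset.card_le_card hAX
    rw [hB.card_left] at this
    exact_mod_cast this
  have hBn : ((ℬ.biUnion Prod.snd).card : ℝ) ≤ n := by
    have := Finset.card_le_card hBY
    rw [hB.card_right] at this
    exact_mod_cast this
  have hwh : (w : ℝ) / (u + w : ℕ) = w / (u + w) := by push_cast; rfl
  have hsub : (w / (u + w) - a) * (n : ℝ) ≤ (w / (u + w) - 5 * w / M) * (n : ℝ) :=
    mul_le_mul_of_nonneg_right (by linarith) hn0.le
  have he := hE _ hAX _ hBY (by rw [hwh, cA]; linarith) (by rw [hwh, cB]; linarith)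
  obtain ⟨D, hD⟩ : ∃ D : ℕ, D = k * U.card + ℬ.card * (q * k + w) := ⟨_, rfl⟩
  have he' : (eAB G (𝒜.biUnion Prod.snd) (ℬ.biUnion Prod.snd) : ℝ) ≤
      n * (((𝒜.biUnion Prod.snd).filter fun x => D < degIn G x (ℬ.biUnion Prod.snd)).card : ℕ) +
        D * n := eAB_le_of_lt_threshold_real _ _ D hAn hBn
  have hUr : (U.card : ℝ) ≤ 8 * ((u + w : ℕ) : ℝ) * n / M :=
    mul_le_of_count rfl hM0 hMpr (by exact_mod_cast hScard) (Nat.cast_nonneg S.card)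
      (Nat.cast_nonneg _) (by exact_mod_cast hUcard)
  obtain ⟨hK1, hK2, hwqk⟩ := hP.free
  have hDr : (D : ℝ) ≤ k * U.card + 2 * n / k := by
    rw [hD]
    push_cast
    refine add_le_add le_rfl (threshold_le hkr (Nat.cast_nonneg _) (by exact_mod_cast hwqk) ?_)
    rw [cB, hBdef] at hBn
    exact_mod_cast hBn
  have hYc : ((Y \ cov 𝒯).card : ℝ) ≤ 2 * n / M :=
    le_div_of_mul_le hM0 hMpr nY hYr
  have hvX := (Finset.mem_sdiff.1 hv).1
  have hdeg : (u : ℝ) / (u + w : ℕ) * n ≤ degIn G v Y := by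
    have h1 := hB.deg_left v hvX
    have h2 : (u : ℝ) * n ≤ (u + w : ℕ) * degIn G v Y := by exact_mod_cast h1
    rw [div_mul_eq_mul_div, div_le_iff₀ (by exact_mod_cast (by omega : 0 < u + w))]
    linarith
  have hnum := absorb_numeric (As := ((𝒜.biUnion Prod.fst).card : ℝ)) hur huwr hP.k_large' hkr hM0
    hP.M_large hP.a_pos hn0 (by rw [cAs]; push_cast; exact b3) hdeg hUr hDr hYc he he'
  refine h.step h𝒯 hT hu (k := k) (by ring) hk0 huw hK1 hK2 hqp (Finset.mem_sdiff.1 hv).2 hvS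
    h𝒜s hℬs hdisj (IsNT.inter_cov_subset hB.disj h𝒜m hℬm hun) ?_
  rw [← hD]
  exact_mod_cast hnum

end Step

lemma Params.gd_right {u w k M p q : ℕ} {a : ℝ} (h : Params u w k M p q a) :
    u * (q * (k * k)) + 3 * (u + w) ^ 4 ≤ w * (p * (k * k)) := by
  have hk := h.k_large
  obtain ⟨-, hk0, -⟩ := h.nat
  have e1 : w * p = u * q + (u + w) := by
    have h1 := h.q_eq
    rw [h.p_eq]
    calc w * (u * M + 1) = u * (w * M) + w := by ring
      _ = u * (q + 1) + w := by rw [h1]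
      _ = _ := by ring
  have e2 : k ≤ k * k := Nat.le_mul_of_pos_left k hk0
  calc u * (q * (k * k)) + 3 * (u + w) ^ 4
      = u * q * (k * k) + (u + w) * (3 * (u + w) ^ 3) := by ring
    _ ≤ u * q * (k * k) + (u + w) * (k * k) :=
        Nat.add_le_add_left (Nat.mul_le_mul_left _ (by omega)) _
    _ = (u * q + (u + w)) * (k * k) := by ring
    _ = w * p * (k * k) := by rw [e1]
    _ = _ := by ring

lemma Params.gd_left {u w k M p q : ℕ} {a : ℝ} (h : Params u w k M p q a) :
    u * (p * (k * k)) + 3 * (u + w) ^ 4 + w * (q * k + w) ≤ w * (q * (k * k)) := by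
  have hk := h.k_large
  have hu := h.u_pos
  have huw := h.lt
  obtain ⟨hk2, hk0, hp0, hpq, -⟩ := h.nat
  have e0 : u + w ≤ q * k := by
    have : 1 * k ≤ q * k := Nat.mul_le_mul_right _ (by omega)
    omega
  have e1 : u * (p * (k * k)) ≤ u * (q * (k * k)) :=
    Nat.mul_le_mul_left _ (Nat.mul_le_mul_right _ hpq.le)
  have e2 : (u + 1) * (q * (k * k)) ≤ w * (q * (k * k)) := Nat.mul_le_mul_right _ huw
  have e3 : 8 * (u + w) ^ 3 * (q * k) ≤ k * (q * k) := Nat.mul_le_mul_right _ hk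
  have e4 : 3 * (u + w) ^ 4 ≤ 3 * (u + w) ^ 3 * (q * k) := by
    calc 3 * (u + w) ^ 4 = 3 * (u + w) ^ 3 * (u + w) := by ring
      _ ≤ _ := Nat.mul_le_mul_left _ e0
  have e5 : w ≤ (u + w) ^ 3 := by
    calc w ≤ u + w := by omega
      _ ≤ (u + w) ^ 3 := Nat.le_self_pow (by norm_num) _
  have e6 : w * (q * k + w) ≤ (u + w) ^ 3 * (q * k + q * k) :=
    Nat.mul_le_mul e5 (by omega)
  nlinarith

section Final

variable [Fintype α] [Fintype V] {H : SimpleGraph α} {G : SimpleGraph V} {u w : ℕ}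
  {X Y : Finset V} {p q k M n : ℕ} {𝒯 : Finset (Finset V × Finset V)} {S U : Finset V} {a : ℝ}

lemma Absorb.empty {K : ℕ} : Absorb H G u w K 𝒯 ∅ ∅ :=
  ⟨tileable_empty, by simp, by simp, by simp, by simp⟩

lemma exists_absorb (hP : Params u w k M p q a) (hT : TileSize H G w u)
    (h𝒯 : IsNT G X Y p q (k * k) 𝒯) (hB : Bal G X Y n u (u + w)) (hn : 0 < n)
    (hX : p * (X \ cov 𝒯).card ≤ 2 * n) (hY : p * (Y \ cov 𝒯).card ≤ 2 * n)
    (hE : NonExt G X Y n ((w : ℝ) / (u + w : ℕ)) a) :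
    ∃ U, Absorb H G u w (q * k) 𝒯 ((X ∪ Y) \ cov 𝒯) U := by
  have key : ∀ S : Finset V, S ⊆ (X ∪ Y) \ cov 𝒯 → ∃ U, Absorb H G u w (q * k) 𝒯 S U := by
    intro S
    induction S using Finset.induction_on with
    | empty => exact fun _ => ⟨∅, Absorb.empty⟩
    | insert v S hvS ih =>
      intro hS
      have hS' : S ⊆ (X ∪ Y) \ cov 𝒯 := (Finset.subset_insert v S).trans hS
      obtain ⟨U, hU⟩ := ih hS'
      have hv := Finset.mem_sdiff.1 (hS (Finset.mem_insert_self v S))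
      rcases Finset.mem_union.1 hv.1 with hvX | hvY
      · exact hU.step_of_nonExt hP hT h𝒯 hB hn hX hY hE hS' (Finset.mem_sdiff.2 ⟨hvX, hv.2⟩) hvS
      · exact hU.step_of_nonExt hP hT h𝒯.swap hB.swap hn hY hX hE.swap
          (by rwa [Finset.union_comm]) (Finset.mem_sdiff.2 ⟨hvY, hv.2⟩) hvS
  exact key _ Finset.Subset.rfl

lemma Absorb.gd (h : Absorb H G u w (q * k) 𝒯 S U) (hP : Params u w k M p q a)
    (h𝒯 : IsNT G X Y p q (k * k) 𝒯) {t : Finset V × Finset V} (ht : t ∈ 𝒯) :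
    Gd G u w (3 * (u + w) ^ 4) (t.1 \ U) (t.2 \ U) := by
  have h1 := h.ratio t ht
  have h2 := h.bound t ht
  have h3 := hP.gd_right
  have h4 := hP.gd_left
  have c1 := card_sdiff_add_inter t.1 U
  have c2 := card_sdiff_add_inter t.2 U
  rw [h𝒯.card_fst t ht] at c1
  rw [h𝒯.card_snd t ht] at c2
  have h5 : w * (t.2 ∩ U).card ≤ w * (q * k + w) := Nat.mul_le_mul_left _ h2
  rw [← c1, ← c2] at h3 h4
  simp only [Nat.mul_add] at h3 h4 h5
  refine ⟨(h𝒯.cpl t ht).mono Finset.sdiff_subset Finset.sdiff_subset, ?_, ?_⟩ <;> omega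

lemma Absorb.tileable {c : α → Bool} (hD : HData H u w c)
    (h : Absorb H G u w (q * k) 𝒯 ((X ∪ Y) \ cov 𝒯) U)
    (hP : Params u w k M p q a) (h𝒯 : IsNT G X Y p q (k * k) 𝒯)
    (hdvd : u + w ∣ (X ∪ Y).card) : Tileable H G (X ∪ Y) := by
  have hUsub : U ⊆ X ∪ Y := by
    intro x hx
    by_cases hc : x ∈ cov 𝒯
    · exact h𝒯.cov_subset hc
    · have : x ∈ U \ cov 𝒯 := Finset.mem_sdiff.2 ⟨hx, hc⟩
      rw [h.out] at this
      exact (Finset.mem_sdiff.1 this).1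
  have hrest : (X ∪ Y) \ U = 𝒯.biUnion fun t => (t.1 \ U) ∪ (t.2 \ U) := by
    ext x
    simp only [Finset.mem_sdiff, Finset.mem_biUnion, Finset.mem_union]
    constructor
    · rintro ⟨hx, hxU⟩
      have hc : x ∈ cov 𝒯 := by
        by_contra hc
        have h' : x ∈ (X ∪ Y) \ cov 𝒯 := Finset.mem_sdiff.2 ⟨Finset.mem_union.2 hx, hc⟩
        rw [← h.out] at h'
        exact hxU (Finset.mem_sdiff.1 h').1
      obtain ⟨t, ht, hxt⟩ := mem_cov.1 hc
      exact ⟨t, ht, hxt.imp (fun h => ⟨h, hxU⟩) (fun h => ⟨h, hxU⟩)⟩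
    · rintro ⟨t, ht, hx⟩
      have hc : x ∈ cov 𝒯 := mem_cov.2 ⟨t, ht, hx.imp And.left And.left⟩
      exact ⟨Finset.mem_union.1 (h𝒯.cov_subset hc), hx.elim And.right And.right⟩
  refine Tileable.of_union_sdiff h.tile ?_ hUsub
  rw [hrest]
  refine hD.tileable_blocks _ _ 𝒯 (fun t ht => h.gd hP h𝒯 ht) ?_ ?_
  · intro t ht s hs hne
    exact (h𝒯.disj t ht s hs hne).mono
      (Finset.union_subset_union Finset.sdiff_subset Finset.sdiff_subset)
      (Finset.union_subset_union Finset.sdiff_subset Finset.sdiff_subset)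
  · rw [← hrest, Finset.card_sdiff_of_subset hUsub]
    have := h.tile.dvd_card
    rw [hD.card_eq] at this
    exact Nat.dvd_sub hdvd this

end Final

lemma exists_params {u w : ℕ} (hu : 0 < u) (huw : u < w) {a : ℝ} (ha : 0 < a) :
    ∃ k M p q, Params u w k M p q a := by
  obtain ⟨k₁, hk₁⟩ := exists_nat_gt (8 * (2 * (w : ℝ) + 1) / a)
  rw [div_lt_iff₀ ha] at hk₁
  obtain ⟨M₁, hM₁⟩ := exists_nat_gt
    (4 * (14 * (w : ℝ) + 8 * ((u + w : ℕ) : ℝ) * (k₁ + 8 * (u + w) ^ 3 : ℕ) * (2 * w + 2)) / a)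
  rw [div_lt_iff₀ ha] at hM₁
  refine ⟨k₁ + 8 * (u + w) ^ 3, M₁ + 4, u * (M₁ + 4) + 1, w * (M₁ + 4) - 1, ?_⟩
  refine ⟨hu, huw, rfl, ?_, ha, Nat.le_add_left _ _, ?_, Nat.le_add_left _ _, ?_⟩
  · have : 0 < w * (M₁ + 4) := Nat.mul_pos (by omega) (by omega)
    omega
  · push_cast
    have : 0 ≤ a * (8 * ((u : ℝ) + w) ^ 3) := by positivity
    nlinarith
  · refine hM₁.le.trans ?_
    push_cast
    nlinarith

/-- The non-extremal case. -/
lemma tileable_of_nonExt [Fintype α] {H : SimpleGraph α} {u w : ℕ} {c : α → Bool}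
    (hD : HData H u w c) (hu : 0 < u) {a : ℝ} (ha : 0 < a) :
    ∃ n₀ : ℕ, ∀ (V : Type) [Fintype V] (G : SimpleGraph V) (X Y : Finset V) (n : ℕ), n₀ ≤ n →
      Bal G X Y n u (u + w) → u + w ∣ (X ∪ Y).card →
      NonExt G X Y n ((w : ℝ) / (u + w : ℕ)) a → Tileable H G (X ∪ Y) := by
  obtain ⟨k, M, p, q, hP⟩ := exists_params hu hD.lt ha
  obtain ⟨-, hk0, hp0, hpq, -, -, hpqM⟩ := hP.nat
  obtain ⟨n₀, hn₀⟩ := exists_isNT hp0 hpq (k * k) (Nat.mul_pos hk0 hk0)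
  refine ⟨n₀ + 1, fun V _ G X Y n hn hB hdvd hE => ?_⟩
  have hB' : Bal G X Y n (p - 1) (p + q) := by
    have hpe : p - 1 = M * u := by rw [hP.p_eq, Nat.add_sub_cancel, Nat.mul_comm]
    have hqe : p + q = M * (u + w) := by rw [hpqM, Nat.mul_comm]
    rw [hpe, hqe]
    refine ⟨hB.disj, hB.card_left, hB.card_right, fun x hx => ?_, fun x hx => ?_⟩
    · rw [Nat.mul_assoc, Nat.mul_assoc]
      exact Nat.mul_le_mul_left _ (hB.deg_left x hx)
    · rw [Nat.mul_assoc, Nat.mul_assoc]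
      exact Nat.mul_le_mul_left _ (hB.deg_right x hx)
  obtain ⟨𝒯, h𝒯, hX, hY⟩ := hn₀ V G X Y n (by omega) hB'
  obtain ⟨U, hU⟩ := exists_absorb hP hD.tileSize h𝒯 hB (by omega) hX hY hE
  exact hU.tileable hD hP h𝒯 hdvd

/-- Every vertex of `P` has at most `d` non-neighbours in `Q`. -/
def Miss (G : SimpleGraph V) (d : ℕ) (P Q : Finset V) : Prop :=
  ∀ p ∈ P, (Q.filter fun q => ¬ G.Adj p q).card ≤ d

lemma Miss.mono {G : SimpleGraph V} {d : ℕ} {P Q P' Q' : Finset V} (h : Miss G d P Q)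
    (hP : P' ⊆ P) (hQ : Q' ⊆ Q) : Miss G d P' Q' := fun p hp =>
  (Finset.card_le_card (Finset.filter_subset_filter _ hQ)).trans (h p (hP hp))

lemma degIn_add_card_filter_not (G : SimpleGraph V) (x : V) (Q : Finset V) :
    degIn G x Q + (Q.filter fun q => ¬ G.Adj x q).card = Q.card :=
  Finset.card_filter_add_card_filter_not (s := Q) (fun q => G.Adj x q)

lemma Miss.exists_common {G : SimpleGraph V} {d : ℕ} {P Q R : Finset V} (h : Miss G d Q P)
    (hR : R ⊆ Q) : ∃ P₀ ⊆ P, Cpl G P₀ R ∧ P.card ≤ P₀.card + R.card * d := by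
  refine ⟨P.filter fun p => ∀ r ∈ R, G.Adj r p, Finset.filter_subset _ _, ?_, ?_⟩
  · intro p hp r hr
    exact ((Finset.mem_filter.1 hp).2 r hr).symm
  · have h1 : P ⊆ (P.filter fun p => ∀ r ∈ R, G.Adj r p) ∪
        R.biUnion fun r => P.filter fun p => ¬ G.Adj r p := by
      intro p hp
      by_cases h2 : ∀ r ∈ R, G.Adj r p
      · exact Finset.mem_union_left _ (Finset.mem_filter.2 ⟨hp, h2⟩)
      · push Not at h2
        obtain ⟨r, hr, hrp⟩ := h2
        exact Finset.mem_union_right _ (Finset.mem_biUnion.2 ⟨r, hr, Finset.mem_filter.2 ⟨hp, hrp⟩⟩)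
    refine (Finset.card_le_card h1).trans ((Finset.card_union_le _ _).trans ?_)
    refine Nat.add_le_add_left ?_ _
    exact Finset.card_biUnion_le_card_mul _ _ _ fun r hr => h r (hR hr)

lemma inter_eq_inter_of_subset_insert {P P₀ Q Q₁ T : Finset V} {v : V} (hPQ : Disjoint P Q)
    (hP : P₀ ⊆ P) (hQ : Q₁ ⊆ Q) (hv : v ∉ P) (hT : T ⊆ insert v (P₀ ∪ Q₁)) :
    P ∩ T = P₀ ∩ T := by
  rw [Finset.disjoint_left] at hPQ
  ext x
  simp only [Finset.mem_inter]
  constructor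
  · rintro ⟨h1, h2⟩
    have h3 := hT h2
    rw [Finset.mem_insert, Finset.mem_union] at h3
    rcases h3 with rfl | h3 | h3
    · exact absurd h1 hv
    · exact ⟨h3, h2⟩
    · exact absurd (hQ h3) (hPQ h1)
  · exact fun h => ⟨hP h.1, h.2⟩

section Star

variable [Fintype α] [Fintype V] {H : SimpleGraph α} {G : SimpleGraph V} {u w : ℕ}

lemma exists_star (hT : TileSize H G w u) (hu : 0 < u) {P Q U : Finset V} {v : V} {d : ℕ}
    (hM : Miss G d Q P) (hPQ : Disjoint P Q) (hvP : v ∉ P) (hvQ : v ∉ Q) (hvU : v ∉ U)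
    (hP : w * d + u ≤ (P \ U).card) (hQ : w ≤ degIn G v (Q \ U)) :
    ∃ T, Tileable H G T ∧ Disjoint T U ∧ v ∈ T ∧ T ⊆ insert v (P ∪ Q) ∧
      (P ∩ T).card = u - 1 ∧ (Q ∩ T).card = w ∧ T.card = u + w := by
  obtain ⟨Q₁, hQ₁, hQ₁c⟩ := Finset.exists_subset_card_eq hQ
  have hQ₁' : ∀ x ∈ Q₁, x ∈ Q \ U ∧ G.Adj v x := fun x hx => Finset.mem_filter.1 (hQ₁ hx)
  have hQ₁U : Q₁ ⊆ Q \ U := fun x hx => (hQ₁' x hx).1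
  have hQ₁Q : Q₁ ⊆ Q := hQ₁U.trans Finset.sdiff_subset
  obtain ⟨P₀, hP₀, hc, hP₀c⟩ := (hM.mono subset_rfl (Finset.sdiff_subset (s := P) (t := U))
    ).exists_common hQ₁Q
  have hP₀P : P₀ ⊆ P := hP₀.trans Finset.sdiff_subset
  have e1 : P₀ \ U = P₀ := Finset.sdiff_eq_self_of_disjoint
    (Finset.disjoint_of_subset_left hP₀ Finset.sdiff_disjoint)
  have e2 : Q₁ \ U = Q₁ := Finset.sdiff_eq_self_of_disjoint
    (Finset.disjoint_of_subset_left hQ₁U Finset.sdiff_disjoint)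
  have e3 : degIn G v Q₁ = w := by
    unfold degIn
    rw [Finset.filter_true_of_mem fun x hx => (hQ₁' x hx).2, hQ₁c]
  rw [hQ₁c] at hP₀c
  obtain ⟨T, h1, h2, h3, h4, h5, h6, h7⟩ := exists_tileable_insert hT hu hc
    (fun h => hvP (hP₀P h)) (fun h => hvQ (hQ₁Q h)) hvU (by rw [e1]; omega) (by rw [e2, e3])
  refine ⟨T, h1, h2, h3, h4.trans (Finset.insert_subset_insert _
    (Finset.union_subset_union hP₀P hQ₁Q)), ?_, ?_, h7⟩
  · rw [inter_eq_inter_of_subset_insert hPQ hP₀P hQ₁Q hvP h4, h5]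
  · rw [inter_eq_inter_of_subset_insert hPQ.symm hQ₁Q hP₀P hvQ (by rwa [Finset.union_comm]), h6]

end Star

lemma exists_injective_of_miss {k a b : ℕ} (r : Fin k → Fin k → Prop)
    (ha : ∀ i, (univ.filter fun j => ¬ r i j).card ≤ a)
    (hb : ∀ j, (univ.filter fun i => ¬ r i j).card ≤ b) (hab : a + b ≤ k) :
    ∃ f : Fin k → Fin k, Function.Injective f ∧ ∀ i, r i (f i) := by
  rw [← Fintype.all_card_le_filter_rel_iff_exists_injective]
  intro S
  suffices h : S.card ≤ (univ.filter fun j => ∃ i ∈ S, r i j).card by convert h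
  by_cases hS : S.card ≤ b
  · rcases S.eq_empty_or_nonempty with rfl | ⟨i, hi⟩
    · simp
    · have h1 : (univ.filter fun j => r i j) ⊆ univ.filter fun j => ∃ i ∈ S, r i j := by
        intro j hj
        simp only [Finset.mem_filter, Finset.mem_univ, true_and] at hj ⊢
        exact ⟨i, hi, hj⟩
      have h2 := Finset.card_le_card h1
      have h3 := Finset.card_filter_add_card_filter_not (s := (univ : Finset (Fin k)))
        (fun j => r i j)
      have h4 := ha i
      rw [Finset.card_univ, Fintype.card_fin] at h3
      omega
  · have h1 : (univ.filter fun j => ∃ i ∈ S, r i j) = univ := by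
      rw [Finset.filter_eq_self]
      intro j _
      by_contra h
      push Not at h
      refine hS ((Finset.card_le_card fun i hi => ?_).trans (hb j))
      simpa using h i hi
    rw [h1]
    exact Finset.card_le_card (Finset.subset_univ S)

lemma exists_partition {P : Finset V} {k s : ℕ} (h : P.card = k * s) :
    ∃ f : Fin k → Finset V, (∀ i, (f i).card = s) ∧ (∀ i j, i ≠ j → Disjoint (f i) (f j)) ∧
      univ.biUnion f = P := by
  let e : Fin k × Fin s ≃ P := finProdFinEquiv.trans ((finCongr h.symm).trans P.equivFin.symm)
  refine ⟨fun i => univ.image fun j => (e (i, j) : V), fun i => ?_, fun i j hij => ?_, ?_⟩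
  · rw [Finset.card_image_of_injective, Finset.card_univ, Fintype.card_fin]
    intro a b hab
    have := e.injective (Subtype.ext hab)
    simpa using this
  · rw [Finset.disjoint_left]
    intro x hx hy
    simp only [Finset.mem_image, Finset.mem_univ, true_and] at hx hy
    obtain ⟨a, rfl⟩ := hx
    obtain ⟨b, hb⟩ := hy
    have := e.injective (Subtype.ext hb)
    exact hij (by simpa using congrArg Prod.fst this.symm)
  · ext x
    simp only [Finset.mem_biUnion, Finset.mem_image, Finset.mem_univ, true_and]
    constructor
    · rintro ⟨i, j, rfl⟩
      exact (e (i, j)).2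
    · intro hx
      refine ⟨(e.symm ⟨x, hx⟩).1, (e.symm ⟨x, hx⟩).2, ?_⟩
      rw [Prod.mk.eta, Equiv.apply_symm_apply]

lemma card_filter_not_cpl_le {G : SimpleGraph V} {k d : ℕ} {P : Finset V} {g : Fin k → Finset V}
    (hg : ∀ i j, i ≠ j → Disjoint (g i) (g j)) (hM : Miss G d P (univ.biUnion g)) :
    (univ.filter fun j => ¬ Cpl G P (g j)).card ≤ P.card * d := by
  rcases isEmpty_or_nonempty V with hne | hne
  · rw [Finset.filter_false_of_mem fun j _ h => h fun p => isEmptyElim p]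
    simp
  have h0 : ∀ j, ∃ y, ¬ Cpl G P (g j) → y ∈ g j ∧ ∃ p ∈ P, ¬ G.Adj p y := by
    intro j
    by_cases h : Cpl G P (g j)
    · exact ⟨hne.some, fun h' => absurd h h'⟩
    · unfold Cpl at h
      push Not at h
      obtain ⟨p, hp, q, hq, hpq⟩ := h
      exact ⟨q, fun _ => ⟨hq, p, hp, hpq⟩⟩
  choose y hy using h0
  have h1 : (univ.filter fun j => ¬ Cpl G P (g j)).card ≤
      (P.biUnion fun p => (univ.biUnion g).filter fun q => ¬ G.Adj p q).card := by
    refine Finset.card_le_card_of_injOn y ?_ ?_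
    · intro j hj
      obtain ⟨h2, p, hp, h3⟩ := hy j (Finset.mem_filter.1 hj).2
      exact Finset.mem_coe.2 (Finset.mem_biUnion.2 ⟨p, hp, Finset.mem_filter.2
        ⟨Finset.mem_biUnion.2 ⟨j, Finset.mem_univ _, h2⟩, h3⟩⟩)
    · intro i hi j hj hij
      by_contra hne
      have h2 := (hy i (Finset.mem_filter.1 hi).2).1
      have h3 := (hy j (Finset.mem_filter.1 hj).2).1
      rw [← hij] at h3
      exact Finset.disjoint_left.1 (hg i j hne) h2 h3
  exact h1.trans (Finset.card_biUnion_le_card_mul _ _ _ hM)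

lemma exists_block_sizes {u w C d p q : ℕ} (hu : 0 < u) (huw : u < w) (h1 : u * p + C ≤ w * q)
    (h2 : w * q ≤ u * p + C + (u + w) * w) (hq : C + w ^ 2 + u + u * ((u + w) * d) ≤ q) :
    ∃ k p₁ q₁, p = k * w + p₁ ∧ q = k * u + q₁ ∧ (w + u) * d ≤ k ∧ u * p₁ + C ≤ w * q₁ ∧
      u * q₁ + C ≤ w * p₁ ∧ q₁ ≤ C + w ^ 2 + u ∧ p₁ ≤ w * (C + w ^ 2 + u) := by
  obtain ⟨k, hk⟩ : ∃ k, k = (q - (C + w ^ 2)) / u := ⟨_, rfl⟩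
  obtain ⟨q₁, hq₁⟩ : ∃ q₁, q = k * u + q₁ ∧ C + w ^ 2 ≤ q₁ ∧ q₁ ≤ C + w ^ 2 + u := by
    have e1 := Nat.div_add_mod (q - (C + w ^ 2)) u
    have e2 := Nat.mod_lt (q - (C + w ^ 2)) hu
    rw [← hk] at e1
    refine ⟨q - k * u, ?_, ?_, ?_⟩ <;>
    · rw [Nat.mul_comm k u]
      omega
  obtain ⟨hq1, hq2, hq3⟩ := hq₁
  have hw2 : 2 * (C + w ^ 2) ≤ w * q₁ := Nat.mul_le_mul (by omega) hq2
  have hkw : k * w ≤ p := by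
    by_contra hlt
    push Not at hlt
    have e1 : u * p ≤ u * (k * w) := Nat.mul_le_mul_left u hlt.le
    have e2 : u * (p + 1) ≤ u * (k * w) := Nat.mul_le_mul_left u hlt
    rw [hq1] at h2
    nlinarith
  obtain ⟨p₁, hp₁⟩ := Nat.exists_eq_add_of_le hkw
  subst hq1 hp₁
  have h3 : u * p₁ + C ≤ w * q₁ := by nlinarith
  have h4 : w * q₁ ≤ u * p₁ + C + (u + w) * w := by nlinarith
  refine ⟨k, p₁, q₁, rfl, rfl, ?_, h3, ?_, hq3, ?_⟩
  · rw [hk, Nat.le_div_iff_mul_le hu]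
    have : (w + u) * d * u = u * ((u + w) * d) := by ring
    omega
  · by_contra hlt
    push Not at hlt
    have e1 : u * (w * p₁) ≤ u * (u * q₁ + C) := Nat.mul_le_mul_left u hlt.le
    have e2 : w * (w * q₁) ≤ w * (u * p₁ + C + (u + w) * w) := Nat.mul_le_mul_left w h4
    have e3 : u * (w * p₁ + 1) ≤ u * (u * q₁ + C) := Nat.mul_le_mul_left u hlt
    have e4 : (u + w) * (C + w ^ 2) ≤ (u + w) * q₁ := Nat.mul_le_mul_left _ hq2
    have e5 : (u + w) * q₁ ≤ (w - u) * ((u + w) * q₁) :=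
      Nat.le_mul_of_pos_left _ (by omega)
    obtain ⟨t, rfl⟩ := Nat.exists_eq_add_of_lt huw
    have e6 : u + t + 1 - u = t + 1 := by omega
    rw [e6] at e5
    nlinarith
  · have e1 : p₁ ≤ u * p₁ := Nat.le_mul_of_pos_left _ hu
    have e2 : w * q₁ ≤ w * (C + w ^ 2 + u) := Nat.mul_le_mul_left _ hq3
    omega

section Near

variable [Fintype α] [Fintype V] {H : SimpleGraph α} {G : SimpleGraph V} {u w : ℕ}

lemma Tileable.biUnion {ι : Type*} (I : Finset ι) (f : ι → Finset V)
    (h : ∀ i ∈ I, Tileable H G (f i)) (hd : ∀ i ∈ I, ∀ j ∈ I, i ≠ j → Disjoint (f i) (f j)) :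
    Tileable H G (I.biUnion f) := by
  induction I using Finset.induction_on with
  | empty => simpa using tileable_empty
  | insert a I ha ih =>
    rw [Finset.biUnion_insert]
    refine (h a (by simp)).union (ih (fun i hi => h i (by simp [hi]))
      fun i hi j hj => hd i (by simp [hi]) j (by simp [hj])) ?_
    rw [Finset.disjoint_biUnion_right]
    exact fun i hi => hd a (by simp) i (by simp [hi]) fun e => ha (e ▸ hi)

/-- An almost complete pair with the exact ratio `w : u` is tileable. -/
lemma tileable_of_miss (hT : TileSize H G w u) {P Q : Finset V} {d k : ℕ} (hPQ : Disjoint P Q)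
    (h1 : Miss G d P Q) (h2 : Miss G d Q P) (hP : P.card = k * w) (hQ : Q.card = k * u)
    (hk : (w + u) * d ≤ k) : Tileable H G (P ∪ Q) := by
  obtain ⟨f, hf1, hf2, rfl⟩ := exists_partition hP
  obtain ⟨g, hg1, hg2, rfl⟩ := exists_partition hQ
  have hfs : ∀ i, f i ⊆ univ.biUnion f := fun i => Finset.subset_biUnion_of_mem f (mem_univ i)
  have hgs : ∀ i, g i ⊆ univ.biUnion g := fun i => Finset.subset_biUnion_of_mem g (mem_univ i)
  obtain ⟨m, hm, hmr⟩ := exists_injective_of_miss (fun i j => Cpl G (f i) (g j))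
    (a := w * d) (b := u * d)
    (fun i => by
      rw [← hf1 i]
      exact card_filter_not_cpl_le hg2 (h1.mono (hfs i) subset_rfl))
    (fun j => by
      rw [← hg1 j]
      refine le_trans (Finset.card_le_card fun i hi => ?_)
        (card_filter_not_cpl_le hf2 (h2.mono (hgs j) subset_rfl))
      simp only [Finset.mem_filter, Finset.mem_univ, true_and] at hi ⊢
      exact fun h => hi h.symm)
    (by rwa [← Nat.add_mul])
  have hsurj := Finite.surjective_of_injective hm
  have e : univ.biUnion f ∪ univ.biUnion g = univ.biUnion fun i => f i ∪ g (m i) := by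
    ext x
    simp only [Finset.mem_union, Finset.mem_biUnion, Finset.mem_univ, true_and]
    constructor
    · rintro (⟨i, hi⟩ | ⟨j, hj⟩)
      · exact ⟨i, Or.inl hi⟩
      · obtain ⟨i, rfl⟩ := hsurj j
        exact ⟨i, Or.inr hj⟩
    · rintro ⟨i, hi | hi⟩
      · exact Or.inl ⟨i, hi⟩
      · exact Or.inr ⟨m i, hi⟩
  rw [e]
  refine Tileable.biUnion _ _ (fun i _ => hT _ _ (hmr i) (hf1 i) (hg1 _)) fun i _ j _ hij => ?_
  rw [Finset.disjoint_union_left, Finset.disjoint_union_right, Finset.disjoint_union_right]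
  exact ⟨⟨hf2 i j hij, Finset.disjoint_of_subset_left (hfs i)
    (Finset.disjoint_of_subset_right (hgs _) hPQ)⟩,
    ⟨Finset.disjoint_of_subset_left (hgs _) (Finset.disjoint_of_subset_right (hfs _) hPQ.symm),
    hg2 _ _ fun h => hij (hm h)⟩⟩

lemma exists_gd_block (hT : TileSize H G w u) (hu : 0 < u) (huw : u < w) {P Q : Finset V}
    {C d : ℕ} (hPQ : Disjoint P Q) (hM1 : Miss G d P Q) (hM2 : Miss G d Q P)
    (h1 : u * P.card + C ≤ w * Q.card)
    (h2 : w * Q.card ≤ u * P.card + C + (u + w) * w)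
    (hQ : C + w ^ 2 + u + u * ((u + w) * d) ≤ Q.card)
    (hP : (C + w ^ 2 + u) * d + w * (C + w ^ 2 + u) ≤ P.card) :
    ∃ P₁ ⊆ P, ∃ Q₁ ⊆ Q, Gd G u w C P₁ Q₁ ∧ Tileable H G ((P ∪ Q) \ (P₁ ∪ Q₁)) := by
  obtain ⟨k, p₁, q₁, e1, e2, e3, e4, e5, e6, e7⟩ := exists_block_sizes hu huw h1 h2 hQ
  obtain ⟨Q₁, hQ₁, hQ₁c⟩ := Finset.exists_subset_card_eq (s := Q) (n := q₁) (by omega)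
  obtain ⟨P₀, hP₀, hc, hP₀c⟩ := hM2.exists_common hQ₁
  rw [hQ₁c] at hP₀c
  have := Nat.mul_le_mul_right d e6
  obtain ⟨P₁, hP₁, hP₁c⟩ := Finset.exists_subset_card_eq (s := P₀) (n := p₁) (by omega)
  have hP₁P := hP₁.trans hP₀
  refine ⟨P₁, hP₁P, Q₁, hQ₁, ⟨hc.mono hP₁ subset_rfl, by rwa [hP₁c, hQ₁c],
    by rwa [hP₁c, hQ₁c]⟩, ?_⟩
  rw [union_sdiff_union_of_disjoint hP₁P hQ₁ hPQ]
  refine tileable_of_miss hT (d := d) (k := k) ?_ (hM1.mono sdiff_subset sdiff_subset)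
    (hM2.mono sdiff_subset sdiff_subset) ?_ ?_ e3
  · exact Finset.disjoint_of_subset_left sdiff_subset
      (Finset.disjoint_of_subset_right sdiff_subset hPQ)
  · rw [Finset.card_sdiff_of_subset hP₁P]
    omega
  · rw [Finset.card_sdiff_of_subset hQ₁]
    omega

end Near

lemma sdiff_sdiff_union_eq {P Q P₁ Q₁ P₂ Q₂ : Finset V} (hP : P₁ ⊆ P) (hQ : Q₁ ⊆ Q)
    (hd : Disjoint P Q) :
    ((P ∪ Q) \ (P₂ ∪ Q₂)) \ (P₁ ∪ Q₁) = ((P \ P₁) ∪ (Q \ Q₁)) \ (P₂ ∪ Q₂) := by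
  rw [Finset.disjoint_left] at hd
  ext x
  have h1 := @hP x
  have h2 := @hQ x
  have h3 := @hd x
  simp only [Finset.mem_union, Finset.mem_sdiff]
  tauto

lemma subset_union_sdiff_union {P Q P₁ Q₁ P₂ Q₂ : Finset V} (hP : P₁ ⊆ P) (hQ : Q₁ ⊆ Q)
    (hP₂ : P₂ ⊆ P \ P₁) (hQ₂ : Q₂ ⊆ Q \ Q₁) (hd : Disjoint P Q) :
    P₁ ∪ Q₁ ⊆ (P ∪ Q) \ (P₂ ∪ Q₂) := by
  rw [Finset.disjoint_left] at hd
  intro x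
  have h1 := @hP x
  have h2 := @hQ x
  have h3 := @hd x
  have h4 := @hP₂ x
  have h5 := @hQ₂ x
  simp only [Finset.mem_union, Finset.mem_sdiff] at *
  tauto

section Near

variable [Fintype α] [Fintype V] {H : SimpleGraph α} {G : SimpleGraph V} {u w : ℕ}

/-- An almost complete pair whose ratio is on the good side of `w : u` splits into a complete
block and a tileable part. -/
lemma exists_gd_block_of_slack (hT : TileSize H G w u) (hu : 0 < u) (huw : u < w) {C d : ℕ}
    (r : ℕ) : ∀ {P Q : Finset V}, Disjoint P Q → Miss G d P Q → Miss G d Q P →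
    u * P.card + C ≤ w * Q.card →
    w * Q.card ≤ u * P.card + C + (u + w) * w + r →
    C + w ^ 2 + u + u * ((u + w) * d) + r * w ≤ Q.card →
    (C + w ^ 2 + u) * d + w * (C + w ^ 2 + u) + r * u ≤ P.card →
    ∃ P₁ ⊆ P, ∃ Q₁ ⊆ Q, Gd G u w C P₁ Q₁ ∧ Tileable H G ((P ∪ Q) \ (P₁ ∪ Q₁)) := by
  induction r with
  | zero =>
    intro P Q hPQ hM1 hM2 h1 h2 hQ hP
    exact exists_gd_block hT hu huw hPQ hM1 hM2 h1 h2 (by omega) (by omega)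
  | succ r ih =>
    intro P Q hPQ hM1 hM2 h1 h2 hQ hP
    by_cases hs : w * Q.card ≤ u * P.card + C + (u + w) * w
    · exact exists_gd_block hT hu huw hPQ hM1 hM2 h1 hs (by omega) (by omega)
    push Not at hs
    rw [Nat.succ_mul] at hQ hP
    obtain ⟨Q₁, hQ₁, hQ₁c⟩ := Finset.exists_subset_card_eq (s := Q) (n := w) (by omega)
    obtain ⟨P₀, hP₀, hc, hP₀c⟩ := hM2.exists_common hQ₁
    rw [hQ₁c] at hP₀c
    have hwd : w * d ≤ (C + w ^ 2 + u) * d := by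
      refine Nat.mul_le_mul_right d ?_
      have : w ≤ w ^ 2 := Nat.le_self_pow (by omega) w
      omega
    obtain ⟨P₁, hP₁, hP₁c⟩ := Finset.exists_subset_card_eq (s := P₀) (n := u) (by omega)
    have hP₁P := hP₁.trans hP₀
    have hT1 : Tileable H G (P₁ ∪ Q₁) := hT.symm _ _ (hc.mono hP₁ subset_rfl) hP₁c hQ₁c
    obtain ⟨p, hp⟩ : ∃ p, P.card = p + u := ⟨P.card - u, by omega⟩
    obtain ⟨q, hq⟩ : ∃ q, Q.card = q + w := ⟨Q.card - w, by omega⟩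
    have hp' : (P \ P₁).card = p := by rw [Finset.card_sdiff_of_subset hP₁P]; omega
    have hq' : (Q \ Q₁).card = q := by rw [Finset.card_sdiff_of_subset hQ₁]; omega
    rw [hp, hq] at h1 h2 hs
    rw [hp] at hP
    rw [hq] at hQ
    obtain ⟨P₂, hP₂, Q₂, hQ₂, hg, hT2⟩ := ih (P := P \ P₁) (Q := Q \ Q₁)
      (Finset.disjoint_of_subset_left sdiff_subset (Finset.disjoint_of_subset_right sdiff_subset hPQ))
      (hM1.mono sdiff_subset sdiff_subset) (hM2.mono sdiff_subset sdiff_subset)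
      (by rw [hp', hq']; nlinarith) (by rw [hp', hq']; nlinarith)
      (by rw [hq']; omega) (by rw [hp']; omega)
    refine ⟨P₂, hP₂.trans sdiff_subset, Q₂, hQ₂.trans sdiff_subset, hg, ?_⟩
    refine hT1.of_union_sdiff ?_ (subset_union_sdiff_union hP₁P hQ₁ hP₂ hQ₂ hPQ)
    rwa [sdiff_sdiff_union_eq hP₁P hQ₁ hPQ]

end Near

/-- The four parts of the vertex set in the extremal case are disjoint. -/
structure Lay (A A' B B' : Finset V) : Prop where
  left : Disjoint A A'
  right : Disjoint B B'
  cross : Disjoint (A ∪ A') (B ∪ B')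

namespace Lay

variable {A A' B B' : Finset V}

lemma swap (h : Lay A A' B B') : Lay B B' A A' := ⟨h.right, h.left, h.cross.symm⟩

lemma ab (h : Lay A A' B B') : Disjoint A B :=
  Finset.disjoint_of_subset_left subset_union_left
    (Finset.disjoint_of_subset_right subset_union_left h.cross)

lemma ab' (h : Lay A A' B B') : Disjoint A B' :=
  Finset.disjoint_of_subset_left subset_union_left
    (Finset.disjoint_of_subset_right subset_union_right h.cross)

lemma a'b (h : Lay A A' B B') : Disjoint A' B :=
  Finset.disjoint_of_subset_left subset_union_right
    (Finset.disjoint_of_subset_right subset_union_left h.cross)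

lemma a'b' (h : Lay A A' B B') : Disjoint A' B' :=
  Finset.disjoint_of_subset_left subset_union_right
    (Finset.disjoint_of_subset_right subset_union_right h.cross)

end Lay

lemma inter_eq_empty_of_star {R P Q T : Finset V} {v : V} (hT : T ⊆ insert v (P ∪ Q))
    (hv : v ∉ R) (hP : Disjoint P R) (hQ : Disjoint Q R) : R ∩ T = ∅ := by
  rw [Finset.eq_empty_iff_forall_notMem]
  intro x hx
  rw [Finset.mem_inter] at hx
  have h := hT hx.2
  rw [Finset.mem_insert, Finset.mem_union] at h
  rcases h with rfl | h | h
  · exact hv hx.1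
  · exact Finset.disjoint_left.1 hP h hx.1
  · exact Finset.disjoint_left.1 hQ h hx.1

lemma inter_eq_singleton_of_star {R P Q T : Finset V} {v : V} (hT : T ⊆ insert v (P ∪ Q))
    (hvT : v ∈ T) (hv : v ∈ R) (hP : Disjoint P R) (hQ : Disjoint Q R) : R ∩ T = {v} := by
  ext x
  rw [Finset.mem_inter, Finset.mem_singleton]
  constructor
  · rintro ⟨h1, h2⟩
    have h := hT h2
    rw [Finset.mem_insert, Finset.mem_union] at h
    rcases h with rfl | h | h
    · rfl
    · exact absurd h1 (Finset.disjoint_left.1 hP h)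
    · exact absurd h1 (Finset.disjoint_left.1 hQ h)
  · rintro rfl
    exact ⟨hv, hvT⟩

lemma card_inter_sdiff_add {R Z T : Finset V} (hZ : Z ⊆ R) :
    (R ∩ T).card = ((R \ Z) ∩ T).card + (Z ∩ T).card := by
  rw [← Finset.card_union_of_disjoint]
  · congr 1
    ext x
    have := @hZ x
    simp only [Finset.mem_inter, Finset.mem_union, Finset.mem_sdiff]
    tauto
  · exact Finset.disjoint_of_subset_left inter_subset_left
      (Finset.disjoint_of_subset_right inter_subset_left sdiff_disjoint)

/-- A tiled set `U` made of `s` stars centred in `A`, `t` stars centred in `B`, and one tile for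
each of the exceptional vertices in `Z ⊆ Za` and `W ⊆ Wa`. -/
structure St [Fintype α] [Fintype V] (H : SimpleGraph α) (G : SimpleGraph V) (u w : ℕ)
    (A A' B B' Za Wa U : Finset V) (s t : ℕ) (Z W : Finset V) : Prop where
  tile : Tileable H G U
  sub : U ⊆ (A ∪ A') ∪ (B ∪ B')
  cA : (A ∩ U).card = s + w * (t + W.card)
  cA' : (A' ∩ U).card + s = u * (s + Z.card)
  cB : (B ∩ U).card = t + w * (s + Z.card)
  cB' : (B' ∩ U).card + t = u * (t + W.card)
  cU : U.card = (u + w) * (s + t + Z.card + W.card)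
  eZ : Za ∩ U = Z
  eW : Wa ∩ U = W

namespace St

variable [Fintype α] [Fintype V] {H : SimpleGraph α} {G : SimpleGraph V} {u w : ℕ}
  {A A' B B' Za Wa U Z W : Finset V} {s t d : ℕ}

lemma swap (h : St H G u w A A' B B' Za Wa U s t Z W) :
    St H G u w B B' A A' Wa Za U t s W Z :=
  ⟨h.tile, by rw [Finset.union_comm]; exact h.sub, h.cB, h.cB', h.cA, h.cA', by
    rw [h.cU]; ring, h.eW, h.eZ⟩

lemma empty : St H G u w A A' B B' Za Wa ∅ 0 0 ∅ ∅ :=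
  ⟨tileable_empty, by simp, by simp, by simp, by simp, by simp, by simp, by simp, by simp⟩

lemma add_center (h : St H G u w A A' B B' Za Wa U s t Z W) (hL : Lay A A' B B')
    (hT : TileSize H G w u) (hu : 0 < u) (hZa : Za ⊆ A') (hWa : Wa ⊆ B')
    (hM : Miss G d B (A' \ Za)) {v : V} (hv : v ∈ A) (hvU : v ∉ U)
    (hP : w * d + u ≤ ((A' \ Za) \ U).card) (hQ : w ≤ degIn G v (B \ U)) :
    ∃ U', St H G u w A A' B B' Za Wa U' (s + 1) t Z W := by
  have hvA' : v ∉ A' := Finset.disjoint_left.1 hL.left hv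
  have hvB : v ∉ B := Finset.disjoint_left.1 hL.ab hv
  have hvB' : v ∉ B' := Finset.disjoint_left.1 hL.ab' hv
  have hPA' : A' \ Za ⊆ A' := sdiff_subset
  obtain ⟨T, h1, h2, h3, h4, h5, h6, h7⟩ := exists_star hT hu hM
    (Finset.disjoint_of_subset_left hPA' hL.a'b) (fun h => hvA' (hPA' h)) hvB hvU hP hQ
  have i1 : A ∩ T = {v} := inter_eq_singleton_of_star h4 h3 hv
    (Finset.disjoint_of_subset_left hPA' hL.left.symm) hL.ab.symm
  have i2 : B' ∩ T = ∅ := inter_eq_empty_of_star h4 hvB'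
    (Finset.disjoint_of_subset_left hPA' hL.a'b') hL.right
  have i3 : Za ∩ T = ∅ := inter_eq_empty_of_star h4 (fun h => hvA' (hZa h)) sdiff_disjoint
    (Finset.disjoint_of_subset_right hZa hL.a'b.symm)
  have i4 : Wa ∩ T = ∅ := Finset.subset_empty.1 (i2 ▸ Finset.inter_subset_inter hWa subset_rfl)
  have i5 : (A' ∩ T).card = u - 1 := by
    rw [card_inter_sdiff_add hZa, h5, i3, Finset.card_empty, Nat.add_zero]
  refine ⟨T ∪ U, h1.union h.tile h2, ?_, ?_, ?_, ?_, ?_, ?_, ?_, ?_⟩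
  · refine Finset.union_subset (h4.trans ?_) h.sub
    refine Finset.insert_subset (Finset.mem_union_left _ (Finset.mem_union_left _ hv)) ?_
    exact Finset.union_subset_union (hPA'.trans subset_union_right) subset_union_left
  · rw [card_inter_union_of_disjoint _ h2, i1, h.cA, Finset.card_singleton]; ring
  · rw [card_inter_union_of_disjoint _ h2, i5]
    have := h.cA'
    have e : u * (s + 1 + Z.card) = u * (s + Z.card) + u := by ring
    omega
  · rw [card_inter_union_of_disjoint _ h2, h6, h.cB]; ring
  · rw [card_inter_union_of_disjoint _ h2, i2, Finset.card_empty, Nat.zero_add, h.cB']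
  · rw [Finset.card_union_of_disjoint h2, h7, h.cU]; ring
  · rw [Finset.inter_union_distrib_left, i3, h.eZ, Finset.empty_union]
  · rw [Finset.inter_union_distrib_left, i4, h.eW, Finset.empty_union]

lemma add_exceptional (h : St H G u w A A' B B' Za Wa U s t Z W) (hL : Lay A A' B B')
    (hT : TileSize H G w u) (hu : 0 < u) (hZa : Za ⊆ A') (hWa : Wa ⊆ B')
    (hM : Miss G d B (A' \ Za)) {v : V} (hv : v ∈ Za) (hvZ : v ∉ Z)
    (hP : w * d + u ≤ ((A' \ Za) \ U).card) (hQ : w ≤ degIn G v (B \ U)) :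
    ∃ U', St H G u w A A' B B' Za Wa U' s t (insert v Z) W := by
  have hvA' : v ∈ A' := hZa hv
  have hvA : v ∉ A := fun h => Finset.disjoint_left.1 hL.left h hvA'
  have hvB : v ∉ B := Finset.disjoint_left.1 hL.a'b hvA'
  have hvB' : v ∉ B' := Finset.disjoint_left.1 hL.a'b' hvA'
  have hvU : v ∉ U := fun hU => hvZ (h.eZ ▸ Finset.mem_inter.2 ⟨hv, hU⟩)
  have hPA' : A' \ Za ⊆ A' := sdiff_subset
  obtain ⟨T, h1, h2, h3, h4, h5, h6, h7⟩ := exists_star hT hu hM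
    (Finset.disjoint_of_subset_left hPA' hL.a'b) (fun h => (Finset.mem_sdiff.1 h).2 hv) hvB hvU
    hP hQ
  have i1 : A ∩ T = ∅ := inter_eq_empty_of_star h4 hvA
    (Finset.disjoint_of_subset_left hPA' hL.left.symm) hL.ab.symm
  have i2 : B' ∩ T = ∅ := inter_eq_empty_of_star h4 hvB'
    (Finset.disjoint_of_subset_left hPA' hL.a'b') hL.right
  have i3 : Za ∩ T = {v} := inter_eq_singleton_of_star h4 h3 hv sdiff_disjoint
    (Finset.disjoint_of_subset_right hZa hL.a'b.symm)
  have i4 : Wa ∩ T = ∅ := Finset.subset_empty.1 (i2 ▸ Finset.inter_subset_inter hWa subset_rfl)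
  have i5 : (A' ∩ T).card = u := by
    rw [card_inter_sdiff_add hZa, h5, i3, Finset.card_singleton]
    omega
  have hZc := Finset.card_insert_of_notMem hvZ
  refine ⟨T ∪ U, h1.union h.tile h2, ?_, ?_, ?_, ?_, ?_, ?_, ?_, ?_⟩
  · refine Finset.union_subset (h4.trans ?_) h.sub
    refine Finset.insert_subset (Finset.mem_union_left _ (Finset.mem_union_right _ hvA')) ?_
    exact Finset.union_subset_union (hPA'.trans subset_union_right) subset_union_left
  · rw [card_inter_union_of_disjoint _ h2, i1, h.cA, Finset.card_empty, Nat.zero_add]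
  · rw [card_inter_union_of_disjoint _ h2, i5, hZc, Nat.add_assoc, h.cA']; ring
  · rw [card_inter_union_of_disjoint _ h2, h6, h.cB, hZc]; ring
  · rw [card_inter_union_of_disjoint _ h2, i2, Finset.card_empty, Nat.zero_add, h.cB']
  · rw [Finset.card_union_of_disjoint h2, h7, h.cU, hZc]; ring
  · rw [Finset.inter_union_distrib_left, i3, h.eZ, Finset.insert_eq]
  · rw [Finset.inter_union_distrib_left, i4, h.eW, Finset.empty_union]

end St

lemma exists_center {G : SimpleGraph V} {A B U : Finset V} {w e D : ℕ} (hw : 0 < w)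
    (hAB : Disjoint A B) (hD : ∀ y ∈ B, D ≤ degIn G y A) (hA : ∀ x ∈ A, degIn G x B ≤ e)
    (hB : ∀ y ∈ B, degIn G y A ≤ e) (hlt : (w - 1) * A.card + e * U.card < B.card * D) :
    ∃ v ∈ A, v ∉ U ∧ w ≤ degIn G v (B \ U) := by
  by_contra hcon
  push Not at hcon
  have h1 : B.card * D ≤ eAB G A B := by
    rw [eAB_comm, eAB_eq_sum]
    simpa using Finset.card_nsmul_le_sum B _ D hD
  have h2 : eAB G A B ≤ (w - 1) * A.card + eAB G A (B ∩ U) + e * (A ∩ U).card := by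
    rw [eAB_eq_sum, eAB_eq_sum]
    have e1 : ∀ x ∈ A, degIn G x B ≤ (w - 1) + degIn G x (B ∩ U) + if x ∈ U then e else 0 := by
      intro x hx
      split_ifs with hxU
      · exact (hA x hx).trans (by omega)
      · have e2 := hcon x hx hxU
        have e3 : degIn G x B ≤ degIn G x (B \ U) + degIn G x (B ∩ U) := by
          refine le_trans (le_of_eq ?_) (degIn_union_le x _ _)
          rw [Finset.sdiff_union_inter]
        omega
    refine (Finset.sum_le_sum e1).trans ?_
    rw [Finset.sum_add_distrib, Finset.sum_add_distrib, ← Finset.sum_filter,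
      Finset.filter_mem_eq_inter]
    simp [Nat.mul_comm]
  have h3 : eAB G A (B ∩ U) ≤ e * (B ∩ U).card := by
    rw [eAB_comm, eAB_eq_sum, Nat.mul_comm]
    refine Finset.sum_le_card_nsmul _ _ e fun y hy => ?_
    exact hB y (Finset.mem_inter.1 hy).1
  have h4 : (B ∩ U).card + (A ∩ U).card ≤ U.card := by
    rw [← Finset.card_union_of_disjoint]
    · exact Finset.card_le_card (Finset.union_subset inter_subset_right inter_subset_right)
    · exact Finset.disjoint_of_subset_left inter_subset_left
        (Finset.disjoint_of_subset_right inter_subset_left hAB.symm)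
  have h5 := Nat.mul_le_mul_left e h4
  rw [Nat.mul_add] at h5
  omega

/-- One half of the numerical data of an extremal configuration. Here `A` and `B` span few edges,
`Za` is the set of exceptional vertices of `A'`, and `S`, `T` are the numbers of stars
centred in `A` and `B` needed to make the pairs good. -/
structure Half (G : SimpleGraph V) (u w : ℕ) (A A' B Za : Finset V)
    (d e L M C r S T : ℕ) : Prop where
  sub : Za ⊆ A'
  miss : Miss G d B (A' \ Za)
  miss' : Miss G d (A' \ Za) B
  sparse : ∀ x ∈ A, degIn G x B ≤ e
  deg : 0 < S → ∀ y ∈ B, S + 2 * w ≤ degIn G y A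
  card_le : A.card ≤ 2 * B.card
  le_card : 4 * (u + w) * e ≤ B.card
  exc : ∀ z ∈ Za, M + w ≤ degIn G z B
  size : L ≤ A.card
  size' : L ≤ A'.card
  excCard : Za.card ≤ M
  slack : u * B.card + C ≤ w * A'.card + w * S + u * T
  slack' : w * A'.card + w * S + u * T ≤ u * B.card + C + (u + w) * w + r

lemma center_count {a b e U s t S u w : ℕ} (hw : 0 < w) (hb : 0 < b) (hab : a ≤ 2 * b)
    (he : 4 * (u + w) * e ≤ b) (hs : s ≤ S) (ht : t ≤ S) (hU : U = (u + w) * (s + t)) :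
    (w - 1) * a + e * U < b * (S + 2 * w) := by
  obtain ⟨w', rfl⟩ : ∃ w', w = w' + 1 := ⟨w - 1, by omega⟩
  rw [Nat.add_sub_cancel]
  have h1 : w' * a ≤ w' * (2 * b) := Nat.mul_le_mul_left _ hab
  have h2 : e * U ≤ e * ((u + (w' + 1)) * (S + S)) := by
    rw [hU]
    exact Nat.mul_le_mul_left _ (Nat.mul_le_mul_left _ (by omega))
  have h3 : 4 * (u + (w' + 1)) * e * S ≤ b * S := Nat.mul_le_mul_right _ he
  nlinarith

lemma le_card_sdiff_sdiff {A' Za U : Finset V} {L M k : ℕ} (hL : L ≤ A'.card) (hZ : Za.card ≤ M)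
    (hU : U.card ≤ M) (h : M + M + k ≤ L) : k ≤ ((A' \ Za) \ U).card := by
  have h1 := Finset.le_card_sdiff Za A'
  have h2 := Finset.le_card_sdiff U (A' \ Za)
  omega

section Loops

variable [Fintype α] [Fintype V] {H : SimpleGraph α} {G : SimpleGraph V} {u w : ℕ}
  {A A' B B' Za Wa U Z W : Finset V} {s t d e L M C r S T : ℕ}

lemma St.exists_centers (hT : TileSize H G w u) (hu : 0 < u) (hw : 0 < w)
    (hL : Lay A A' B B') (hA : Half G u w A A' B Za d e L M C r S T)
    (hB : Half G u w B B' A Wa d e L M C r T S) (hLM : M + M + (w * d + u) ≤ L)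
    (h0 : St H G u w A A' B B' Za Wa U 0 t ∅ ∅) (htS : t ≤ S) (hM : (u + w) * (S + t) ≤ M) :
    ∀ s ≤ S, ∃ U, St H G u w A A' B B' Za Wa U s t ∅ ∅ := by
  intro s
  induction s with
  | zero => exact fun _ => ⟨U, h0⟩
  | succ s ih =>
    intro hs
    obtain ⟨U₁, h1⟩ := ih (by omega)
    have hUc : U₁.card = (u + w) * (s + t) := by simpa using h1.cU
    have hUM : U₁.card ≤ M := by
      rw [hUc]
      exact (Nat.mul_le_mul_left _ (by omega)).trans hM
    obtain ⟨v, hv, hvU, hvw⟩ := exists_center (U := U₁) (D := S + 2 * w) hw hL.ab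
      (hA.deg (by omega)) hA.sparse hB.sparse
      (center_count hw (by have := hB.size; omega) hA.card_le hA.le_card (by omega) htS hUc)
    exact h1.add_center hL hT hu hA.sub hB.sub hA.miss hv hvU
      (le_card_sdiff_sdiff hA.size' hA.excCard hUM hLM) hvw

lemma St.exists_exceptional (hT : TileSize H G w u) (hu : 0 < u)
    (hL : Lay A A' B B') (hA : Half G u w A A' B Za d e L M C r S T)
    (hWa : Wa ⊆ B') (hLM : M + M + (w * d + u) ≤ L)
    (h0 : St H G u w A A' B B' Za Wa U s t ∅ W)
    (hM : (u + w) * (s + t + Za.card + W.card) ≤ M) :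
    ∃ U, St H G u w A A' B B' Za Wa U s t Za W := by
  suffices h : ∀ Z ⊆ Za, ∃ U, St H G u w A A' B B' Za Wa U s t Z W from h Za subset_rfl
  intro Z
  induction Z using Finset.induction_on with
  | empty => exact fun _ => ⟨U, h0⟩
  | insert v Z hv ih =>
    intro hZ
    obtain ⟨U₁, h1⟩ := ih ((Finset.subset_insert v Z).trans hZ)
    have hvZa : v ∈ Za := hZ (Finset.mem_insert_self v Z)
    have hUM : U₁.card ≤ M := by
      rw [h1.cU]
      refine (Nat.mul_le_mul_left _ ?_).trans hM
      have := Finset.card_le_card ((Finset.subset_insert v Z).trans hZ)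
      omega
    refine h1.add_exceptional hL hT hu hA.sub hWa hA.miss hvZa hv
      (le_card_sdiff_sdiff hA.size' hA.excCard hUM hLM) ?_
    have h2 := degIn_le_sdiff_add (G := G) v B U₁
    have h3 : (B ∩ U₁).card ≤ U₁.card := Finset.card_le_card inter_subset_right
    have h4 := hA.exc v hvZa
    rw [Finset.inter_comm] at h3
    rw [Finset.inter_comm] at h3
    omega

end Loops

lemma sdiff_eq_of_disjoint_parts {U R₁ R₂ K₁ K₂ : Finset V} (h1 : Disjoint U (R₁ ∪ R₂))
    (h2 : Disjoint R₁ R₂) (hK₁ : K₁ ⊆ R₁) (hK₂ : K₂ ⊆ R₂) :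
    (U ∪ (R₁ ∪ R₂)) \ (U ∪ ((R₁ \ K₁) ∪ (R₂ \ K₂))) = K₁ ∪ K₂ := by
  rw [Finset.disjoint_left] at h1 h2
  ext x
  have e1 := @h1 x
  have e2 := @h2 x
  have e3 := @hK₁ x
  have e4 := @hK₂ x
  simp only [Finset.mem_union, Finset.mem_sdiff] at *
  tauto

lemma parts_eq {A A' B B' U : Finset V} (hU : U ⊆ (A ∪ A') ∪ (B ∪ B')) :
    U ∪ (((B \ U) ∪ (A' \ U)) ∪ ((A \ U) ∪ (B' \ U))) = (A ∪ A') ∪ (B ∪ B') := by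
  ext x
  have e1 := @hU x
  simp only [Finset.mem_union, Finset.mem_sdiff] at *
  tauto

section Layout

variable [Fintype α] [Fintype V] {H : SimpleGraph α} {G : SimpleGraph V} {u w : ℕ}
  {A A' B B' Za Wa U Z W : Finset V} {s t d e L M C r S T : ℕ}

lemma tileable_of_two_blocks {c : α → Bool} (D : HData H u w c) {P₁ Q₁ P₂ Q₂ : Finset V}
    (h1 : Gd G u w (3 * (u + w) ^ 4) P₁ Q₁) (h2 : Gd G u w (3 * (u + w) ^ 4) P₂ Q₂)
    (hd : Disjoint (P₁ ∪ Q₁) (P₂ ∪ Q₂)) (hdvd : u + w ∣ ((P₁ ∪ Q₁) ∪ (P₂ ∪ Q₂)).card) :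
    Tileable H G ((P₁ ∪ Q₁) ∪ (P₂ ∪ Q₂)) := by
  have e : (univ.biUnion fun i : Bool => (cond i P₁ P₂) ∪ (cond i Q₁ Q₂)) =
      (P₁ ∪ Q₁) ∪ (P₂ ∪ Q₂) := by
    ext x
    simp only [Finset.mem_biUnion, Finset.mem_univ, true_and, Bool.exists_bool, cond_true,
      cond_false, Finset.mem_union (s := P₁ ∪ Q₁)]
    exact or_comm
  rw [← e] at hdvd ⊢
  refine D.tileable_blocks _ _ _ ?_ ?_ hdvd
  · rintro (_ | _) _
    · exact h2
    · exact h1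
  · rintro (_ | _) _ (_ | _) _ hij
    · exact absurd rfl hij
    · exact hd.symm
    · exact hd
    · exact absurd rfl hij

lemma St.exists_block (hT : TileSize H G w u) (hu : 0 < u) (huw : u < w)
    (hL : Lay A A' B B') (hA : Half G u w A A' B Za d e L M C r S T) (hBL : L ≤ B.card)
    (h : St H G u w A A' B B' Za Wa U S T Za Wa)
    (hM : (u + w) * (S + T + Za.card + Wa.card) ≤ M)
    (hLM : M + (C + w ^ 2 + u + u * ((u + w) * d)) +
      ((C + w ^ 2 + u) * d + w * (C + w ^ 2 + u)) + r * w ≤ L) :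
    ∃ P₁ ⊆ B \ U, ∃ Q₁ ⊆ A' \ U, Gd G u w C P₁ Q₁ ∧
      Tileable H G (((B \ U) ∪ (A' \ U)) \ (P₁ ∪ Q₁)) := by
  have hZU : Za ⊆ U := by
    have := h.eZ
    exact Finset.inter_eq_left.1 this
  have hsub : A' \ U ⊆ A' \ Za := Finset.sdiff_subset_sdiff subset_rfl hZU
  have hUM : U.card ≤ M := by
    rw [h.cU]
    exact hM
  have c1 := card_sdiff_add_inter B U
  have c2 := card_sdiff_add_inter A' U
  have c3 := h.cA'
  have c4 := h.cB
  have c5 := hA.slack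
  have c6 := hA.slack'
  have c7 := hA.size'
  have c8 : (B ∩ U).card ≤ U.card := Finset.card_le_card inter_subset_right
  have c9 : (A' ∩ U).card ≤ U.card := Finset.card_le_card inter_subset_right
  have c10 : r * u ≤ r * w := Nat.mul_le_mul_left _ huw.le
  obtain ⟨b, hb⟩ : ∃ b, b = (B \ U).card := ⟨_, rfl⟩
  obtain ⟨a, ha⟩ : ∃ a, a = (A' \ U).card := ⟨_, rfl⟩
  have f1 : u * B.card = u * b + u * (T + w * (S + Za.card)) := by
    rw [← c1, ← hb, c4]; ring
  have f2 : w * A'.card + w * S = w * a + w * (u * (S + Za.card)) := by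
    rw [← c2, ← ha, ← c3]; ring
  have f3 : u * (T + w * (S + Za.card)) = u * T + w * (u * (S + Za.card)) := by ring
  refine exists_gd_block_of_slack hT hu huw r (d := d) ?_ (hA.miss.mono sdiff_subset hsub)
    (hA.miss'.mono hsub sdiff_subset) ?_ ?_ ?_ ?_
  · exact Finset.disjoint_of_subset_left sdiff_subset
      (Finset.disjoint_of_subset_right sdiff_subset hL.a'b.symm)
  · rw [← ha, ← hb]
    omega
  · rw [← ha, ← hb]
    omega
  · omega
  · omega

lemma tileable_of_layout_aux {c : α → Bool} (D : HData H u w c) (hu : 0 < u)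
    (hL : Lay A A' B B') (hA : Half G u w A A' B Za d e L M (3 * (u + w) ^ 4) r S T)
    (hB : Half G u w B B' A Wa d e L M (3 * (u + w) ^ 4) r T S)
    (hM : (u + w) * (S + T + Za.card + Wa.card) ≤ M)
    (hLM : M + M + (3 * (u + w) ^ 4 + w ^ 2 + u + u * ((u + w) * d)) +
      ((3 * (u + w) ^ 4 + w ^ 2 + u) * d + w * (3 * (u + w) ^ 4 + w ^ 2 + u)) + r * w
      + (w * d + u) ≤ L)
    (hdvd : u + w ∣ ((A ∪ A') ∪ (B ∪ B')).card) (hST : S ≤ T) :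
    Tileable H G ((A ∪ A') ∪ (B ∪ B')) := by
  have hT : TileSize H G w u := D.tileSize
  have huw := D.lt
  have hTS : (u + w) * (S + T) ≤ M := (Nat.mul_le_mul_left _ (by omega)).trans hM
  obtain ⟨U₁, h1⟩ := St.exists_centers hT hu (hu.trans huw) hL hA hB (by omega)
    St.empty (Nat.zero_le S) ((Nat.mul_le_mul_left _ (by omega)).trans hTS) S le_rfl
  obtain ⟨U₂, h2⟩ := St.exists_centers hT hu (hu.trans huw) hL.swap hB hA (by omega)
    h1.swap hST (by rwa [Nat.add_comm T]) T le_rfl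
  obtain ⟨U₃, h3⟩ := St.exists_exceptional hT hu hL hA hB.sub (by omega) h2.swap
    ((Nat.mul_le_mul_left _ (by simp)).trans hM)
  obtain ⟨U, h4⟩ := St.exists_exceptional hT hu hL.swap hB hA.sub (by omega) h3.swap
    ((Nat.mul_le_mul_left _ (by omega)).trans hM)
  obtain ⟨P₁, hP₁, Q₁, hQ₁, hg1, hR1⟩ := h4.swap.exists_block hT hu huw hL hA hB.size hM (by omega)
  obtain ⟨P₂, hP₂, Q₂, hQ₂, hg2, hR2⟩ := h4.exists_block hT hu huw hL.swap hB hA.size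
    (by convert hM using 2; ring) (by omega)
  have hdU : ∀ R : Finset V, Disjoint U (R \ U) := fun R => Finset.disjoint_sdiff
  have hd1 : Disjoint U (((B \ U) ∪ (A' \ U)) ∪ ((A \ U) ∪ (B' \ U))) := by
    simp only [Finset.disjoint_union_right]
    exact ⟨⟨hdU _, hdU _⟩, hdU _, hdU _⟩
  have hss : ∀ {R R' : Finset V}, Disjoint R R' → Disjoint (R \ U) (R' \ U) := fun h =>
    Finset.disjoint_of_subset_left sdiff_subset (Finset.disjoint_of_subset_right sdiff_subset h)
  have hd2 : Disjoint ((B \ U) ∪ (A' \ U)) ((A \ U) ∪ (B' \ U)) := by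
    simp only [Finset.disjoint_union_right, Finset.disjoint_union_left]
    exact ⟨⟨hss hL.ab.symm, hss hL.left.symm⟩, hss hL.right, hss hL.a'b'⟩
  have hK₁ := Finset.union_subset_union hP₁ hQ₁
  have hK₂ := Finset.union_subset_union hP₂ hQ₂
  have hT0 : Tileable H G (U ∪ ((((B \ U) ∪ (A' \ U)) \ (P₁ ∪ Q₁)) ∪
      (((A \ U) ∪ (B' \ U)) \ (P₂ ∪ Q₂)))) := by
    refine h4.tile.union (hR1.union hR2 ?_) ?_
    · exact Finset.disjoint_of_subset_left sdiff_subset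
        (Finset.disjoint_of_subset_right sdiff_subset hd2)
    · exact Finset.disjoint_of_subset_right
        (Finset.union_subset_union sdiff_subset sdiff_subset) hd1
  have hsub : U ∪ ((((B \ U) ∪ (A' \ U)) \ (P₁ ∪ Q₁)) ∪ (((A \ U) ∪ (B' \ U)) \ (P₂ ∪ Q₂))) ⊆
      U ∪ (((B \ U) ∪ (A' \ U)) ∪ ((A \ U) ∪ (B' \ U))) :=
    Finset.union_subset_union subset_rfl (Finset.union_subset_union sdiff_subset sdiff_subset)
  have hK := sdiff_eq_of_disjoint_parts hd1 hd2 hK₁ hK₂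
  rw [← parts_eq h4.swap.sub] at hdvd ⊢
  refine hT0.of_union_sdiff ?_ hsub
  rw [hK]
  refine tileable_of_two_blocks D hg1 hg2 ?_ ?_
  · exact Finset.disjoint_of_subset_left hK₁ (Finset.disjoint_of_subset_right hK₂ hd2)
  · rw [← hK, Finset.card_sdiff_of_subset hsub]
    have h5 := hT0.dvd_card
    rw [D.card_eq] at h5
    exact Nat.dvd_sub hdvd h5

/-- An extremal configuration is tileable. -/
lemma tileable_of_layout {c : α → Bool} (D : HData H u w c) (hu : 0 < u)
    (hL : Lay A A' B B') (hA : Half G u w A A' B Za d e L M (3 * (u + w) ^ 4) r S T)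
    (hB : Half G u w B B' A Wa d e L M (3 * (u + w) ^ 4) r T S)
    (hM : (u + w) * (S + T + Za.card + Wa.card) ≤ M)
    (hLM : M + M + (3 * (u + w) ^ 4 + w ^ 2 + u + u * ((u + w) * d)) +
      ((3 * (u + w) ^ 4 + w ^ 2 + u) * d + w * (3 * (u + w) ^ 4 + w ^ 2 + u)) + r * w
      + (w * d + u) ≤ L)
    (hdvd : u + w ∣ ((A ∪ A') ∪ (B ∪ B')).card) :
    Tileable H G ((A ∪ A') ∪ (B ∪ B')) := by
  rcases le_total S T with h | h
  · exact tileable_of_layout_aux D hu hL hA hB hM hLM hdvd h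
  · rw [Finset.union_comm] at hdvd ⊢
    exact tileable_of_layout_aux D hu hL.swap hB hA
      (by convert hM using 2; ring) hLM hdvd h

end Layout

lemma sparse_core_arith {ρ η n A₀ B₀ D : ℝ} (hρ : 1 / 2 ≤ ρ) (hη : 0 < η) (hη' : η ≤ 1 / 16)
    (hn : 0 < n) (hA₀ : (ρ - η ^ 3) * n ≤ A₀) (hB₀ : (ρ - η ^ 3) * n ≤ B₀) (hB₀' : B₀ ≤ n)
    (hD : 0 ≤ D)
    (h : B₀ * ((1 - ρ) * n) ≤ η ^ 3 * n ^ 2 + (D * (η * n) + (n - A₀ - D) * B₀)) :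
    D ≤ 16 * η ^ 3 * n ∧ A₀ ≤ ρ * n + 4 * η ^ 3 * n := by
  have h3 : η ^ 3 ≤ 1 / 16 := by
    have : η ^ 3 ≤ η ^ 1 := pow_le_pow_of_le_one hη.le (by linarith) (by norm_num)
    linarith
  have h0 : 0 < η ^ 3 := by positivity
  have h1 : D * (B₀ - η * n) + B₀ * (A₀ - ρ * n) ≤ η ^ 3 * n ^ 2 := by nlinarith
  have hB1 : n / 4 + η * n ≤ B₀ := by nlinarith
  have hB2 : 0 ≤ B₀ := by nlinarith
  constructor
  · have h2 : B₀ * (-(η ^ 3 * n)) ≤ B₀ * (A₀ - ρ * n) :=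
      mul_le_mul_of_nonneg_left (by linarith) hB2
    have h4 : B₀ * (η ^ 3 * n) ≤ n * (η ^ 3 * n) := mul_le_mul_of_nonneg_right hB₀' (by positivity)
    have h5 : D * (n / 4) ≤ D * (B₀ - η * n) := mul_le_mul_of_nonneg_left (by linarith) hD
    have h6 : n * D ≤ n * (16 * η ^ 3 * n) := by nlinarith
    exact le_of_mul_le_mul_left h6 hn
  · by_contra hlt
    push Not at hlt
    have h2 : 0 ≤ D * (B₀ - η * n) := mul_nonneg hD (by nlinarith)
    have h4 : n / 4 * (A₀ - ρ * n) ≤ B₀ * (A₀ - ρ * n) :=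
      mul_le_mul_of_nonneg_right (by nlinarith) (by nlinarith)
    have h5 : n * (A₀ - ρ * n) ≤ n * (4 * η ^ 3 * n) := by nlinarith
    have h6 := le_of_mul_le_mul_left h5 hn
    linarith

section Core

variable {G : SimpleGraph V}

lemma mul_le_eAB_of_le_degIn {S T : Finset V} {x : ℝ} (h : ∀ s ∈ S, x ≤ degIn G s T) :
    S.card * x ≤ eAB G S T := by
  rw [eAB_eq_sum]
  push_cast
  simpa using Finset.card_nsmul_le_sum S (fun s => (degIn G s T : ℝ)) x h

lemma eAB_le_mul_of_degIn_le {S T : Finset V} {x : ℝ} (h : ∀ s ∈ S, (degIn G s T : ℝ) ≤ x) :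
    (eAB G S T : ℝ) ≤ S.card * x := by
  rw [eAB_eq_sum]
  push_cast
  simpa using Finset.sum_le_card_nsmul S (fun s => (degIn G s T : ℝ)) x h

/-- A sparse pair of almost maximal size is close to the set of vertices of low degree. -/
lemma sparse_core {X A₀ B₀ : Finset V} {ρ η : ℝ} {n : ℕ} (hρ : 1 / 2 ≤ ρ) (hη : 0 < η)
    (hη' : η ≤ 1 / 16) (hn : 0 < n) (hX : X.card = n) (hAX : A₀ ⊆ X)
    (hA₀ : (ρ - η ^ 3) * n ≤ A₀.card) (hB₀ : (ρ - η ^ 3) * n ≤ B₀.card) (hB₀' : B₀.card ≤ n)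
    (he : (eAB G A₀ B₀ : ℝ) ≤ η ^ 3 * n ^ 2) (hdeg : ∀ y ∈ B₀, (1 - ρ) * n ≤ degIn G y X) :
    ((A₀ \ X.filter fun x => (degIn G x B₀ : ℝ) ≤ η * n).card : ℝ) ≤ η ^ 2 * n ∧
    (((X.filter fun x => (degIn G x B₀ : ℝ) ≤ η * n) \ A₀).card : ℝ) ≤ 16 * η ^ 3 * n ∧
    (A₀.card : ℝ) ≤ ρ * n + 4 * η ^ 3 * n := by
  have hn' : (0 : ℝ) < n := by exact_mod_cast hn
  obtain ⟨A, hA⟩ : ∃ A, A = X.filter fun x => (degIn G x B₀ : ℝ) ≤ η * n := ⟨_, rfl⟩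
  rw [← hA]
  refine ⟨?_, ?_⟩
  · have h1 : ((A₀ \ A).card : ℝ) * (η * n) ≤ eAB G (A₀ \ A) B₀ := by
      refine mul_le_eAB_of_le_degIn fun x hx => ?_
      rw [Finset.mem_sdiff, hA, Finset.mem_filter, not_and, not_le] at hx
      exact (hx.2 (hAX hx.1)).le
    have h2 : (eAB G (A₀ \ A) B₀ : ℝ) ≤ eAB G A₀ B₀ := by
      exact_mod_cast eAB_mono sdiff_subset subset_rfl
    have h3 : (η * n) * ((A₀ \ A).card : ℝ) ≤ (η * n) * (η ^ 2 * n) := by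
      calc (η * n) * ((A₀ \ A).card : ℝ) = ((A₀ \ A).card : ℝ) * (η * n) := mul_comm _ _
        _ ≤ η ^ 3 * n ^ 2 := h1.trans (h2.trans he)
        _ = _ := by ring
    exact le_of_mul_le_mul_left h3 (by positivity)
  · have h1 : (B₀.card : ℝ) * ((1 - ρ) * n) ≤ eAB G B₀ X := mul_le_eAB_of_le_degIn hdeg
    have h2 : eAB G B₀ X ≤ eAB G A₀ B₀ + (eAB G B₀ (A \ A₀) + eAB G B₀ ((X \ A₀) \ A)) := by
      have e1 : X = A₀ ∪ ((A \ A₀) ∪ ((X \ A₀) \ A)) := by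
        have hAX' : A ⊆ X := hA ▸ Finset.filter_subset _ _
        ext x
        have e2 := @hAX x
        have e3 := @hAX' x
        simp only [Finset.mem_union, Finset.mem_sdiff]
        tauto
      conv_lhs => rw [e1]
      refine (eAB_union_le _ _ _).trans ?_
      rw [eAB_comm B₀ A₀]
      exact Nat.add_le_add_left (eAB_union_le _ _ _) _
    have h3 : (eAB G B₀ (A \ A₀) : ℝ) ≤ (A \ A₀).card * (η * n) := by
      rw [eAB_comm]
      refine eAB_le_mul_of_degIn_le fun x hx => ?_
      rw [Finset.mem_sdiff, hA, Finset.mem_filter] at hx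
      exact hx.1.2
    have h4 : eAB G B₀ ((X \ A₀) \ A) ≤ B₀.card * ((X \ A₀) \ A).card := eAB_le_mul _ _
    have h5 : A₀.card + (A \ A₀).card + ((X \ A₀) \ A).card = n := by
      have e1 := Finset.card_sdiff_add_card_eq_card hAX
      have e2 := card_sdiff_add_inter (X \ A₀) A
      have e3 : (X \ A₀) ∩ A = A \ A₀ := by
        have hAX' : A ⊆ X := hA ▸ Finset.filter_subset _ _
        ext x
        have e3 := @hAX' x
        simp only [Finset.mem_inter, Finset.mem_sdiff]
        tauto
      rw [e3] at e2
      omega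
    have h2' : (eAB G B₀ X : ℝ) ≤ eAB G A₀ B₀ + (eAB G B₀ (A \ A₀) +
        eAB G B₀ ((X \ A₀) \ A)) := by exact_mod_cast h2
    have h4' : (eAB G B₀ ((X \ A₀) \ A) : ℝ) ≤ B₀.card * ((X \ A₀) \ A).card := by
      exact_mod_cast h4
    have h5' : (A₀.card : ℝ) + (A \ A₀).card + ((X \ A₀) \ A).card = n := by exact_mod_cast h5
    have h6 : (((X \ A₀) \ A).card : ℝ) = n - A₀.card - (A \ A₀).card := by linarith
    rw [h6] at h4'
    refine sparse_core_arith hρ hη hη' hn' hA₀ hB₀ (by exact_mod_cast hB₀') (Nat.cast_nonneg _) ?_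
    linarith

end Core

/-- The rough shape of one side of an extremal graph. -/
structure Rough (G : SimpleGraph V) (A A' B : Finset V) (n : ℕ) (ρ η : ℝ) : Prop where
  lower : ρ * n - 2 * η ^ 2 * n ≤ A.card
  upper : (A.card : ℝ) ≤ ρ * n + 2 * η ^ 2 * n
  sparse : ∀ x ∈ A, (degIn G x B : ℝ) ≤ 2 * η * n
  rich : ∀ x ∈ A', η * n / 2 ≤ degIn G x B

lemma rough_of_core {G : SimpleGraph V} {X A₀ B₀ B : Finset V} {ρ η : ℝ} {n : ℕ} (hη : 0 < η)
    (hη' : η ≤ 1 / 16) (hA₀ : (ρ - η ^ 3) * n ≤ A₀.card)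
    (h1 : ((A₀ \ X.filter fun x => (degIn G x B₀ : ℝ) ≤ η * n).card : ℝ) ≤ η ^ 2 * n)
    (h2 : (((X.filter fun x => (degIn G x B₀ : ℝ) ≤ η * n) \ A₀).card : ℝ) ≤ 16 * η ^ 3 * n)
    (h3 : (A₀.card : ℝ) ≤ ρ * n + 4 * η ^ 3 * n)
    (h4 : ((B₀ \ B).card : ℝ) ≤ η ^ 2 * n) (h5 : ((B \ B₀).card : ℝ) ≤ 16 * η ^ 3 * n) :
    Rough G (X.filter fun x => (degIn G x B₀ : ℝ) ≤ η * n)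
      (X \ X.filter fun x => (degIn G x B₀ : ℝ) ≤ η * n) B n ρ η := by
  obtain ⟨A, hA⟩ : ∃ A, A = X.filter fun x => (degIn G x B₀ : ℝ) ≤ η * n := ⟨_, rfl⟩
  rw [← hA] at h1 h2 ⊢
  have hn : (0 : ℝ) ≤ n := Nat.cast_nonneg n
  have e1 : ((A \ A₀).card : ℝ) + (A ∩ A₀).card = A.card := by
    exact_mod_cast card_sdiff_add_inter A A₀
  have e2 : ((A₀ \ A).card : ℝ) + (A ∩ A₀).card = A₀.card := by
    rw [Finset.inter_comm]
    exact_mod_cast card_sdiff_add_inter A₀ A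
  have e0 : (0 : ℝ) ≤ (A₀ \ A).card := Nat.cast_nonneg _
  have e0' : (0 : ℝ) ≤ (A \ A₀).card := Nat.cast_nonneg _
  have e3 : η ^ 3 * n ≤ 1 / 16 * (η ^ 2 * n) := by
    have : η * (η ^ 2 * n) ≤ 1 / 16 * (η ^ 2 * n) :=
      mul_le_mul_of_nonneg_right hη' (by positivity)
    calc η ^ 3 * n = η * (η ^ 2 * n) := by ring
      _ ≤ _ := this
  have e4 : η ^ 2 * n ≤ 1 / 16 * (η * n) := by
    have : η * (η * n) ≤ 1 / 16 * (η * n) :=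
      mul_le_mul_of_nonneg_right hη' (by positivity)
    calc η ^ 2 * n = η * (η * n) := by ring
      _ ≤ _ := this
  have e5 : 0 ≤ η * n := by positivity
  have hA₀' : ρ * n - η ^ 3 * n ≤ A₀.card := by linarith
  refine ⟨?_, ?_, fun x hx => ?_, fun x hx => ?_⟩
  · linarith
  · have : 0 ≤ η ^ 2 * n := by positivity
    linarith
  · rw [hA, Finset.mem_filter] at hx
    have f1 : (degIn G x B : ℝ) ≤ degIn G x B₀ + (B \ B₀).card := by
      have f2 : degIn G x B ≤ degIn G x B₀ + degIn G x (B \ B₀) := by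
        refine (degIn_mono x ?_).trans (degIn_union_le x B₀ (B \ B₀))
        rw [Finset.union_sdiff_self_eq_union]
        exact subset_union_right
      have f3 := degIn_le_card (G := G) x (B \ B₀)
      exact_mod_cast f2.trans (Nat.add_le_add_left f3 _)
    linarith [hx.2]
  · rw [hA, Finset.mem_sdiff, Finset.mem_filter, not_and, not_le] at hx
    have f1 : (degIn G x B₀ : ℝ) ≤ degIn G x B + (B₀ \ B).card := by
      have f2 : degIn G x B₀ ≤ degIn G x B + degIn G x (B₀ \ B) := by
        refine (degIn_mono x ?_).trans (degIn_union_le x B (B₀ \ B))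
        rw [Finset.union_sdiff_self_eq_union]
        exact subset_union_right
      have f3 := degIn_le_card (G := G) x (B₀ \ B)
      exact_mod_cast f2.trans (Nat.add_le_add_left f3 _)
    linarith [hx.2 hx.1]

lemma exists_rough {G : SimpleGraph V} {X Y A₀ B₀ : Finset V} {ρ η : ℝ} {n : ℕ} (hρ : 1 / 2 ≤ ρ)
    (hη : 0 < η) (hη' : η ≤ 1 / 16) (hn : 0 < n) (hX : X.card = n) (hY : Y.card = n)
    (hAX : A₀ ⊆ X) (hBY : B₀ ⊆ Y) (hA₀ : (ρ - η ^ 3) * n ≤ A₀.card)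
    (hB₀ : (ρ - η ^ 3) * n ≤ B₀.card) (he : (eAB G A₀ B₀ : ℝ) ≤ η ^ 3 * n ^ 2)
    (hdX : ∀ x ∈ X, (1 - ρ) * n ≤ degIn G x Y) (hdY : ∀ y ∈ Y, (1 - ρ) * n ≤ degIn G y X) :
    ∃ A ⊆ X, ∃ B ⊆ Y, Rough G A (X \ A) B n ρ η ∧ Rough G B (Y \ B) A n ρ η ∧
      (eAB G A B : ℝ) ≤ 33 * η ^ 3 * n ^ 2 := by
  have hA₀n : A₀.card ≤ n := hX ▸ Finset.card_le_card hAX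
  have hB₀n : B₀.card ≤ n := hY ▸ Finset.card_le_card hBY
  have he' : (eAB G B₀ A₀ : ℝ) ≤ η ^ 3 * n ^ 2 := by rwa [eAB_comm]
  obtain ⟨a1, a2, a3⟩ := sparse_core hρ hη hη' hn hX hAX hA₀ hB₀ hB₀n he
    (fun y hy => hdY y (hBY hy))
  obtain ⟨b1, b2, b3⟩ := sparse_core hρ hη hη' hn hY hBY hB₀ hA₀ hA₀n he'
    (fun y hy => hdX y (hAX hy))
  have rA := rough_of_core hη hη' hA₀ a1 a2 a3 b1 b2
  have rB := rough_of_core hη hη' hB₀ b1 b2 b3 a1 a2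
  refine ⟨_, Finset.filter_subset _ _, _, Finset.filter_subset _ _, rA, rB, ?_⟩
  generalize hA : (X.filter fun x => (degIn G x B₀ : ℝ) ≤ η * n) = A at *
  generalize hB : (Y.filter fun x => (degIn G x A₀ : ℝ) ≤ η * n) = B at *
  have hAn : A.card ≤ n := hX ▸ hA ▸ Finset.card_le_card (Finset.filter_subset _ _)
  have f1 : eAB G A B ≤ eAB G A B₀ + eAB G A (B \ B₀) := by
    refine (eAB_mono subset_rfl ?_).trans (eAB_union_le _ _ _)
    rw [Finset.union_sdiff_self_eq_union]
    exact subset_union_right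
  have f2 : eAB G A B₀ ≤ eAB G A₀ B₀ + eAB G (A \ A₀) B₀ := by
    rw [eAB_comm A B₀, eAB_comm A₀ B₀, eAB_comm (A \ A₀) B₀]
    refine (eAB_mono subset_rfl ?_).trans (eAB_union_le _ _ _)
    rw [Finset.union_sdiff_self_eq_union]
    exact subset_union_right
  have f3 : eAB G A (B \ B₀) ≤ n * (B \ B₀).card :=
    (eAB_le_mul _ _).trans (Nat.mul_le_mul_right _ hAn)
  have f4 : eAB G (A \ A₀) B₀ ≤ n * (A \ A₀).card := by
    rw [mul_comm]
    exact (eAB_le_mul _ _).trans (Nat.mul_le_mul_left _ hB₀n)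
  have f5 : (eAB G A B : ℝ) ≤ eAB G A₀ B₀ + n * (A \ A₀).card + n * (B \ B₀).card := by
    have : eAB G A B ≤ eAB G A₀ B₀ + n * (A \ A₀).card + n * (B \ B₀).card := by omega
    exact_mod_cast this
  have hn0 : (0 : ℝ) ≤ n := Nat.cast_nonneg n
  have f6 := mul_le_mul_of_nonneg_left a2 hn0
  have f7 := mul_le_mul_of_nonneg_left b2 hn0
  have f8 : (n : ℝ) * (16 * η ^ 3 * n) = 16 * (η ^ 3 * n ^ 2) := by ring
  have f9 : 33 * η ^ 3 * (n : ℝ) ^ 2 = 33 * (η ^ 3 * n ^ 2) := by ring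
  rw [f8] at f6 f7
  rw [f9]
  linarith

lemma sum_miss_le_arith {ρ η n a a' b e s t : ℝ} (hη : 0 < η) (hη' : η ≤ 1 / 16) (hn : 0 ≤ n)
    (ha : a + a' = n) (hl : ρ * n - 2 * η ^ 2 * n ≤ a) (hb : b ≤ n) (hb0 : 0 ≤ b)
    (he : e ≤ 33 * η ^ 3 * n ^ 2) (hs : s + t = a' * b) (ht : b * ((1 - ρ) * n) ≤ e + t) :
    s ≤ 6 * η ^ 2 * n ^ 2 := by
  have h1 : a' ≤ (1 - ρ) * n + 2 * η ^ 2 * n := by linarith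
  have h2 := mul_le_mul_of_nonneg_right h1 hb0
  have h3 : b * (η ^ 2 * n) ≤ n * (η ^ 2 * n) := mul_le_mul_of_nonneg_right hb (by positivity)
  have h4 : η * (η ^ 2 * n ^ 2) ≤ 1 / 16 * (η ^ 2 * n ^ 2) :=
    mul_le_mul_of_nonneg_right hη' (by positivity)
  have h5 : 0 ≤ η ^ 2 * n ^ 2 := by positivity
  nlinarith

/-- Few pairs between the complement of `A` and `B` are nonadjacent. -/
lemma sum_miss_le {G : SimpleGraph V} {X A B : Finset V} {ρ η : ℝ} {n : ℕ} (hη : 0 < η)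
    (hη' : η ≤ 1 / 16) (hX : X.card = n) (hA : A ⊆ X) (hB : B.card ≤ n)
    (hl : ρ * n - 2 * η ^ 2 * n ≤ A.card) (he : (eAB G A B : ℝ) ≤ 33 * η ^ 3 * n ^ 2)
    (hd : ∀ y ∈ B, (1 - ρ) * n ≤ degIn G y X) :
    ((∑ x ∈ X \ A, (B.filter fun y => ¬ G.Adj x y).card : ℕ) : ℝ) ≤ 6 * η ^ 2 * n ^ 2 := by
  have h1 : (∑ x ∈ X \ A, (B.filter fun y => ¬ G.Adj x y).card) + eAB G (X \ A) B =
      (X \ A).card * B.card := by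
    rw [eAB_eq_sum, ← Finset.sum_add_distrib]
    rw [Finset.sum_congr rfl (fun x _ => (add_comm _ _).trans (degIn_add_card_filter_not G x B))]
    simp
  have h2 : (B.card : ℝ) * ((1 - ρ) * n) ≤ eAB G B X := mul_le_eAB_of_le_degIn hd
  have h3 : eAB G B X ≤ eAB G A B + eAB G (X \ A) B := by
    rw [eAB_comm A B, eAB_comm (X \ A) B]
    refine (eAB_mono subset_rfl ?_).trans (eAB_union_le _ _ _)
    rw [Finset.union_sdiff_self_eq_union]
    exact subset_union_right
  have h4 : A.card + (X \ A).card = n := by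
    have := Finset.card_sdiff_add_card_eq_card hA
    omega
  refine sum_miss_le_arith (a := A.card) (a' := (X \ A).card) (b := B.card) (e := eAB G A B)
    (t := eAB G (X \ A) B) hη hη' (Nat.cast_nonneg n) (by exact_mod_cast h4) hl
    (by exact_mod_cast hB) (Nat.cast_nonneg _) he (by exact_mod_cast h1) (h2.trans ?_)
  exact_mod_cast h3

/-- Few vertices outside `A` have more than `d` nonneighbours in `B`. -/
lemma card_exceptional_le {G : SimpleGraph V} {A' B : Finset V} {d : ℕ} {t s : ℝ}
    (ht : t ≤ d + 1)
    (hs : ((∑ x ∈ A', (B.filter fun y => ¬ G.Adj x y).card : ℕ) : ℝ) ≤ s) :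
    ((A'.filter fun x => d < (B.filter fun y => ¬ G.Adj x y).card).card : ℝ) * t ≤ s := by
  refine le_trans ?_ hs
  have h1 : (A'.filter fun x => d < (B.filter fun y => ¬ G.Adj x y).card).card * (d + 1) ≤
      ∑ x ∈ A', (B.filter fun y => ¬ G.Adj x y).card := by
    calc _ ≤ ∑ x ∈ A'.filter (fun x => d < (B.filter fun y => ¬ G.Adj x y).card),
          (B.filter fun y => ¬ G.Adj x y).card := by
            have := Finset.card_nsmul_le_sum
              (A'.filter fun x => d < (B.filter fun y => ¬ G.Adj x y).card)
              (fun x => (B.filter fun y => ¬ G.Adj x y).card) (d + 1)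
              (fun x hx => (Finset.mem_filter.1 hx).2)
            simpa using this
      _ ≤ _ := Finset.sum_le_sum_of_subset (Finset.filter_subset _ _)
  have h2 : ((A'.filter fun x => d < (B.filter fun y => ¬ G.Adj x y).card).card : ℝ) * (d + 1) ≤
      ((∑ x ∈ A', (B.filter fun y => ¬ G.Adj x y).card : ℕ) : ℝ) := by exact_mod_cast h1
  exact (mul_le_mul_of_nonneg_left ht (Nat.cast_nonneg _)).trans h2

lemma miss_sdiff_exceptional (G : SimpleGraph V) (A' B : Finset V) (d : ℕ) :
    Miss G d (A' \ A'.filter fun x => d < (B.filter fun y => ¬ G.Adj x y).card) B := by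
  intro x hx
  rw [Finset.mem_sdiff, Finset.mem_filter, not_and, not_lt] at hx
  exact hx.2 hx.1

lemma miss_of_rough {G : SimpleGraph V} {X A B : Finset V} {ρ η : ℝ} {n d : ℕ} (hη : 0 < η)
    (hη' : η ≤ 1 / 16) (hX : X.card = n) (hA : A ⊆ X)
    (hl : ρ * n - 2 * η ^ 2 * n ≤ A.card) (hs : ∀ y ∈ B, (degIn G y A : ℝ) ≤ 2 * η * n)
    (hd : ∀ y ∈ B, (1 - ρ) * n ≤ degIn G y X) (hdn : 3 * η * n ≤ d) : Miss G d B (X \ A) := by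
  intro y hy
  have h1 := degIn_add_card_filter_not G y (X \ A)
  have h4 : A.card + (X \ A).card = n := by
    have := Finset.card_sdiff_add_card_eq_card hA
    omega
  have h3 : degIn G y X ≤ degIn G y A + degIn G y (X \ A) := by
    refine (degIn_mono y ?_).trans (degIn_union_le _ _ _)
    rw [Finset.union_sdiff_self_eq_union]
    exact subset_union_right
  have h1' : (degIn G y (X \ A) : ℝ) + ((X \ A).filter fun q => ¬ G.Adj y q).card =
      (X \ A).card := by exact_mod_cast h1
  have h3' : (degIn G y X : ℝ) ≤ degIn G y A + degIn G y (X \ A) := by exact_mod_cast h3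
  have h4' : (A.card : ℝ) + (X \ A).card = n := by exact_mod_cast h4
  have h5 : η * (η * n) ≤ 1 / 16 * (η * n) := mul_le_mul_of_nonneg_right hη' (by positivity)
  have h6 : η ^ 2 * (n : ℝ) = η * (η * n) := by ring
  have h7 : 0 ≤ η * (n : ℝ) := by positivity
  have h8 := hs y hy
  have h9 := hd y hy
  have : (((X \ A).filter fun q => ¬ G.Adj y q).card : ℝ) ≤ d := by linarith
  exact_mod_cast this

/-- The numerical hierarchy between the constants used for extremal graphs. -/
structure ExtParams (u w n d e L M : ℕ) (ρ η p q R : ℝ) : Prop where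
  hu : 1 ≤ u
  lt : u < w
  eta_pos : 0 < η
  eta_le : η ≤ 1 / 16
  p_eq : η * n = p
  q_eq : η ^ 2 * n = q
  R_eq : ρ * n = R
  mul_R : (u + w : ℝ) * R = w * n
  q_nonneg : 0 ≤ q
  q_le : 100000 * (u + w : ℝ) * q ≤ p
  le_p : 100 * (u + w : ℝ) ^ 5 ≤ p
  n_eq : (n : ℝ) = 100000 * (u + w : ℝ) ^ 6 * p
  le_M : p / 4 - 1 ≤ M
  M_le : (M : ℝ) ≤ p / 4
  le_e : ∀ k : ℕ, (k : ℝ) ≤ 2 * p → k ≤ e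
  e_le : (e : ℝ) ≤ 2 * p
  le_d : 1000 * (u + w : ℝ) * p ≤ d + 1
  d_le : (d : ℝ) ≤ 1000 * (u + w : ℝ) * p
  le_L : (n : ℝ) ≤ 2 * (u + w : ℝ) * (L + 1)
  L_le : 2 * (u + w : ℝ) * L ≤ n

lemma exists_extParams {u w : ℕ} (hu : 1 ≤ u) (lt : u < w) : ∃ η : ℝ, 0 < η ∧ η ≤ 1 / 16 ∧
    ∃ n₀ : ℕ, 0 < n₀ ∧ ∀ n, n₀ ≤ n → ∃ d e L M : ℕ, ∃ p q R : ℝ,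
      ExtParams u w n d e L M ((w : ℝ) / (u + w : ℕ)) η p q R := by
  obtain ⟨h, hh⟩ : ∃ h : ℝ, h = u + w := ⟨_, rfl⟩
  have hu' : (1 : ℝ) ≤ u := by exact_mod_cast hu
  have hw' : (1 : ℝ) + u ≤ w := by exact_mod_cast (by omega : 1 + u ≤ w)
  have h3 : 3 ≤ h := by linarith
  have h1 : 1 ≤ h ^ 5 := one_le_pow₀ (by linarith)
  have h6 : h ^ 6 = h * h ^ 5 := by ring
  have h66 : 3 ≤ h ^ 6 := by nlinarith
  have hη : 0 < 1 / (100000 * h ^ 6) := by positivity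
  refine ⟨1 / (100000 * h ^ 6), hη, ?_, 10000000 * (u + w) ^ 11, by positivity, fun n hn => ?_⟩
  · rw [div_le_iff₀ (by positivity)]
    linarith
  have hn' : 10000000 * h ^ 11 ≤ (n : ℝ) := by
    rw [hh]
    exact_mod_cast hn
  obtain ⟨η, hη'⟩ : ∃ η : ℝ, η = 1 / (100000 * h ^ 6) := ⟨_, rfl⟩
  rw [← hη']
  rw [← hη'] at hη
  have e1 : η * (100000 * h ^ 6) = 1 := by rw [hη']; field_simp
  have e2 : (n : ℝ) = 100000 * h ^ 6 * (η * n) := by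
    calc (n : ℝ) = (η * (100000 * h ^ 6)) * n := by rw [e1, one_mul]
      _ = _ := by ring
  have hp0 : 0 ≤ η * n := by positivity
  have e3 : 100000 * h * η ≤ 1 := by
    rw [← e1]
    have : η * h * 1 ≤ η * h * h ^ 5 := mul_le_mul_of_nonneg_left h1 (by positivity)
    nlinarith
  refine ⟨⌊1000 * h * (η * n)⌋₊, ⌊2 * (η * n)⌋₊, ⌊n / (2 * h)⌋₊, ⌊η * n / 4⌋₊, η * n, η ^ 2 * n,
    (w : ℝ) / (u + w : ℕ) * n, ?_⟩
  have f1 := Nat.floor_le (show 0 ≤ 1000 * h * (η * n) by positivity)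
  have f2 := Nat.floor_le (show 0 ≤ 2 * (η * n) by positivity)
  have f3 := Nat.floor_le (show (0 : ℝ) ≤ n / (2 * h) by positivity)
  have f4 := Nat.floor_le (show 0 ≤ η * n / 4 by positivity)
  have g1 := (Nat.lt_floor_add_one (1000 * h * (η * n))).le
  have g2 : ∀ k : ℕ, (k : ℝ) ≤ 2 * (η * n) → k ≤ ⌊2 * (η * n)⌋₊ := fun k hk => Nat.le_floor hk
  have g3 := (Nat.lt_floor_add_one (n / (2 * h))).le
  have g4 := (Nat.lt_floor_add_one (η * n / 4)).le
  generalize ⌊1000 * h * (η * n)⌋₊ = d at *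
  generalize ⌊2 * (η * n)⌋₊ = e at *
  generalize ⌊n / (2 * h)⌋₊ = L at *
  generalize ⌊η * n / 4⌋₊ = M at *
  rw [le_div_iff₀ (by positivity)] at f3
  rw [div_le_iff₀ (by positivity)] at g3
  refine ⟨hu, lt, hη, ?_, rfl, rfl, rfl, ?_, by positivity, ?_, ?_, ?_, by linarith, f4,
    g2, f2, ?_, ?_, ?_, ?_⟩
  · nlinarith
  · push_cast
    rw [← hh]
    field_simp
  · rw [← hh]
    have := mul_le_mul_of_nonneg_right e3 hp0
    nlinarith
  · rw [← hh]
    have h7 : 100000 * h ^ 6 * (100 * h ^ 5) ≤ 100000 * h ^ 6 * (η * n) := by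
      rw [← e2]
      calc _ = 10000000 * h ^ 11 := by ring
        _ ≤ _ := hn'
    exact le_of_mul_le_mul_left h7 (by positivity)
  · rw [← hh]; exact e2
  · rw [← hh]; exact g1
  · rw [← hh]; exact f1
  · rw [← hh]; linarith
  · rw [← hh]; linarith

namespace ExtParams

variable {u w n d e L M : ℕ} {ρ η p q R : ℝ}

lemma three_le (P : ExtParams u w n d e L M ρ η p q R) : (3 : ℝ) ≤ u + w := by
  have hu' : (1 : ℝ) ≤ u := by exact_mod_cast P.hu
  have hw' : (1 : ℝ) + u ≤ w := by
    have := P.lt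
    exact_mod_cast (by omega : 1 + u ≤ w)
  linarith

lemma hundred_le_p (P : ExtParams u w n d e L M ρ η p q R) {k : ℕ} (hk : k ≤ 5) :
    100 * (u + w : ℝ) ^ k ≤ p := by
  have h1 : (u + w : ℝ) ^ k ≤ (u + w : ℝ) ^ 5 :=
    pow_le_pow_right₀ (by linarith [P.three_le]) hk
  linarith [P.le_p]

lemma p_pos (P : ExtParams u w n d e L M ρ η p q R) : 0 < p := by
  have := P.hundred_le_p (k := 0) (by norm_num)
  norm_num at this
  linarith

lemma le_n (P : ExtParams u w n d e L M ρ η p q R) {k : ℕ} (hk : k ≤ 6) :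
    100000 * ((u + w : ℝ) ^ k * p) ≤ n := by
  have h1 : (u + w : ℝ) ^ k ≤ (u + w : ℝ) ^ 6 :=
    pow_le_pow_right₀ (by linarith [P.three_le]) hk
  have := mul_le_mul_of_nonneg_right h1 P.p_pos.le
  rw [P.n_eq]
  linarith

lemma half_le_R (P : ExtParams u w n d e L M ρ η p q R) : (n : ℝ) / 2 ≤ R := by
  have h1 := P.mul_R
  have h2 := P.three_le
  have hw' : (1 : ℝ) + u ≤ w := by
    have := P.lt
    exact_mod_cast (by omega : 1 + u ≤ w)
  have hn : (0 : ℝ) ≤ n := Nat.cast_nonneg n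
  have h3 : (u + w : ℝ) * (n / 2) ≤ (u + w : ℝ) * R := by rw [h1]; nlinarith
  exact le_of_mul_le_mul_left h3 (by linarith)

lemma hundred_q_le (P : ExtParams u w n d e L M ρ η p q R) : 100000 * q ≤ p := by
  have h1 := P.q_le
  have h2 := P.three_le
  have h3 := P.q_nonneg
  nlinarith

end ExtParams

/-- The vertices of `A'` with more than `d` nonneighbours in `B`. -/
noncomputable def exceptional (G : SimpleGraph V) (A' B : Finset V) (d : ℕ) : Finset V :=
  A'.filter fun x => d < (B.filter fun y => ¬ G.Adj x y).card

/-- A correction for the excess `h * a + k - b`. -/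
lemma exists_correction (h a k b : ℕ) (hh : 0 < h) :
    ∃ S, h * a + k ≤ h * S + b ∧ (0 < S → h * S + b ≤ h * a + k + h) := by
  refine ⟨(h * a + k + (h - 1) - b) / h, ?_, fun hS => ?_⟩
  · have h1 := Nat.lt_mul_div_succ (h * a + k + (h - 1) - b) hh
    rw [Nat.mul_add, Nat.mul_one] at h1
    omega
  · have h1 := Nat.mul_div_le (h * a + k + (h - 1) - b) h
    have h2 : 0 < h * a + k + (h - 1) - b := by
      by_contra h3
      have h4 : h * a + k + (h - 1) - b = 0 := by omega
      rw [h4, Nat.zero_div] at hS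
      exact hS.false
    omega

namespace ExtParams

variable {u w n d e L M : ℕ} {ρ η p q R : ℝ}

lemma one_sub_mul_le (P : ExtParams u w n d e L M ρ η p q R) {x : ℕ}
    (hx : u * n + 4 * (u + w) ^ 4 ≤ (u + w) * x) : (1 - ρ) * n ≤ x := by
  have h1 : (u : ℝ) * n + 4 * (u + w) ^ 4 ≤ (u + w) * x := by exact_mod_cast hx
  have h2 := P.mul_R
  have h3 := P.R_eq
  have h4 := P.three_le
  have h5 : (0 : ℝ) ≤ 4 * (u + w : ℝ) ^ 4 := by positivity
  have h6 : (u + w : ℝ) * ((1 - ρ) * n) ≤ (u + w) * x := by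
    have : (u + w : ℝ) * ((1 - ρ) * n) = (u + w) * n - (u + w) * R := by rw [← h3]; ring
    rw [this, h2]
    linarith
  exact le_of_mul_le_mul_left h6 (by linarith)

lemma correction_le (P : ExtParams u w n d e L M ρ η p q R) {a S : ℕ} (ha : (a : ℝ) ≤ R + 2 * q)
    (hS : 0 < S → (u + w) * S + w * n ≤ (u + w) * a + 3 * (u + w) ^ 4 + (u + w)) :
    (S : ℝ) ≤ 2 * q + 3 * (u + w : ℝ) ^ 3 + 1 := by
  have h4 := P.three_le
  rcases Nat.eq_zero_or_pos S with rfl | hS0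
  · have := P.q_nonneg
    push_cast
    positivity
  · have h1 : (u + w : ℝ) * S + w * n ≤ (u + w) * a + 3 * (u + w) ^ 4 + (u + w) := by
      exact_mod_cast hS hS0
    have h2 := P.mul_R
    have h5 := mul_le_mul_of_nonneg_left ha (by linarith : (0 : ℝ) ≤ u + w)
    have h6 : (u + w : ℝ) * S ≤ (u + w) * (2 * q + 3 * (u + w : ℝ) ^ 3 + 1) := by linarith
    exact le_of_mul_le_mul_left h6 (by linarith)

lemma deg_le (P : ExtParams u w n d e L M ρ η p q R) {a a' S x y z : ℕ} (hS0 : 0 < S)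
    (hS : 0 < S → (u + w) * S + w * n ≤ (u + w) * a + 3 * (u + w) ^ 4 + (u + w))
    (ha : a + a' = n) (hx : u * n + 4 * (u + w) ^ 4 ≤ (u + w) * x) (hxy : x ≤ y + z)
    (hz : z ≤ a') : S + 2 * w ≤ y := by
  have h1 := hS hS0
  have h2 : 3 ≤ u + w := by have := P.hu; have := P.lt; omega
  generalize hh : u + w = h at *
  have hw : w ≤ h := by omega
  have h3 : 9 * h ^ 2 ≤ h ^ 4 := by nlinarith [Nat.mul_le_mul h2 h2, sq_nonneg h]
  have h4 : h * x ≤ h * (y + a') := Nat.mul_le_mul_left _ (by omega)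
  have h5 : h * a + h * a' = u * n + w * n := by rw [← Nat.mul_add, ha, ← hh, Nat.add_mul]
  have h6 : h * w ≤ h ^ 2 := by rw [sq]; exact Nat.mul_le_mul_left _ hw
  have h7 : 3 * h ≤ h ^ 2 := by rw [sq]; exact Nat.mul_le_mul_right _ h2
  refine Nat.le_of_mul_le_mul_left ?_ (by omega : 0 < h)
  rw [Nat.mul_add] at h4 ⊢
  have h8 : h * (2 * w) = 2 * (h * w) := by ring
  omega

lemma slack (P : ExtParams u w n d e L M ρ η p q R) {a a' b S T : ℕ} (ha : a + a' = n)
    (hS : (u + w) * a + 3 * (u + w) ^ 4 ≤ (u + w) * S + w * n)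
    (hT : (u + w) * b + 3 * (u + w) ^ 4 ≤ (u + w) * T + w * n) :
    u * b + 3 * (u + w) ^ 4 ≤ w * a' + w * S + u * T := by
  have h1 := Nat.mul_le_mul_left w hS
  have h2 := Nat.mul_le_mul_left u hT
  have hh : 0 < u + w := by have := P.lt; omega
  subst ha
  refine Nat.le_of_mul_le_mul_left ?_ hh
  nlinarith

lemma slack' (P : ExtParams u w n d e L M ρ η p q R) {a a' b S T : ℕ} (ha : a + a' = n)
    (hl : R - 2 * q ≤ a) (hl' : R - 2 * q ≤ b)
    (hS : (S : ℝ) ≤ 2 * q + 3 * (u + w : ℝ) ^ 3 + 1)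
    (hT : (T : ℝ) ≤ 2 * q + 3 * (u + w : ℝ) ^ 3 + 1) :
    w * a' + w * S + u * T ≤ u * b + 3 * (u + w) ^ 4 + (u + w) * w + M := by
  have h1 : (a : ℝ) + a' = n := by exact_mod_cast ha
  have hu : (1 : ℝ) ≤ u := by exact_mod_cast P.hu
  have hw : (2 : ℝ) ≤ w := by have := P.lt; have := P.hu; exact_mod_cast (by omega : 2 ≤ w)
  have h2 : (w : ℝ) * a' ≤ w * (n - R + 2 * q) :=
    mul_le_mul_of_nonneg_left (by linarith) (by linarith)
  have h3 := mul_le_mul_of_nonneg_left hS (by linarith : (0 : ℝ) ≤ w)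
  have h4 := mul_le_mul_of_nonneg_left hT (by linarith : (0 : ℝ) ≤ u)
  have h5 := mul_le_mul_of_nonneg_left hl' (by linarith : (0 : ℝ) ≤ u)
  have h6 := P.mul_R
  have h7 := P.q_le
  have h8 := P.le_M
  have h9 := P.hundred_le_p (k := 0) (by norm_num)
  have h10 : (u + w : ℝ) ≤ (u + w) * w := by nlinarith
  have : (w : ℝ) * a' + w * S + u * T ≤ u * b + 3 * (u + w) ^ 4 + (u + w) * w + M := by
    have h11 : (w : ℝ) * (2 * q + 3 * (u + w : ℝ) ^ 3 + 1) + u * (2 * q + 3 * (u + w : ℝ) ^ 3 + 1) =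
      2 * ((u + w) * q) + 3 * (u + w) ^ 4 + (u + w) := by ring
    have h12 : 0 ≤ (u + w : ℝ) * q := mul_nonneg (by linarith) P.q_nonneg
    norm_num at h9
    nlinarith
  exact_mod_cast this

lemma card_le (P : ExtParams u w n d e L M ρ η p q R) {a b : ℕ} (ha : (a : ℝ) ≤ R + 2 * q)
    (hb : R - 2 * q ≤ b) : a ≤ 2 * b := by
  have h1 := P.half_le_R
  have h2 := P.hundred_q_le
  have h3 := P.le_n (k := 0) (by norm_num)
  have h4 := P.q_nonneg
  have : (a : ℝ) ≤ 2 * b := by linarith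
  exact_mod_cast this

lemma le_card (P : ExtParams u w n d e L M ρ η p q R) {b : ℕ} (hb : R - 2 * q ≤ b) :
    4 * (u + w) * e ≤ b := by
  have h1 := P.half_le_R
  have h2 := P.hundred_q_le
  have h3 := P.le_n (k := 1) (by norm_num)
  have h4 := P.le_n (k := 0) (by norm_num)
  have h5 := mul_le_mul_of_nonneg_left P.e_le (by linarith [P.three_le] : (0 : ℝ) ≤ u + w)
  have h6 := P.q_nonneg
  have : 4 * (u + w : ℝ) * e ≤ b := by linarith
  exact_mod_cast this

lemma size (P : ExtParams u w n d e L M ρ η p q R) {a : ℕ} (ha : R - 2 * q ≤ a) : L ≤ a := by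
  have h1 := P.half_le_R
  have h2 := P.hundred_q_le
  have h3 := P.L_le
  have h4 := P.le_n (k := 0) (by norm_num)
  have h6 := P.q_nonneg
  have h5 := mul_le_mul_of_nonneg_right P.three_le (Nat.cast_nonneg L : (0 : ℝ) ≤ L)
  have : (L : ℝ) ≤ a := by linarith
  exact_mod_cast this

lemma size' (P : ExtParams u w n d e L M ρ η p q R) {a a' : ℕ} (h : a + a' = n)
    (ha : (a : ℝ) ≤ R + 2 * q) : L ≤ a' := by
  have h1 := P.mul_R
  have h2 := P.q_le
  have h3 := P.L_le
  have h4 := P.le_n (k := 0) (by norm_num)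
  have hu : (1 : ℝ) ≤ u := by exact_mod_cast P.hu
  have h0 : (a : ℝ) + a' = n := by exact_mod_cast h
  have h5 := mul_le_mul_of_nonneg_right hu (Nat.cast_nonneg n : (0 : ℝ) ≤ n)
  have h6 := P.three_le
  have h7 : (u + w : ℝ) * (n - R - 2 * q) ≤ (u + w) * a' :=
    mul_le_mul_of_nonneg_left (by linarith) (by linarith)
  have h9 := P.p_pos
  have h8 : (u + w : ℝ) * L ≤ (u + w) * a' := by linarith
  exact_mod_cast le_of_mul_le_mul_left h8 (by linarith)

lemma exc_le (P : ExtParams u w n d e L M ρ η p q R) {x : ℕ} (hx : p / 2 ≤ x) : M + w ≤ x := by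
  have h1 := P.M_le
  have h2 := P.hundred_le_p (k := 1) (by norm_num)
  have hu : (1 : ℝ) ≤ u := by exact_mod_cast P.hu
  have : (M : ℝ) + w ≤ x := by linarith [P.three_le]
  exact_mod_cast this

lemma card_exceptional (P : ExtParams u w n d e L M ρ η p q R) {z : ℕ}
    (hz : (z : ℝ) * (1000 * (u + w) * p) ≤ 6 * η ^ 2 * n ^ 2) : 1000 * (u + w : ℝ) * z ≤ 6 * p := by
  have h1 : 6 * η ^ 2 * (n : ℝ) ^ 2 = 6 * p * p := by rw [← P.p_eq]; ring
  rw [h1] at hz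
  refine le_of_mul_le_mul_right ?_ P.p_pos
  linarith

lemma excCard_le (P : ExtParams u w n d e L M ρ η p q R) {z : ℕ}
    (hz : 1000 * (u + w : ℝ) * z ≤ 6 * p) : z ≤ M := by
  have h1 := P.le_M
  have h2 := P.hundred_le_p (k := 0) (by norm_num)
  have h3 := mul_le_mul_of_nonneg_right P.three_le (Nat.cast_nonneg z : (0 : ℝ) ≤ z)
  have : (z : ℝ) ≤ M := by norm_num at h2; linarith
  exact_mod_cast this

lemma sum_le_M (P : ExtParams u w n d e L M ρ η p q R) {S T z z' : ℕ}
    (hS : (S : ℝ) ≤ 2 * q + 3 * (u + w : ℝ) ^ 3 + 1)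
    (hT : (T : ℝ) ≤ 2 * q + 3 * (u + w : ℝ) ^ 3 + 1)
    (hz : 1000 * (u + w : ℝ) * z ≤ 6 * p) (hz' : 1000 * (u + w : ℝ) * z' ≤ 6 * p) :
    (u + w) * (S + T + z + z') ≤ M := by
  have h0 : (0 : ℝ) ≤ u + w := by linarith [P.three_le]
  have h1 := mul_le_mul_of_nonneg_left hS h0
  have h2 := mul_le_mul_of_nonneg_left hT h0
  have h3 := P.le_M
  have h4 := P.hundred_le_p (k := 4) (by norm_num)
  have h5 := P.hundred_le_p (k := 1) (by norm_num)
  have h6 := P.q_le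
  have h7 := P.three_le
  have : (u + w : ℝ) * (S + T + z + z') ≤ M := by linarith
  exact_mod_cast this

lemma le_L' (P : ExtParams u w n d e L M ρ η p q R) :
    M + M + (3 * (u + w) ^ 4 + w ^ 2 + u + u * ((u + w) * d)) +
      ((3 * (u + w) ^ 4 + w ^ 2 + u) * d + w * (3 * (u + w) ^ 4 + w ^ 2 + u)) + M * w +
      (w * d + u) ≤ L := by
  have h3 := P.three_le
  have hp := P.hundred_le_p (k := 5) (by norm_num)
  have hM := P.M_le
  have hd := P.d_le
  have hL := P.le_L
  have hn := P.n_eq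
  have hu : (u : ℝ) ≤ u + w := by linarith [(Nat.cast_nonneg w : (0 : ℝ) ≤ w)]
  have hw : (w : ℝ) ≤ u + w := by linarith [(Nat.cast_nonneg u : (0 : ℝ) ≤ u)]
  have hu0 : (0 : ℝ) ≤ u := Nat.cast_nonneg u
  have hw0 : (0 : ℝ) ≤ w := Nat.cast_nonneg w
  have hM0 : (0 : ℝ) ≤ M := Nat.cast_nonneg M
  have hd0 : (0 : ℝ) ≤ d := Nat.cast_nonneg d
  have hp0 := P.p_pos
  obtain ⟨h, hh⟩ : ∃ h : ℝ, h = u + w := ⟨_, rfl⟩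
  have key : (M : ℝ) + M + (3 * (u + w) ^ 4 + w ^ 2 + u + u * ((u + w) * d)) +
      ((3 * (u + w) ^ 4 + w ^ 2 + u) * d + w * (3 * (u + w) ^ 4 + w ^ 2 + u)) + M * w +
      (w * d + u) ≤ L := by
    rw [← hh] at h3 hp hd hL hn hu hw ⊢
    have h1 : (1 : ℝ) ≤ h ^ 3 := one_le_pow₀ (by linarith)
    have a2 : w ^ 2 ≤ h ^ 4 := by
      calc (w : ℝ) ^ 2 ≤ h ^ 2 := pow_le_pow_left₀ hw0 hw 2
        _ ≤ h ^ 4 := pow_le_pow_right₀ (by linarith) (by norm_num)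
    have a3 : h ≤ h ^ 4 := by
      calc h = h ^ 1 := (pow_one h).symm
        _ ≤ h ^ 4 := pow_le_pow_right₀ (by linarith) (by norm_num)
    have a4 : h ^ 2 ≤ h ^ 4 := pow_le_pow_right₀ (by linarith) (by norm_num)
    have a5 : h ^ 4 ≤ h ^ 5 := pow_le_pow_right₀ (by linarith) (by norm_num)
    have b1 : 3 * h ^ 4 + (w : ℝ) ^ 2 + u ≤ 5 * h ^ 4 := by linarith
    have b2 : (3 * h ^ 4 + (w : ℝ) ^ 2 + u) * d ≤ 5 * h ^ 4 * d :=
      mul_le_mul_of_nonneg_right b1 hd0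
    have b3 : w * (3 * h ^ 4 + (w : ℝ) ^ 2 + u) ≤ h * (5 * h ^ 4) :=
      mul_le_mul hw b1 (by positivity) (by linarith)
    have b4 : (u : ℝ) * (h * d) ≤ h ^ 4 * d := by
      have : (u : ℝ) * (h * d) ≤ h * (h * d) := mul_le_mul_of_nonneg_right hu (by positivity)
      nlinarith [mul_le_mul_of_nonneg_right a4 hd0]
    have b5 : (w : ℝ) * d ≤ h ^ 4 * d := mul_le_mul_of_nonneg_right (by linarith) hd0
    have b6 : (M : ℝ) * w ≤ p / 4 * h ^ 5 := mul_le_mul hM (by linarith) hw0 (by positivity)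
    have c1 : h ^ 4 * d ≤ 1000 * (h ^ 5 * p) := by
      have := mul_le_mul_of_nonneg_left hd (by positivity : 0 ≤ h ^ 4)
      calc _ ≤ _ := this
        _ = _ := by ring
    have c2 : p ≤ h ^ 5 * p := by
      have : 1 ≤ h ^ 5 := one_le_pow₀ (by linarith)
      nlinarith
    have c3 : 50000 * (h ^ 5 * p) ≤ L + 1 := by
      have : 2 * h * (50000 * (h ^ 5 * p)) ≤ 2 * h * (L + 1) := by
        calc 2 * h * (50000 * (h ^ 5 * p)) = n := by rw [hn]; ring
          _ ≤ _ := hL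
      exact le_of_mul_le_mul_left this (by linarith)
    have c4 : 1 ≤ h ^ 5 := one_le_pow₀ (by linarith)
    have c5 : h * (5 * h ^ 4) = 5 * h ^ 5 := by ring
    linarith
  exact_mod_cast key

end ExtParams

lemma card_exceptional_rough {u w n d e L M : ℕ} {ρ η p q R : ℝ}
    (P : ExtParams u w n d e L M ρ η p q R) {G : SimpleGraph V} {X A B : Finset V}
    (hX : X.card = n) (hA : A ⊆ X) (hB : B.card ≤ n) (rA : Rough G A (X \ A) B n ρ η)
    (he : (eAB G A B : ℝ) ≤ 33 * η ^ 3 * n ^ 2)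
    (hdeg : ∀ y ∈ B, u * n + 4 * (u + w) ^ 4 ≤ (u + w) * degIn G y X) :
    1000 * (u + w : ℝ) * (exceptional G (X \ A) B d).card ≤ 6 * p :=
  P.card_exceptional (card_exceptional_le P.le_d
    (sum_miss_le P.eta_pos P.eta_le hX hA hB rA.lower he fun y hy => P.one_sub_mul_le (hdeg y hy)))

lemma half_of_rough {u w n d e L M S T : ℕ} {ρ η p q R : ℝ}
    (P : ExtParams u w n d e L M ρ η p q R) {G : SimpleGraph V} {X Y A B : Finset V}
    (hX : X.card = n) (hA : A ⊆ X) (hB : B.card ≤ n)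
    (rA : Rough G A (X \ A) B n ρ η) (rB : Rough G B (Y \ B) A n ρ η)
    (he : (eAB G A B : ℝ) ≤ 33 * η ^ 3 * n ^ 2)
    (hdeg : ∀ y ∈ B, u * n + 4 * (u + w) ^ 4 ≤ (u + w) * degIn G y X)
    (hS : (u + w) * A.card + 3 * (u + w) ^ 4 ≤ (u + w) * S + w * n)
    (hS' : 0 < S → (u + w) * S + w * n ≤ (u + w) * A.card + 3 * (u + w) ^ 4 + (u + w))
    (hT : (u + w) * B.card + 3 * (u + w) ^ 4 ≤ (u + w) * T + w * n)
    (hT' : 0 < T → (u + w) * T + w * n ≤ (u + w) * B.card + 3 * (u + w) ^ 4 + (u + w)) :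
    Half G u w A (X \ A) B (exceptional G (X \ A) B d) d e L M (3 * (u + w) ^ 4) M S T := by
  have hp := P.p_eq
  have hq := P.q_eq
  have hR := P.R_eq
  have aL : R - 2 * q ≤ A.card := by linarith [rA.lower]
  have aU : (A.card : ℝ) ≤ R + 2 * q := by linarith [rA.upper]
  have bL : R - 2 * q ≤ B.card := by linarith [rB.lower]
  have bU : (B.card : ℝ) ≤ R + 2 * q := by linarith [rB.upper]
  have hc : A.card + (X \ A).card = n := by
    have := Finset.card_sdiff_add_card_eq_card hA
    omega
  have hd : 3 * η * n ≤ d := by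
    have h1 := P.le_d
    have h2 := P.hundred_le_p (k := 0) (by norm_num)
    have h3 := mul_le_mul_of_nonneg_right P.three_le P.p_pos.le
    norm_num at h2
    linarith
  have hm : Miss G d B (X \ A) := miss_of_rough P.eta_pos P.eta_le hX hA rA.lower rB.sparse
    (fun y hy => P.one_sub_mul_le (hdeg y hy)) hd
  have hz := card_exceptional_rough P hX hA hB rA he hdeg
  exact
    { sub := Finset.filter_subset _ _
      miss := hm.mono subset_rfl sdiff_subset
      miss' := miss_sdiff_exceptional G _ _ d
      sparse := fun x hx => by
        refine P.le_e _ ?_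
        linarith [rA.sparse x hx]
      deg := fun hS0 y hy => P.deg_le hS0 hS' hc (hdeg y hy)
        (y := degIn G y A) (z := degIn G y (X \ A))
        (by
          refine (degIn_mono y ?_).trans (degIn_union_le _ _ _)
          rw [Finset.union_sdiff_self_eq_union]
          exact subset_union_right)
        (degIn_le_card _ _)
      card_le := P.card_le aU bL
      le_card := P.le_card bL
      exc := fun z hz => by
        refine P.exc_le ?_
        have := rA.rich z ((Finset.mem_filter.1 hz).1)
        linarith
      size := P.size aL
      size' := P.size' hc aU
      excCard := P.excCard_le hz
      slack := P.slack hc hS hT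
      slack' := P.slack' hc aL bL (P.correction_le aU hS') (P.correction_le bU hT') }

/-- A balanced bipartite graph of large minimum degree which contains a large sparse pair can be
tiled. -/
lemma tileable_of_extremal [Fintype α] {H : SimpleGraph α} {u w : ℕ} {c : α → Bool}
    (D : HData H u w c) (hu : 0 < u) : ∃ a : ℝ, 0 < a ∧ ∃ n₀ : ℕ, ∀ (V : Type) [Fintype V]
      (G : SimpleGraph V) (X Y : Finset V) (n : ℕ), n₀ ≤ n → Disjoint X Y → X.card = n →
      Y.card = n → (∀ x ∈ X, u * n + 4 * (u + w) ^ 4 ≤ (u + w) * degIn G x Y) →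
      (∀ y ∈ Y, u * n + 4 * (u + w) ^ 4 ≤ (u + w) * degIn G y X) →
      u + w ∣ (X ∪ Y).card → ¬ NonExt G X Y n ((w : ℝ) / (u + w : ℕ)) a →
      Tileable H G (X ∪ Y) := by
  obtain ⟨η, hη, hη', n₀, hn₀, hP⟩ := exists_extParams hu D.lt
  refine ⟨η ^ 3, by positivity, n₀, fun V _ G X Y n hn hXY hX hY hdX hdY hdvd hNE => ?_⟩
  obtain ⟨d, e, L, M, p, q, R, P⟩ := hP n hn
  generalize (w : ℝ) / (u + w : ℕ) = ρ at *
  have hn' : 0 < n := hn₀.trans_le hn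
  have hρ : 1 / 2 ≤ ρ := by
    have h1 := P.half_le_R
    rw [← P.R_eq] at h1
    have h2 : (0 : ℝ) < n := by exact_mod_cast hn'
    refine le_of_mul_le_mul_right ?_ h2
    linarith
  unfold NonExt at hNE
  push Not at hNE
  obtain ⟨A₀, hA₀, B₀, hB₀, cA, cB, he⟩ := hNE
  obtain ⟨A, hA, B, hB, rA, rB, heAB⟩ := exists_rough hρ hη hη' hn' hX hY hA₀ hB₀ cA cB he
    (fun x hx => P.one_sub_mul_le (hdX x hx)) (fun y hy => P.one_sub_mul_le (hdY y hy))
  have hh : 0 < u + w := by omega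
  obtain ⟨S, hS, hS'⟩ := exists_correction (u + w) A.card (3 * (u + w) ^ 4) (w * n) hh
  obtain ⟨T, hT, hT'⟩ := exists_correction (u + w) B.card (3 * (u + w) ^ 4) (w * n) hh
  have hAn : A.card ≤ n := hX ▸ Finset.card_le_card hA
  have hBn : B.card ≤ n := hY ▸ Finset.card_le_card hB
  have heBA : (eAB G B A : ℝ) ≤ 33 * η ^ 3 * n ^ 2 := by rwa [eAB_comm]
  have hdA := fun x hx => hdX x (hA hx)
  have hdB := fun y hy => hdY y (hB hy)
  have HA := half_of_rough P hX hA hBn rA rB heAB hdB hS hS' hT hT'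
  have HB := half_of_rough P hY hB hAn rB rA heBA hdA hT hT' hS hS'
  have eX : A ∪ (X \ A) = X := Finset.union_sdiff_of_subset hA
  have eY : B ∪ (Y \ B) = Y := Finset.union_sdiff_of_subset hB
  have hp := P.p_eq
  have hq := P.q_eq
  have hR := P.R_eq
  have aU : (A.card : ℝ) ≤ R + 2 * q := by linarith [rA.upper]
  have bU : (B.card : ℝ) ≤ R + 2 * q := by linarith [rB.upper]
  have hLay : Lay A (X \ A) B (Y \ B) := ⟨disjoint_sdiff, disjoint_sdiff, by rwa [eX, eY]⟩
  have key := tileable_of_layout D hu hLay HA HB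
    (P.sum_le_M (P.correction_le aU hS') (P.correction_le bU hT')
      (card_exceptional_rough P hX hA hBn rA heAB hdB)
      (card_exceptional_rough P hY hB hAn rB heBA hdA))
    P.le_L' (by rwa [eX, eY])
  rwa [eX, eY] at key

lemma tileable_of_no_edges [Fintype α] [Fintype V] {H : SimpleGraph α} (G : SimpleGraph V)
    (hH : ∀ a b, ¬ H.Adj a b) {P : Finset V} {k : ℕ} (hP : P.card = k * Fintype.card α) :
    Tileable H G P := by
  obtain ⟨f, h1, h2, rfl⟩ := exists_partition hP
  refine Tileable.biUnion _ _ (fun i _ => ?_) fun i _ j _ hij => h2 i j hij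
  have := tileable_of_coloring (H := H) (G := G) (fun _ => ()) (fun _ : Unit => f i)
    (fun a b hab => absurd (Subsingleton.elim a b) hab)
    (fun _ => by simp [h1 i]) (fun a b hab => absurd hab (hH a b))
  simpa using this

lemma HData.no_edges [Fintype α] {H : SimpleGraph α} {w : ℕ} {c : α → Bool}
    (D : HData H 0 w c) (a b : α) : ¬ H.Adj a b := by
  intro hab
  have h1 : ∀ x, c x = true := fun x => by
    by_contra hx
    have h2 := D.card_false
    rw [colorCard, Finset.card_eq_zero] at h2
    have : x ∈ univ.filter fun v => c v = false := by simpa using hx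
    rw [h2] at this
    simp at this
  exact D.proper hab (by rw [h1, h1])

lemma BipartiteWith.symm [Fintype V] {G : SimpleGraph V} {X Y : Finset V}
    (h : BipartiteWith G X Y) : BipartiteWith G Y X :=
  ⟨h.disj.symm, by rw [Finset.union_comm, h.cover], fun _ _ hab => (h.cross hab).symm⟩

lemma BipartiteWith.degree_eq [Fintype V] {G : SimpleGraph V} {X Y : Finset V}
    (h : BipartiteWith G X Y) {x : V} (hx : x ∈ X) : G.degree x = degIn G x Y := by
  rw [degIn, ← SimpleGraph.card_neighborFinset_eq_degree]
  congr 1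
  ext y
  rw [SimpleGraph.mem_neighborFinset, Finset.mem_filter]
  refine ⟨fun hy => ⟨?_, hy⟩, fun hy => hy.2⟩
  rcases h.cross hy with h1 | h1
  · exact h1.2
  · exact absurd h1.1 (Finset.disjoint_left.1 h.disj hx)

/-- Theorem 1.4, main theorem. Let `H` be a bipartite graph on `h` vertices
with `hcf(H) = 1`. There are positive integers `m₀` and `c₁ ≤ 4h³` such that every balanced
bipartite graph `G` on `2n = mh` vertices with `m ≥ m₀` and
`δ(G) ≥ (1 - 1/χ_cr(H))n + c₁ = (σ(H)/h)n + c₁` contains an `H`-factor. -/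
theorem statement_2 {α : Type*} [Fintype α] (H : SimpleGraph α) (h : ℕ)
    (hh : Fintype.card α = h) (hbip : IsBip H) (hhcf : HcfOne H) :
    ∃ m₀ c₁ : ℕ, 0 < m₀ ∧ 0 < c₁ ∧ c₁ ≤ 4 * h ^ 3 ∧
      ∀ (V : Type) [Fintype V], ∀ (G : SimpleGraph V) (X Y : Finset V) (m n : ℕ),
        m₀ ≤ m → 2 * n = m * h → BipartiteWith G X Y → X.card = n → Y.card = n →
        (∀ v : V, ((sigmaBip H : ℝ) / h) * n + c₁ ≤ G.degree v) →
        HasHFactor H G := by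
  obtain ⟨w, c, D, hw⟩ := exists_hData hbip hhcf
  generalize sigmaBip H = u at *
  have hpos : 0 < h := by have := D.lt; omega
  have hhuw : h = u + w := by omega
  rcases Nat.eq_zero_or_pos u with rfl | hu
  · refine ⟨1, 4 * h ^ 3, one_pos, by positivity, le_rfl, ?_⟩
    intro V _ G X Y m n _ hmn hG hX hY _
    have h1 : (univ : Finset V).card = m * Fintype.card α := by
      rw [← hG.cover, Finset.card_union_of_disjoint hG.disj, hX, hY, hh]
      omega
    exact tileable_of_no_edges G D.no_edges h1
  · obtain ⟨a, ha, n₁, hE⟩ := tileable_of_extremal D hu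
    obtain ⟨n₂, hN⟩ := tileable_of_nonExt D hu ha
    refine ⟨2 * (n₁ + n₂) + 1, 4 * h ^ 3, by positivity, by positivity, le_rfl, ?_⟩
    intro V _ G X Y m n hm hmn hG hX hY hdeg
    have hmm : m ≤ 2 * n := hmn ▸ Nat.le_mul_of_pos_right m hpos
    have hcard : (X ∪ Y).card = m * (u + w) := by
      rw [Finset.card_union_of_disjoint hG.disj, hX, hY, ← hhuw]
      omega
    have hdvd : u + w ∣ (X ∪ Y).card := hcard ▸ Dvd.intro_left m rfl
    have hdeg' : ∀ v : V, u * n + 4 * (u + w) ^ 4 ≤ (u + w) * G.degree v := fun v => by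
      rw [← hhuw]
      have hh0 : (0 : ℝ) < h := by exact_mod_cast hpos
      have h1 := mul_le_mul_of_nonneg_left (hdeg v) hh0.le
      have h2 : (h : ℝ) * ((u : ℝ) / h * n + (4 * h ^ 3 : ℕ)) = u * n + 4 * h ^ 4 := by
        push_cast
        field_simp
      rw [h2] at h1
      exact_mod_cast h1
    have hdX : ∀ x ∈ X, u * n + 4 * (u + w) ^ 4 ≤ (u + w) * degIn G x Y := fun x hx => by
      rw [← hG.degree_eq hx]
      exact hdeg' x
    have hdY : ∀ y ∈ Y, u * n + 4 * (u + w) ^ 4 ≤ (u + w) * degIn G y X := fun y hy => by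
      rw [← hG.symm.degree_eq hy]
      exact hdeg' y
    have key : Tileable H G (X ∪ Y) := by
      by_cases hNE : NonExt G X Y n ((w : ℝ) / (u + w : ℕ)) a
      · exact hN V G X Y n (by omega)
          ⟨hG.disj, hX, hY, fun x hx => (Nat.le_add_right _ _).trans (hdX x hx),
            fun y hy => (Nat.le_add_right _ _).trans (hdY y hy)⟩ hdvd hNE
      · exact hE V G X Y n (by omega) hG.disj hX hY hdX hdY hdvd hNE
    rw [hG.cover] at key
    exact key

end BipTiling
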